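/- Assume ρ² ∈ ℚ and r ∈ {0,1}, let K ⊂ (0,+∞) be an unbounded set with sup_{t∈K} D̃(ρ,t)/t² < ∞, and assume Assumptions A1 and A2. Let τ_e, τ_n ≥ 1 be such that N_e = (τ_e/π)·κh and N_n = (τ_n/π)·κh are positive integers and η := (τ_e/(ρτ_n))·exp(−π/(2τ_n)) > 1. Then there exists a constant C > 0 depending only on ρ, r, τ_e, τ_n such that for every solution u of −Δu − κ²u = 0 analytic on an open neighborhood of the closure of Ω and every sufficiently large κh ∈ K: inf over v ∈ V_N(T_h) of ‖u − v‖_{H^r_κ(Ω)} ≤ C·|N_h|·(κh)^5·η^{−(2/π)τ_n·κh}·‖u‖_{H^{2N_n+1}_κ(Ω)}. -/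

import Mathlib

open MeasureTheory Real Set
open scoped Real Classical ENNReal NNReal

noncomputable section

/-- Partial derivative in the first coordinate. -/
def pd1 (f : ℝ × ℝ → ℂ) : ℝ × ℝ → ℂ := fun x => deriv (fun t => f (t, x.2)) x.1

/-- Partial derivative in the second coordinate. -/
def pd2 (f : ℝ × ℝ → ℂ) : ℝ × ℝ → ℂ := fun x => deriv (fun t => f (x.1, t)) x.2

/-- Mixed partial derivative `∂₁^i ∂₂^j`. -/
def pdM (i j : ℕ) (f : ℝ × ℝ → ℂ) : ℝ × ℝ → ℂ := pd1^[i] (pd2^[j] f)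

/-- Multi-indices of order at most `M`. -/
def idxLe (M : ℕ) : Finset (ℕ × ℕ) :=
  (Finset.range (M + 1) ×ˢ Finset.range (M + 1)).filter fun p => p.1 + p.2 ≤ M

/-- κ-weighted Sobolev inner product of order `M` on `D`. -/
def sobInner (κ : ℝ) (M : ℕ) (D : Set (ℝ × ℝ)) (f g : ℝ × ℝ → ℂ) : ℂ :=
  ∑ p ∈ idxLe M, ((κ : ℂ) ^ (2 * (p.1 + p.2)))⁻¹ *
    ∫ x in D, pdM p.1 p.2 f x * (starRingEnd ℂ) (pdM p.1 p.2 g x)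

/-- Square of the κ-weighted Sobolev norm of order `M` on `D`. -/
def sobNormSq (κ : ℝ) (M : ℕ) (D : Set (ℝ × ℝ)) (f : ℝ × ℝ → ℂ) : ℝ :=
  ∑ p ∈ idxLe M, (κ ^ (2 * (p.1 + p.2)))⁻¹ * ∫ x in D, ‖pdM p.1 p.2 f x‖ ^ 2

/-- κ-weighted Sobolev norm of order `M` on `D`. -/
def sobNorm (κ : ℝ) (M : ℕ) (D : Set (ℝ × ℝ)) (f : ℝ × ℝ → ℂ) : ℝ :=
  Real.sqrt (sobNormSq κ M D f)

/-- Membership in `H^M_κ(D)` (for pointwise-differentiable representatives). -/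
def MemSob (M : ℕ) (D : Set (ℝ × ℝ)) (f : ℝ × ℝ → ℂ) : Prop :=
  ∀ p ∈ idxLe M, IntegrableOn (fun x => ‖pdM p.1 p.2 f x‖ ^ 2) D

/-- `ν̂_n = nπ/(κ ĥ₁)`. -/
def nuHat (κ h1 : ℝ) (n : ℕ) : ℝ := n * π / (κ * h1)

/-- Principal complex square root of a real number. -/
def csqrt (r : ℝ) : ℂ := (r : ℂ) ^ (1 / 2 : ℂ)

/-- The single-edge Helmholtz mode `φ̂_n` on the reference rectangle. -/
def phiHat (κ h1 h2 : ℝ) (n : ℕ) : ℝ × ℝ → ℂ := fun x =>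
  Complex.sin (↑(κ * nuHat κ h1 n) * (x.1 : ℂ)) *
    Complex.sin ((x.2 : ℂ) * (κ : ℂ) * csqrt (1 - nuHat κ h1 n ^ 2)) /
    Complex.sin ((h2 : ℂ) * (κ : ℂ) * csqrt (1 - nuHat κ h1 n ^ 2))

/-- The open reference rectangle `K̂ = (0,ĥ₁) × (0,ĥ₂)`. -/
def Khat (h1 h2 : ℝ) : Set (ℝ × ℝ) := Ioo 0 h1 ×ˢ Ioo 0 h2

/-- Assumption A0: `κ²` is not a Δ-Neumann eigenvalue of the rectangle with sides `h1, h2`. -/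
def A0cond (κ h1 h2 : ℝ) : Prop :=
  ∀ n m : ℕ, κ ^ 2 ≠ (n * π / h1) ^ 2 + (m * π / h2) ^ 2

/-- Distributional (weak) solution of the homogeneous Helmholtz equation on `D`. -/
def WeakHelmholtz (κ : ℝ) (D : Set (ℝ × ℝ)) (u : ℝ × ℝ → ℂ) : Prop :=
  IntegrableOn u D ∧
  ∀ φ : ℝ × ℝ → ℂ, ContDiff ℝ (⊤ : ℕ∞) φ → HasCompactSupport φ → tsupport φ ⊆ D →
    ∫ x in D, u x * (pdM 2 0 φ x + pdM 0 2 φ x + (κ : ℂ) ^ 2 * φ x) = 0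

/-- The trace of `u` on the top edge (at height `h2`). -/
def traceTop (h2 : ℝ) (u : ℝ × ℝ → ℂ) : ℝ → ℂ := fun t => u (t, h2)

/-- The class `S^{N,M}_κ(K̂, ŝ)` of Helmholtz solutions with trace supported on the top edge. -/
structure SLoc (κ h1 h2 : ℝ) (N M : ℕ) (u : ℝ × ℝ → ℂ) : Prop where
  cont : ContinuousOn u (Icc 0 h1 ×ˢ Icc 0 h2)
  mem : MemSob 1 (Khat h1 h2) u
  helm : WeakHelmholtz κ (Khat h1 h2) u
  left : ∀ y ∈ Icc (0 : ℝ) h2, u (0, y) = 0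
  right : ∀ y ∈ Icc (0 : ℝ) h2, u (h1, y) = 0
  bottom : ∀ x ∈ Icc (0 : ℝ) h1, u (x, 0) = 0
  traceReg : ContDiffOn ℝ M (traceTop h2 u) (Icc 0 h1)
  endpt0 : ∀ j < N, iteratedDerivWithin (2 * j) (traceTop h2 u) (Icc 0 h1) 0 = 0
  endpt1 : ∀ j < N, iteratedDerivWithin (2 * j) (traceTop h2 u) (Icc 0 h1) h1 = 0

/-- Square of the trace seminorm `|u|_{H^M_κ(ŝ)}`. -/
def traceSemiSq (κ h1 h2 : ℝ) (M : ℕ) (u : ℝ × ℝ → ℂ) : ℝ :=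
  (κ ^ (2 * M))⁻¹ * ∫ t in (0 : ℝ)..h1, ‖iteratedDerivWithin M (traceTop h2 u) (Icc 0 h1) t‖ ^ 2

/-- The `L²(ŝ)` inner product of traces on the top edge. -/
def traceL2Inner (h1 h2 : ℝ) (u v : ℝ × ℝ → ℂ) : ℂ :=
  ∫ t in (0 : ℝ)..h1, u (t, h2) * (starRingEnd ℂ) (v (t, h2))

/-- The squared `L²(ŝ)` norm of the trace on the top edge. -/
def traceL2Sq (h1 h2 : ℝ) (u : ℝ × ℝ → ℂ) : ℝ :=
  ∫ t in (0 : ℝ)..h1, ‖u (t, h2)‖ ^ 2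


/-! ### Cartesian mesh machinery -/

/-- The open cell of the Cartesian grid indexed by `c ∈ ℤ²`. -/
def cellO (h1 h2 : ℝ) (c : ℤ × ℤ) : Set (ℝ × ℝ) :=
  Ioo ((c.1 : ℝ) * h1) (((c.1 : ℝ) + 1) * h1) ×ˢ Ioo ((c.2 : ℝ) * h2) (((c.2 : ℝ) + 1) * h2)

/-- The closed cell of the Cartesian grid indexed by `c ∈ ℤ²`. -/
def cellC (h1 h2 : ℝ) (c : ℤ × ℤ) : Set (ℝ × ℝ) :=
  Icc ((c.1 : ℝ) * h1) (((c.1 : ℝ) + 1) * h1) ×ˢ Icc ((c.2 : ℝ) * h2) (((c.2 : ℝ) + 1) * h2)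

/-- Horizontal edges of the mesh: `(i,j)` corresponds to `[i h₁,(i+1)h₁] × {j h₂}`. -/
def hEdges (cells : Finset (ℤ × ℤ)) : Finset (ℤ × ℤ) :=
  cells ∪ cells.image fun c => (c.1, c.2 + 1)

/-- Vertical edges of the mesh: `(i,j)` corresponds to `{i h₁} × [j h₂,(j+1)h₂]`. -/
def vEdges (cells : Finset (ℤ × ℤ)) : Finset (ℤ × ℤ) :=
  cells ∪ cells.image fun c => (c.1 + 1, c.2)

/-- Nodes of the mesh: `(i,j)` corresponds to the point `(i h₁, j h₂)`. -/
def meshNodes (cells : Finset (ℤ × ℤ)) : Finset (ℤ × ℤ) :=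
  ((cells ∪ cells.image fun c => (c.1 + 1, c.2)) ∪
    cells.image fun c => (c.1, c.2 + 1)) ∪
    cells.image fun c => (c.1 + 1, c.2 + 1)

/-- The point of `ℝ²` corresponding to the node index `p`. -/
def nodePt (h1 h2 : ℝ) (p : ℤ × ℤ) : ℝ × ℝ := ((p.1 : ℝ) * h1, (p.2 : ℝ) * h2)

/-- `Ω` is exactly tessellated by the cells of the Cartesian grid indexed by `cells`. -/
def IsTessellation (h1 h2 : ℝ) (cells : Finset (ℤ × ℤ)) (Ω : Set (ℝ × ℝ)) : Prop :=
  cells.Nonempty ∧ Ω = interior (⋃ c ∈ cells, cellC h1 h2 c) ∧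
    closure Ω = ⋃ c ∈ cells, cellC h1 h2 c

/-- The edge basis function `φ_{s,n}` associated with the horizontal edge `e`. -/
def phiEdgeH (κ h1 h2 : ℝ) (cells : Finset (ℤ × ℤ)) (e : ℤ × ℤ) (n : ℕ) : ℝ × ℝ → ℂ :=
  fun x =>
    if e ∈ cells ∧ x ∈ cellC h1 h2 e then
      phiHat κ h1 h2 n (x.1 - (e.1 : ℝ) * h1, h2 + ((e.2 : ℝ) * h2 - x.2))
    else if (e.1, e.2 - 1) ∈ cells ∧ x ∈ cellC h1 h2 (e.1, e.2 - 1) then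
      phiHat κ h1 h2 n (x.1 - (e.1 : ℝ) * h1, h2 - ((e.2 : ℝ) * h2 - x.2))
    else 0

/-- The edge basis function `φ_{s,n}` associated with the vertical edge `e`. -/
def phiEdgeV (κ h1 h2 : ℝ) (cells : Finset (ℤ × ℤ)) (e : ℤ × ℤ) (n : ℕ) : ℝ × ℝ → ℂ :=
  fun x =>
    if e ∈ cells ∧ x ∈ cellC h1 h2 e then
      phiHat κ h2 h1 n (x.2 - (e.2 : ℝ) * h2, h1 + ((e.1 : ℝ) * h1 - x.1))
    else if (e.1 - 1, e.2) ∈ cells ∧ x ∈ cellC h1 h2 (e.1 - 1, e.2) then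
      phiHat κ h2 h1 n (x.2 - (e.2 : ℝ) * h2, h1 - ((e.1 : ℝ) * h1 - x.1))
    else 0

/-- The node basis function `ψ_{p,n}` associated with the node `p`. -/
def psiNode (κ h1 h2 : ℝ) (p : ℤ × ℤ) (n : ℕ) : ℝ × ℝ → ℂ :=
  fun x =>
    if x ∈ Icc (((p.1 : ℝ) - 1) * h1) (((p.1 : ℝ) + 1) * h1) ×ˢ
        Icc ((p.2 : ℝ) * h2) (((p.2 : ℝ) + 1) * h2) then
      phiHat κ (2 * h1) h2 (2 * n - 1) (h1 - ((p.1 : ℝ) * h1 - x.1), h2 + ((p.2 : ℝ) * h2 - x.2))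
    else if x ∈ Icc (((p.1 : ℝ) - 1) * h1) (((p.1 : ℝ) + 1) * h1) ×ˢ
        Icc (((p.2 : ℝ) - 1) * h2) ((p.2 : ℝ) * h2) then
      phiHat κ (2 * h1) h2 (2 * n - 1) (h1 - ((p.1 : ℝ) * h1 - x.1), h2 - ((p.2 : ℝ) * h2 - x.2))
    else 0

/-- The set of edge basis functions with at most `Ne` modes per edge. -/
def edgeFuns (κ h1 h2 : ℝ) (cells : Finset (ℤ × ℤ)) (Ne : ℕ) : Set (ℝ × ℝ → ℂ) :=
  {f | ∃ e ∈ hEdges cells, ∃ n : ℕ, 1 ≤ n ∧ n ≤ Ne ∧ f = phiEdgeH κ h1 h2 cells e n} ∪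
  {f | ∃ e ∈ vEdges cells, ∃ n : ℕ, 1 ≤ n ∧ n ≤ Ne ∧ f = phiEdgeV κ h1 h2 cells e n}

/-- The set of node basis functions with at most `Nn` modes per node. -/
def nodeFuns (κ h1 h2 : ℝ) (cells : Finset (ℤ × ℤ)) (Nn : ℕ) : Set (ℝ × ℝ → ℂ) :=
  {f | ∃ p ∈ meshNodes cells, ∃ n : ℕ, 1 ≤ n ∧ n ≤ Nn ∧ f = psiNode κ h1 h2 p n}

/-- The edge-based Trefftz space `V_{N_e}(Σ_h)`. -/
def edgeSpace (κ h1 h2 : ℝ) (cells : Finset (ℤ × ℤ)) (Ne : ℕ) :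
    Submodule ℂ (ℝ × ℝ → ℂ) :=
  Submodule.span ℂ (edgeFuns κ h1 h2 cells Ne)

/-- The combined edge-and-node Trefftz space `V_𝐍(T_h)`. -/
def combinedSpace (κ h1 h2 : ℝ) (cells : Finset (ℤ × ℤ)) (Ne Nn : ℕ) :
    Submodule ℂ (ℝ × ℝ → ℂ) :=
  Submodule.span ℂ (edgeFuns κ h1 h2 cells Ne ∪ nodeFuns κ h1 h2 cells Nn)

/-- Square of the broken Sobolev norm `‖·‖²_{H^r_κ(T_h)}`. -/
def brokenNormSq (κ : ℝ) (r : ℕ) (h1 h2 : ℝ) (cells : Finset (ℤ × ℤ))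
    (f : ℝ × ℝ → ℂ) : ℝ :=
  ∑ c ∈ cells, sobNormSq κ r (cellO h1 h2 c) f

/-- The global class `S^{N,M}_κ(T_h)`. -/
structure SGlob (κ h1 h2 : ℝ) (cells : Finset (ℤ × ℤ)) (Ω : Set (ℝ × ℝ)) (N M : ℕ)
    (u : ℝ × ℝ → ℂ) : Prop where
  cont : ContinuousOn u (closure Ω)
  mem : ∀ c ∈ cells, MemSob 1 (cellO h1 h2 c) u
  helm : ∀ c ∈ cells, WeakHelmholtz κ (cellO h1 h2 c) u
  htraceReg : ∀ e ∈ hEdges cells,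
    ContDiffOn ℝ M (fun t => u (t, (e.2 : ℝ) * h2)) (Icc ((e.1 : ℝ) * h1) (((e.1 : ℝ) + 1) * h1))
  hend : ∀ e ∈ hEdges cells, ∀ j < N,
    iteratedDerivWithin (2 * j) (fun t => u (t, (e.2 : ℝ) * h2))
        (Icc ((e.1 : ℝ) * h1) (((e.1 : ℝ) + 1) * h1)) ((e.1 : ℝ) * h1) = 0 ∧
    iteratedDerivWithin (2 * j) (fun t => u (t, (e.2 : ℝ) * h2))
        (Icc ((e.1 : ℝ) * h1) (((e.1 : ℝ) + 1) * h1)) (((e.1 : ℝ) + 1) * h1) = 0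
  vtraceReg : ∀ e ∈ vEdges cells,
    ContDiffOn ℝ M (fun t => u ((e.1 : ℝ) * h1, t)) (Icc ((e.2 : ℝ) * h2) (((e.2 : ℝ) + 1) * h2))
  vend : ∀ e ∈ vEdges cells, ∀ j < N,
    iteratedDerivWithin (2 * j) (fun t => u ((e.1 : ℝ) * h1, t))
        (Icc ((e.2 : ℝ) * h2) (((e.2 : ℝ) + 1) * h2)) ((e.2 : ℝ) * h2) = 0 ∧
    iteratedDerivWithin (2 * j) (fun t => u ((e.1 : ℝ) * h1, t))
        (Icc ((e.2 : ℝ) * h2) (((e.2 : ℝ) + 1) * h2)) (((e.2 : ℝ) + 1) * h2) = 0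

/-- Square of the skeleton seminorm `|u|²_{H^μ_κ(Σ_h)}`. -/
def skelSemiSq (κ h1 h2 : ℝ) (cells : Finset (ℤ × ℤ)) (μ : ℕ) (u : ℝ × ℝ → ℂ) : ℝ :=
  (∑ e ∈ hEdges cells, (κ ^ (2 * μ))⁻¹ *
    ∫ t in ((e.1 : ℝ) * h1)..(((e.1 : ℝ) + 1) * h1),
      ‖iteratedDerivWithin μ (fun t => u (t, (e.2 : ℝ) * h2))
          (Icc ((e.1 : ℝ) * h1) (((e.1 : ℝ) + 1) * h1)) t‖ ^ 2) +
  ∑ e ∈ vEdges cells, (κ ^ (2 * μ))⁻¹ *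
    ∫ t in ((e.2 : ℝ) * h2)..(((e.2 : ℝ) + 1) * h2),
      ‖iteratedDerivWithin μ (fun t => u ((e.1 : ℝ) * h1, t))
          (Icc ((e.2 : ℝ) * h2) (((e.2 : ℝ) + 1) * h2)) t‖ ^ 2

/-- `ν̃_n = (2n−1)π/(2κh₁)`. -/
def nuTil (κ h1 : ℝ) (n : ℕ) : ℝ := (2 * (n : ℝ) - 1) * π / (2 * (κ * h1))

/-- `d̃`: distance to the node-associated propagative resonances. -/
def dTil (κ h1 h2 : ℝ) : ℝ :=
  sInf {d : ℝ | ∃ n : ℕ, 1 ≤ n ∧ nuTil κ h1 n < 1 ∧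
    ∃ m : ℕ, d = |Real.sqrt (1 - nuTil κ h1 n ^ 2) - m * π / (κ * h2)|}

/-- `d̃₀`. -/
def dTil0 (κ h1 : ℝ) : ℝ :=
  sInf {d : ℝ | ∃ n : ℕ, 1 ≤ n ∧ 1 < nuTil κ h1 n ∧ d = Real.sqrt (nuTil κ h1 n ^ 2 - 1)}

/-- `χ_N = min(ρe^{κh}/(κh), e·max(1,κh)^{2(N−1)})`. -/
def chiN (ρ kh : ℝ) (N : ℕ) : ℝ :=
  min (ρ * Real.exp kh / kh) (Real.exp 1 * max 1 kh ^ (2 * (N - 1)))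


/-- Assumption A2: `κ² ∉ σ(2h₁,h₂)`. -/
def A2cond (κ h1 h2 : ℝ) : Prop := A0cond κ (2 * h1) h2

/-- `u` is a Helmholtz solution analytic on an open neighborhood of `closure Ω`. -/
def AnalyticHelmholtz (κ : ℝ) (Ω : Set (ℝ × ℝ)) (u : ℝ × ℝ → ℂ) : Prop :=
  (∃ U : Set (ℝ × ℝ), IsOpen U ∧ closure Ω ⊆ U ∧ AnalyticOnNhd ℝ u U) ∧
    ∀ x ∈ Ω, pdM 2 0 u x + pdM 0 2 u x + (κ : ℂ) ^ 2 * u x = 0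

/-- `ν̃_n(t) = (2n−1)π/(2t)`. -/
def nuT (t : ℝ) (n : ℕ) : ℝ := (2 * (n : ℝ) - 1) * π / (2 * t)

/-- `d̃(ρ,t)`, as an extended nonnegative real. -/
def dT (ρ t : ℝ) : ℝ≥0∞ :=
  ⨅ (n : ℕ) (_ : 1 ≤ n) (_ : nuT t n < 1) (m : ℕ),
    ENNReal.ofReal |Real.sqrt (1 - nuT t n ^ 2) - m * π * ρ / t|

/-- `d̃₀(t)`, as an extended nonnegative real. -/
def dT0 (t : ℝ) : ℝ≥0∞ :=
  ⨅ (n : ℕ) (_ : 1 ≤ n) (_ : 1 < nuT t n), ENNReal.ofReal (Real.sqrt (nuT t n ^ 2 - 1))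

/-- `D̃(ρ,t) = 1 + 1/d̃(ρ,t) + 1/√(d̃₀(t))`. -/
def DT (ρ t : ℝ) : ℝ≥0∞ := 1 + 1 / dT ρ t + 1 / (dT0 t ^ (1 / 2 : ℝ))


/-! ### Sine series on an interval -/

/-- The sine mode `sin (nπx/h)`, as a complex number. -/
def sineMode (h : ℝ) (n : ℕ) (x : ℝ) : ℂ := ((Real.sin (n * π / h * x) : ℝ) : ℂ)

/-- The cosine mode `cos (nπx/h)`, as a complex number. -/
def cosMode (h : ℝ) (n : ℕ) (x : ℝ) : ℂ := ((Real.cos (n * π / h * x) : ℝ) : ℂ)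

lemma continuous_sineMode (h : ℝ) (n : ℕ) : Continuous (sineMode h n) := by
  unfold sineMode; fun_prop

lemma continuous_cosMode (h : ℝ) (n : ℕ) : Continuous (cosMode h n) := by
  unfold cosMode; fun_prop

lemma norm_sineMode_le (h : ℝ) (n : ℕ) (x : ℝ) : ‖sineMode h n x‖ ≤ 1 := by
  rw [sineMode, Complex.norm_real]; exact Real.abs_sin_le_one _

lemma norm_cosMode_le (h : ℝ) (n : ℕ) (x : ℝ) : ‖cosMode h n x‖ ≤ 1 := by
  rw [cosMode, Complex.norm_real]; exact Real.abs_cos_le_one _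

lemma sineMode_zero (h : ℝ) (n : ℕ) : sineMode h n 0 = 0 := by simp [sineMode]

lemma sineMode_right {h : ℝ} (hh : 0 < h) (n : ℕ) : sineMode h n h = 0 := by
  rw [sineMode, div_mul_cancel₀ _ hh.ne', Real.sin_nat_mul_pi]; simp

lemma cosMode_right {h : ℝ} (hh : 0 < h) (n : ℕ) : cosMode h n h = (-1) ^ n := by
  rw [cosMode, div_mul_cancel₀ _ hh.ne', Real.cos_nat_mul_pi]; simp

lemma cosMode_zero (h : ℝ) (n : ℕ) : cosMode h n 0 = 1 := by simp [cosMode]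

lemma hasDerivAt_sineMode (h : ℝ) (n : ℕ) (x : ℝ) :
    HasDerivAt (sineMode h n) (((n * π / h : ℝ) : ℂ) * cosMode h n x) x := by
  have := (((hasDerivAt_id' x).const_mul (n * π / h)).sin).ofReal_comp
  unfold sineMode cosMode
  convert this using 1

  push_cast; ring

lemma hasDerivAt_cosMode (h : ℝ) (n : ℕ) (x : ℝ) :
    HasDerivAt (cosMode h n) (-((n * π / h : ℝ) : ℂ) * sineMode h n x) x := by
  have := (((hasDerivAt_id' x).const_mul (n * π / h)).cos).ofReal_comp
  unfold sineMode cosMode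
  convert this using 1

  push_cast; ring

lemma HasDerivAt.continuousOn_Icc {f f' : ℝ → ℂ} {h : ℝ}
    (hf : ∀ x ∈ Icc 0 h, HasDerivAt f (f' x) x) : ContinuousOn f (Icc 0 h) :=
  fun x hx => (hf x hx).continuousAt.continuousWithinAt

lemma integral_deriv_mul_sineMode {h : ℝ} (hh : 0 < h) (n : ℕ) {f f' : ℝ → ℂ}
    (hf : ∀ x ∈ Icc 0 h, HasDerivAt f (f' x) x) (hf' : ContinuousOn f' (Icc 0 h)) :
    ∫ x in (0 : ℝ)..h, f' x * sineMode h n x =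
      -(((n * π / h : ℝ) : ℂ) * ∫ x in (0 : ℝ)..h, f x * cosMode h n x) := by
  have hu : uIcc 0 h = Icc 0 h := uIcc_of_le hh.le
  have := intervalIntegral.integral_mul_deriv_eq_deriv_mul (a := 0) (b := h)
    (u := sineMode h n) (v := f) (u' := fun x => ((n * π / h : ℝ) : ℂ) * cosMode h n x) (v' := f')
    (fun x _ => hasDerivAt_sineMode h n x) (fun x hx => hf x (hu ▸ hx))
    ((continuous_const.mul (continuous_cosMode h n)).intervalIntegrable _ _)
    ((hu ▸ hf').intervalIntegrable)
  rw [sineMode_zero, sineMode_right hh] at this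
  simp only [zero_mul, sub_zero, zero_sub] at this
  rw [show (fun x => f' x * sineMode h n x) = fun x => sineMode h n x * f' x by
    funext x; ring, this, ← intervalIntegral.integral_const_mul]
  congr 2; funext x; ring

lemma integral_deriv_mul_cosMode {h : ℝ} (hh : 0 < h) (n : ℕ) {f f' : ℝ → ℂ}
    (hf : ∀ x ∈ Icc 0 h, HasDerivAt f (f' x) x) (hf' : ContinuousOn f' (Icc 0 h)) :
    ∫ x in (0 : ℝ)..h, f' x * cosMode h n x =
      (-1) ^ n * f h - f 0 + ((n * π / h : ℝ) : ℂ) * ∫ x in (0 : ℝ)..h, f x * sineMode h n x := by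
  have hu : uIcc 0 h = Icc 0 h := uIcc_of_le hh.le
  have := intervalIntegral.integral_mul_deriv_eq_deriv_mul (a := 0) (b := h)
    (u := cosMode h n) (v := f) (u' := fun x => -((n * π / h : ℝ) : ℂ) * sineMode h n x) (v' := f')
    (fun x _ => hasDerivAt_cosMode h n x) (fun x hx => hf x (hu ▸ hx))
    ((continuous_const.mul (continuous_sineMode h n)).intervalIntegrable _ _)
    ((hu ▸ hf').intervalIntegrable)
  rw [cosMode_zero, cosMode_right hh] at this
  rw [show (fun x => f' x * cosMode h n x) = fun x => cosMode h n x * f' x by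
    funext x; ring, this, ← intervalIntegral.integral_const_mul, sub_eq_add_neg,
    ← intervalIntegral.integral_neg, one_mul]
  congr 2; funext x; ring

lemma integral_deriv2_mul_sineMode {h : ℝ} (hh : 0 < h) (n : ℕ) {f f' f'' : ℝ → ℂ}
    (hf : ∀ x ∈ Icc 0 h, HasDerivAt f (f' x) x) (hf' : ∀ x ∈ Icc 0 h, HasDerivAt f' (f'' x) x)
    (hf'' : ContinuousOn f'' (Icc 0 h)) :
    ∫ x in (0 : ℝ)..h, f'' x * sineMode h n x =
      ((n * π / h : ℝ) : ℂ) * (f 0 - (-1) ^ n * f h) -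
        ((n * π / h : ℝ) : ℂ) ^ 2 * ∫ x in (0 : ℝ)..h, f x * sineMode h n x := by
  rw [integral_deriv_mul_sineMode hh n hf' hf'',
    integral_deriv_mul_cosMode hh n hf (HasDerivAt.continuousOn_Icc hf')]
  ring

/-- Sine coefficients of a function whose even derivatives vanish at the end points decay like a
high power of the frequency. -/
lemma norm_integral_mul_sineMode_le {h : ℝ} (hh : 0 < h) {n : ℕ} (hn : 1 ≤ n) (M : ℝ) (N : ℕ) :
    ∀ G : ℕ → ℝ → ℂ, (∀ k, ∀ x ∈ Icc 0 h, HasDerivAt (G k) (G (k + 1) x) x) →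
    (∀ j ≤ N, G (2 * j) 0 = 0 ∧ G (2 * j) h = 0) →
    (∀ x ∈ Icc 0 h, ‖G (2 * N + 1) x‖ ≤ M) →
    ‖∫ x in (0 : ℝ)..h, G 0 x * sineMode h n x‖ ≤ (h / (n * π)) ^ (2 * N + 1) * (h * M) := by
  have hn0 : (0 : ℝ) < n := by exact_mod_cast hn
  have hc : (0 : ℝ) < n * π / h := by positivity
  induction N with
  | zero =>
    intro G hG h0 hM
    have h1 := integral_deriv_mul_cosMode hh n (hG 0)
      (HasDerivAt.continuousOn_Icc (hG 1))
    obtain ⟨h00, h0h⟩ := h0 0 le_rfl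
    simp only [mul_zero] at h00 h0h
    rw [h00, h0h] at h1
    simp only [mul_zero, sub_zero, zero_add] at h1
    have hb : ‖∫ x in (0 : ℝ)..h, G 1 x * cosMode h n x‖ ≤ M * |h - 0| := by
      apply intervalIntegral.norm_integral_le_of_norm_le_const
      intro x hx
      rw [uIoc_of_le hh.le] at hx
      have hx' : x ∈ Icc 0 h := ⟨hx.1.le, hx.2⟩
      rw [norm_mul]
      calc _ ≤ ‖G 1 x‖ * 1 := by gcongr; exact norm_cosMode_le _ _ _
        _ ≤ M := by rw [mul_one]; exact hM x hx'
    rw [h1, norm_mul, Complex.norm_real, Real.norm_of_nonneg hc.le, sub_zero, abs_of_pos hh] at hb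
    have : h / (n * π) = (n * π / h)⁻¹ := by rw [inv_div]
    rw [this, mul_zero, zero_add, pow_one, ← div_eq_inv_mul, le_div_iff₀ hc]
    linarith
  | succ N ih =>
    intro G hG h0 hM
    have h2 := integral_deriv2_mul_sineMode hh n (hG 0) (hG 1)
      (HasDerivAt.continuousOn_Icc (hG 2))
    obtain ⟨h00, h0h⟩ := h0 0 (Nat.zero_le _)
    simp only [mul_zero] at h00 h0h
    rw [h00, h0h] at h2
    have := ih (fun k => G (k + 2)) (fun k => hG (k + 2))
      (fun j hj => h0 (j + 1) (by omega)) (fun x hx => hM x hx)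
    simp only [mul_zero, sub_zero, zero_sub, zero_add] at h2 this
    rw [show G (1 + 1) = G 2 from rfl] at h2
    rw [h2, norm_neg, norm_mul, norm_pow, Complex.norm_real,
      Real.norm_of_nonneg hc.le] at this
    rw [show 2 * (N + 1) + 1 = (2 * N + 1) + 2 by ring, pow_add]
    have e : (h / (n * π)) ^ 2 = ((n * π / h) ^ 2)⁻¹ := by rw [← inv_pow, inv_div]
    rw [mul_right_comm, e, ← div_eq_mul_inv, le_div_iff₀ (by positivity)]
    linarith

lemma integral_sineMode_mul_sineMode {h : ℝ} (hh : 0 < h) {n m : ℕ} (hm : 1 ≤ m) :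
    ∫ x in (0 : ℝ)..h, sineMode h n x * sineMode h m x =
      if n = m then ((h / 2 : ℝ) : ℂ) else 0 := by
  have hm0 : (0 : ℝ) < m := by exact_mod_cast hm
  split_ifs with hnm
  · subst hnm
    have h1 : ∀ x, sineMode h n x * sineMode h n x =
        ((1 / 2 : ℝ) : ℂ) - ((1 / 2 : ℝ) : ℂ) * cosMode h (2 * n) x := by
      intro x
      have : Real.cos (((2 * n : ℕ) : ℝ) * π / h * x) = 1 - 2 * Real.sin (n * π / h * x) ^ 2 := by
        rw [show ((2 * n : ℕ) : ℝ) * π / h * x = 2 * (n * π / h * x) by push_cast; ring,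
          Real.cos_two_mul, Real.cos_sq']
        ring
      unfold sineMode cosMode
      rw [this]
      push_cast; ring
    have h2 := integral_deriv_mul_sineMode hh (2 * n) (f := fun _ => 1) (f' := fun _ => 0)
      (fun x _ => hasDerivAt_const _ _) continuousOn_const
    simp only [zero_mul, one_mul, intervalIntegral.integral_zero] at h2
    have hc : (((((2 * n : ℕ) : ℝ) * π / h : ℝ)) : ℂ) ≠ 0 := by
      rw [Complex.ofReal_ne_zero]; push_cast; positivity
    have h3 : ∫ x in (0 : ℝ)..h, cosMode h (2 * n) x = 0 := by
      have := h2.symm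
      rw [neg_eq_zero] at this
      exact (mul_eq_zero.mp this).resolve_left hc
    simp_rw [h1]
    have hi : IntervalIntegrable (fun x => ((1 / 2 : ℝ) : ℂ) * cosMode h (2 * n) x) volume 0 h :=
      (continuous_const.mul (continuous_cosMode h _)).intervalIntegrable _ _
    rw [intervalIntegral.integral_sub intervalIntegrable_const hi,
      intervalIntegral.integral_const_mul, h3]
    simp only [intervalIntegral.integral_const, sub_zero, mul_zero, Complex.real_smul]
    push_cast; ring
  · have := integral_deriv2_mul_sineMode hh m (f := sineMode h n)
      (f' := fun x => ((n * π / h : ℝ) : ℂ) * cosMode h n x)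
      (f'' := fun x => ((n * π / h : ℝ) : ℂ) * (-((n * π / h : ℝ) : ℂ) * sineMode h n x))
      (fun x _ => hasDerivAt_sineMode h n x)
      (fun x _ => (hasDerivAt_cosMode h n x).const_mul _)
      (by have := continuous_sineMode h n; fun_prop)
    rw [sineMode_zero, sineMode_right hh] at this
    simp only [mul_assoc] at this
    rw [intervalIntegral.integral_const_mul, intervalIntegral.integral_const_mul] at this
    set I := ∫ x in (0 : ℝ)..h, sineMode h n x * sineMode h m x
    have e : ((((n * π / h : ℝ)) : ℂ) ^ 2 - (((m * π / h : ℝ)) : ℂ) ^ 2) * I = 0 := by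
      linear_combination -this
    refine (mul_eq_zero.mp e).resolve_left ?_
    change _ ≠ _
    rw [sub_ne_zero]
    norm_cast
    intro h'
    have := (pow_left_inj₀ (by positivity) (by positivity) two_ne_zero).mp h'
    have h4 : (n : ℝ) = m := by
      field_simp at this
      linarith
    exact hnm (by exact_mod_cast h4)

/-- Completeness of the sine system. -/
lemma eq_zero_of_integral_mul_sineMode {h : ℝ} (hh : 0 < h) {f : ℝ → ℂ}
    (hf : ContinuousOn f (Icc 0 h))
    (h0 : ∀ n, 1 ≤ n → ∫ x in (0 : ℝ)..h, f x * sineMode h n x = 0) :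
    ∀ x ∈ Ioo 0 h, f x = 0 := by
  have hlt : -h < h := by linarith
  -- the odd extension
  set g : ℝ → ℂ := fun x => if 0 < x then f x else -f (-x) with hg
  have hgpos : ∀ x ∈ Ioc 0 h, g x = f x := fun x hx => by simp [hg, hx.1]
  have hgneg : ∀ x ∈ Ioc (-h) 0, g x = -f (-x) := fun x hx => by simp [hg, not_lt.mpr hx.2]
  have cneg : ContinuousOn (fun x => -f (-x)) (Icc (-h) 0) := by
    apply ContinuousOn.neg
    exact hf.comp continuousOn_neg fun x hx => ⟨by linarith [hx.2], by linarith [hx.1]⟩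
  obtain ⟨B, hB⟩ := (isCompact_Icc.image_of_continuousOn hf).isBounded.exists_norm_le
  have hB' : ∀ x ∈ Icc 0 h, ‖f x‖ ≤ B := fun x hx => hB _ ⟨x, hx, rfl⟩
  have hm1 : AEStronglyMeasurable g (volume.restrict (Ioc 0 h)) :=
    ((hf.mono Ioc_subset_Icc_self).aestronglyMeasurable measurableSet_Ioc).congr
      ((ae_restrict_iff' measurableSet_Ioc).mpr (.of_forall fun x hx => (hgpos x hx).symm))
  have hm2 : AEStronglyMeasurable g (volume.restrict (Ioc (-h) 0)) :=
    ((cneg.mono Ioc_subset_Icc_self).aestronglyMeasurable measurableSet_Ioc).congr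
      ((ae_restrict_iff' measurableSet_Ioc).mpr (.of_forall fun x hx => (hgneg x hx).symm))
  have hm : AEStronglyMeasurable g (volume.restrict (Ioc (-h) h)) := by
    rw [← Ioc_union_Ioc_eq_Ioc (by linarith : -h ≤ 0) hh.le]
    exact aestronglyMeasurable_union_iff.mpr ⟨hm2, hm1⟩
  have hbd : ∀ x ∈ Ioc (-h) h, ‖g x‖ ≤ B := by
    intro x hx
    rcases lt_or_ge 0 x with h1 | h1
    · rw [hgpos x ⟨h1, hx.2⟩]; exact hB' x ⟨h1.le, hx.2⟩
    · rw [hgneg x ⟨hx.1, h1⟩, norm_neg]; exact hB' _ ⟨by linarith, by linarith [hx.1]⟩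
  have hmem : MemLp g 2 (volume.restrict (Ioc (-h) h)) :=
    MemLp.of_bound hm B ((ae_restrict_iff' measurableSet_Ioc).mpr (.of_forall hbd))
  have key := tsum_sq_fourierCoeffOn hlt hmem
  have hi : ∀ w : ℝ → ℂ, Continuous w → IntervalIntegrable (fun x => w x * g x) volume 0 h := by
    intro w hw
    rw [intervalIntegrable_iff_integrableOn_Ioc_of_le hh.le]
    refine ((hf.mul hw.continuousOn).integrableOn_Icc.mono_set Ioc_subset_Icc_self).congr_fun
      (fun x hx => ?_) measurableSet_Ioc
    simp only [hgpos x hx, Pi.mul_apply]; ring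
  have hi' : ∀ w : ℝ → ℂ, Continuous w → IntervalIntegrable (fun x => w x * g x) volume (-h) 0 := by
    intro w hw
    rw [intervalIntegrable_iff_integrableOn_Ioc_of_le (by linarith)]
    refine ((cneg.mul hw.continuousOn).integrableOn_Icc.mono_set Ioc_subset_Icc_self).congr_fun
      (fun x hx => ?_) measurableSet_Ioc
    simp only [hgneg x hx, Pi.mul_apply]; ring
  have hcoef : ∀ n : ℤ, fourierCoeffOn hlt g n = 0 := by
    intro n
    rw [fourierCoeffOn_eq_integral]
    have hfc : ∀ x : ℝ, fourier (T := h - -h) (-n) (x : AddCircle (h - -h)) =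
        Complex.exp (-(((n * π / h * x : ℝ)) : ℂ) * Complex.I) := by
      intro x
      rw [fourier_coe_apply]
      congr 1
      push_cast
      have : (h : ℂ) ≠ 0 := by exact_mod_cast hh.ne'
      have h2 : (h : ℂ) - -h ≠ 0 := by
        rw [sub_neg_eq_add, ← two_mul]; simpa using this
      field_simp
      ring
    simp_rw [hfc, smul_eq_mul]
    have hw : Continuous fun x : ℝ => Complex.exp (-(((n * π / h * x : ℝ)) : ℂ) * Complex.I) := by
      fun_prop
    rw [← intervalIntegral.integral_add_adjacent_intervals (hi' _ hw) (hi _ hw)]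
    have e1 : ∫ x in (-h : ℝ)..0, Complex.exp (-(((n * π / h * x : ℝ)) : ℂ) * Complex.I) * g x =
        -∫ x in (0 : ℝ)..h, Complex.exp ((((n * π / h * x : ℝ)) : ℂ) * Complex.I) * f x := by
      rw [← intervalIntegral.integral_neg]
      have := intervalIntegral.integral_comp_neg (a := 0) (b := h)
        (fun x => Complex.exp (-(((n * π / h * x : ℝ)) : ℂ) * Complex.I) * g x)
      rw [neg_zero] at this
      rw [← this]
      apply intervalIntegral.integral_congr
      intro x hx
      rw [uIcc_of_le hh.le] at hx
      simp only
      rw [hg]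
      simp only [neg_neg, Left.neg_pos_iff, not_lt.mpr hx.1, if_false]
      rw [show -((((n : ℝ) * π / h * -x : ℝ)) : ℂ) = (((n : ℝ) * π / h * x : ℝ) : ℂ) by
        push_cast; ring]
      ring
    have e2 : ∫ x in (0 : ℝ)..h, Complex.exp (-(((n * π / h * x : ℝ)) : ℂ) * Complex.I) * g x =
        ∫ x in (0 : ℝ)..h, Complex.exp (-(((n * π / h * x : ℝ)) : ℂ) * Complex.I) * f x := by
      apply intervalIntegral.integral_congr_ae
      refine .of_forall fun x hx => ?_
      rw [uIoc_of_le hh.le] at hx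
      simp only [hgpos x hx]
    rw [e1, e2, neg_add_eq_sub]
    have hf' : ∀ w : ℝ → ℂ, Continuous w →
        IntervalIntegrable (fun x => w x * f x) volume 0 h := by
      intro w hw
      apply ContinuousOn.intervalIntegrable
      rw [uIcc_of_le hh.le]
      exact hw.continuousOn.mul hf
    rw [← intervalIntegral.integral_sub (hf' _ hw) (hf' _ (by fun_prop))]
    have e3 : ∀ x : ℝ, Complex.exp (-(((n * π / h * x : ℝ)) : ℂ) * Complex.I) * f x -
        Complex.exp ((((n * π / h * x : ℝ)) : ℂ) * Complex.I) * f x =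
        (-2 * Complex.I * (n.sign : ℂ)) * (f x * sineMode h n.natAbs x) := by
      intro x
      have : ((Real.sin (n * π / h * x) : ℝ) : ℂ) = n.sign * sineMode h n.natAbs x := by
        unfold sineMode
        rcases lt_trichotomy n 0 with h1 | h1 | h1
        · have : ((n.natAbs : ℕ) : ℝ) = -n := by
            rw [Nat.cast_natAbs, abs_of_neg h1]; push_cast; ring
          rw [this, Int.sign_eq_neg_one_of_neg h1,
            show -(n : ℝ) * π / h * x = -(n * π / h * x) by ring, Real.sin_neg]
          push_cast; ring
        · subst h1; simp
        · have : ((n.natAbs : ℕ) : ℝ) = n := by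
            rw [Nat.cast_natAbs, abs_of_pos h1]
          rw [this, Int.sign_eq_one_of_pos h1]
          push_cast; ring
      rw [show (-2 * Complex.I * (n.sign : ℂ)) * (f x * sineMode h n.natAbs x) =
        -2 * Complex.I * (n.sign * sineMode h n.natAbs x) * f x by ring, ← this,
        Complex.ofReal_sin, Complex.sin]
      linear_combination (norm := skip) (Complex.exp (-(((n * π / h * x : ℝ)) : ℂ) * Complex.I)
        - Complex.exp ((((n * π / h * x : ℝ)) : ℂ) * Complex.I)) * f x * Complex.I_sq
      ring
    simp_rw [e3]
    rw [intervalIntegral.integral_const_mul]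
    rcases eq_or_ne n 0 with h1 | h1
    · subst h1; simp
    · rw [h0 _ (Int.natAbs_pos.mpr h1)]; simp
  simp only [hcoef, norm_zero, ne_eq, OfNat.ofNat_ne_zero, not_false_eq_true, zero_pow,
    tsum_zero] at key
  have hI : ∫ x in (-h)..h, ‖g x‖ ^ 2 = 0 := by
    have h2 : (h - -h)⁻¹ ≠ 0 := inv_ne_zero (by linarith)
    rw [smul_eq_mul] at key
    exact (mul_eq_zero.mp key.symm).resolve_left h2
  rw [intervalIntegral.integral_of_le hlt.le, integral_eq_zero_iff_of_nonneg
    (fun x => by positivity) ((memLp_two_iff_integrable_sq_norm hm).mp hmem)] at hI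
  have hae : f =ᵐ[volume.restrict (Ioo 0 h)] 0 := by
    have := ae_restrict_of_ae_restrict_of_subset
      (show Ioo 0 h ⊆ Ioc (-h) h from fun x hx => ⟨by linarith [hx.1], hx.2.le⟩) hI
    filter_upwards [this, ae_restrict_mem measurableSet_Ioo] with x hx hx'
    rw [hgpos x ⟨hx'.1, hx'.2.le⟩] at hx
    simpa using hx
  exact fun x hx => Measure.eqOn_open_of_ae_eq hae isOpen_Ioo
    (hf.mono Ioo_subset_Icc_self) continuousOn_const hx

/-! ### Helmholtz functions on a closed rectangle -/

/-- The closed reference rectangle. -/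
def rectC (h1 h2 : ℝ) : Set (ℝ × ℝ) := Icc 0 h1 ×ˢ Icc 0 h2

lemma isCompact_rectC (h1 h2 : ℝ) : IsCompact (rectC h1 h2) := isCompact_Icc.prod isCompact_Icc

/-- A classical Helmholtz function that is twice differentiable up to the boundary of the
rectangle. -/
def RectHelm (κ h1 h2 : ℝ) (f : ℝ × ℝ → ℂ) : Prop :=
  ∃ fx fxx fy fyy : ℝ × ℝ → ℂ,
    (∀ x ∈ Icc 0 h1, ∀ y ∈ Icc 0 h2,
      HasDerivAt (fun s => f (s, y)) (fx (x, y)) x ∧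
      HasDerivAt (fun s => fx (s, y)) (fxx (x, y)) x ∧
      HasDerivAt (fun s => f (x, s)) (fy (x, y)) y ∧
      HasDerivAt (fun s => fy (x, s)) (fyy (x, y)) y ∧
      fxx (x, y) + fyy (x, y) + (κ : ℂ) ^ 2 * f (x, y) = 0) ∧
    ContinuousOn f (rectC h1 h2) ∧ ContinuousOn fxx (rectC h1 h2) ∧ ContinuousOn fyy (rectC h1 h2)

lemma RectHelm.continuousOn {κ h1 h2 : ℝ} {f : ℝ × ℝ → ℂ} (hf : RectHelm κ h1 h2 f) :
    ContinuousOn f (rectC h1 h2) := by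
  obtain ⟨_, _, _, _, _, h, _⟩ := hf; exact h

lemma RectHelm.add {κ h1 h2 : ℝ} {f g : ℝ × ℝ → ℂ} (hf : RectHelm κ h1 h2 f)
    (hg : RectHelm κ h1 h2 g) : RectHelm κ h1 h2 (fun x => f x + g x) := by
  obtain ⟨fx, fxx, fy, fyy, hd, c1, c2, c3⟩ := hf
  obtain ⟨gx, gxx, gy, gyy, hd', c1', c2', c3'⟩ := hg
  refine ⟨fun x => fx x + gx x, fun x => fxx x + gxx x, fun x => fy x + gy x,
    fun x => fyy x + gyy x, fun x hx y hy => ?_, c1.add c1', c2.add c2', c3.add c3'⟩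
  obtain ⟨d1, d2, d3, d4, e⟩ := hd x hx y hy
  obtain ⟨d1', d2', d3', d4', e'⟩ := hd' x hx y hy
  exact ⟨d1.add d1', d2.add d2', d3.add d3', d4.add d4', by linear_combination e + e'⟩

lemma RectHelm.const_mul {κ h1 h2 : ℝ} {f : ℝ × ℝ → ℂ} (c : ℂ) (hf : RectHelm κ h1 h2 f) :
    RectHelm κ h1 h2 (fun x => c * f x) := by
  obtain ⟨fx, fxx, fy, fyy, hd, c1, c2, c3⟩ := hf
  refine ⟨fun x => c * fx x, fun x => c * fxx x, fun x => c * fy x,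
    fun x => c * fyy x, fun x hx y hy => ?_, continuousOn_const.mul c1, continuousOn_const.mul c2,
    continuousOn_const.mul c3⟩
  obtain ⟨d1, d2, d3, d4, e⟩ := hd x hx y hy
  exact ⟨d1.const_mul c, d2.const_mul c, d3.const_mul c, d4.const_mul c,
    by linear_combination c * e⟩

lemma RectHelm.sub {κ h1 h2 : ℝ} {f g : ℝ × ℝ → ℂ} (hf : RectHelm κ h1 h2 f)
    (hg : RectHelm κ h1 h2 g) : RectHelm κ h1 h2 (fun x => f x - g x) := by
  simpa [sub_eq_add_neg] using hf.add (hg.const_mul (-1))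

lemma RectHelm.zero (κ h1 h2 : ℝ) : RectHelm κ h1 h2 (fun _ => 0) :=
  ⟨fun _ => 0, fun _ => 0, fun _ => 0, fun _ => 0, fun x _ y _ =>
    ⟨hasDerivAt_const _ _, hasDerivAt_const _ _, hasDerivAt_const _ _, hasDerivAt_const _ _,
      by simp⟩, continuousOn_const, continuousOn_const, continuousOn_const⟩

lemma RectHelm.sum {κ h1 h2 : ℝ} {f : ℕ → ℝ × ℝ → ℂ} (s : Finset ℕ)
    (hf : ∀ n ∈ s, RectHelm κ h1 h2 (f n)) : RectHelm κ h1 h2 (fun x => ∑ n ∈ s, f n x) := by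
  induction s using Finset.induction_on with
  | empty => simpa using RectHelm.zero κ h1 h2
  | insert a s ha ih =>
    simp_rw [Finset.sum_insert ha]
    exact (hf a (by simp)).add (ih fun n hn => hf n (by simp [hn]))

/-- Sinusoidal functions of complex frequency `a`. -/
def SinLike (a : ℂ) (p : ℝ → ℂ) : Prop := ∃ A b : ℂ, ∀ x : ℝ, p x = A * Complex.sin (a * x + b)

lemma hasDerivAt_csin_affine (a b : ℂ) (x : ℝ) :
    HasDerivAt (fun x : ℝ => Complex.sin (a * x + b)) (a * Complex.cos (a * x + b)) x := by
  have h : HasDerivAt (fun x : ℝ => a * (x : ℂ) + b) a x := by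
    simpa using ((hasDerivAt_id x).ofReal_comp.const_mul a).add_const b
  have := (Complex.hasDerivAt_sin (a * x + b)).comp x h
  rw [mul_comm] at this
  exact this

lemma hasDerivAt_ccos_affine (a b : ℂ) (x : ℝ) :
    HasDerivAt (fun x : ℝ => Complex.cos (a * x + b)) (-(a * Complex.sin (a * x + b))) x := by
  have h : HasDerivAt (fun x : ℝ => a * (x : ℂ) + b) a x := by
    simpa using ((hasDerivAt_id x).ofReal_comp.const_mul a).add_const b
  have := (Complex.hasDerivAt_cos (a * x + b)).comp x h
  rw [show -(a * Complex.sin (a * x + b)) = -Complex.sin (a * x + b) * a by ring]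
  exact this

lemma RectHelm.of_sinLike {κ h1 h2 : ℝ} {a b : ℂ} {p q : ℝ → ℂ} (hp : SinLike a p)
    (hq : SinLike b q) (hab : a ^ 2 + b ^ 2 = (κ : ℂ) ^ 2) :
    RectHelm κ h1 h2 (fun x => p x.1 * q x.2) := by
  obtain ⟨A, c, hp⟩ := hp
  obtain ⟨B, d, hq⟩ := hq
  have hp' : p = fun x : ℝ => A * Complex.sin (a * x + c) := funext hp
  have hq' : q = fun x : ℝ => B * Complex.sin (b * x + d) := funext hq
  subst hp' hq'
  refine ⟨fun x => A * (a * Complex.cos (a * x.1 + c)) * (B * Complex.sin (b * x.2 + d)),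
    fun x => A * (a * -(a * Complex.sin (a * x.1 + c))) * (B * Complex.sin (b * x.2 + d)),
    fun x => A * Complex.sin (a * x.1 + c) * (B * (b * Complex.cos (b * x.2 + d))),
    fun x => A * Complex.sin (a * x.1 + c) * (B * (b * -(b * Complex.sin (b * x.2 + d)))),
    fun x _ y _ => ⟨?_, ?_, ?_, ?_, ?_⟩, ?_, ?_, ?_⟩
  · exact ((hasDerivAt_csin_affine a c x).const_mul A).mul_const (B * Complex.sin (b * y + d))
  · exact (((hasDerivAt_ccos_affine a c x).const_mul a).const_mul A).mul_const
      (B * Complex.sin (b * y + d))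
  · exact ((hasDerivAt_csin_affine b d y).const_mul B).const_mul (A * Complex.sin (a * x + c))
  · exact (((hasDerivAt_ccos_affine b d y).const_mul b).const_mul B).const_mul
      (A * Complex.sin (a * x + c))
  · linear_combination -A * Complex.sin (a * x + c) * (B * Complex.sin (b * y + d)) * hab
  all_goals exact Continuous.continuousOn (by fun_prop)

lemma continuousOn_rect_integral {h1 h2 : ℝ} (hh1 : 0 < h1) (hh2 : 0 < h2) {g : ℝ × ℝ → ℂ}
    (hg : ContinuousOn g (rectC h1 h2)) :
    ContinuousOn (fun y => ∫ x in (0 : ℝ)..h1, g (x, y)) (Icc 0 h2) := by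
  have hc : Continuous (fun p : ℝ × ℝ =>
      g ((projIcc 0 h1 hh1.le p.2 : ℝ), (projIcc 0 h2 hh2.le p.1 : ℝ))) := by
    apply hg.comp_continuous
    · exact ((continuous_subtype_val.comp continuous_projIcc).comp continuous_snd).prodMk
        ((continuous_subtype_val.comp continuous_projIcc).comp continuous_fst)
    · exact fun p => ⟨(projIcc 0 h1 hh1.le p.2).2, (projIcc 0 h2 hh2.le p.1).2⟩
  have := intervalIntegral.continuous_parametric_intervalIntegral_of_continuous'
    (f := fun y x => g ((projIcc 0 h1 hh1.le x : ℝ), (projIcc 0 h2 hh2.le y : ℝ))) (μ := volume)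
    hc 0 h1
  refine this.continuousOn.congr fun y hy => ?_
  apply intervalIntegral.integral_congr
  intro x hx
  rw [uIcc_of_le hh1.le] at hx
  simp only [projIcc_of_mem hh1.le hx, projIcc_of_mem hh2.le hy]

lemma rect_integral_swap {h1 h2 : ℝ} (hh1 : 0 < h1) (hh2 : 0 < h2) {g : ℝ × ℝ → ℂ}
    (hg : ContinuousOn g (rectC h1 h2)) :
    ∫ y in (0 : ℝ)..h2, ∫ x in (0 : ℝ)..h1, g (x, y) =
      ∫ x in (0 : ℝ)..h1, ∫ y in (0 : ℝ)..h2, g (x, y) := by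
  symm
  apply intervalIntegral_intervalIntegral_swap (F := fun x y => g (x, y))
  rw [uIoc_of_le hh1.le, uIoc_of_le hh2.le]
  exact (hg.integrableOn_compact (isCompact_rectC h1 h2)).mono_set
    (prod_mono Ioc_subset_Icc_self Ioc_subset_Icc_self)

/-- Double sine coefficients. -/
def sineCoef (h1 h2 : ℝ) (n m : ℕ) (f : ℝ × ℝ → ℂ) : ℂ :=
  ∫ y in (0 : ℝ)..h2, ∫ x in (0 : ℝ)..h1, f (x, y) * (sineMode h1 n x * sineMode h2 m y)

lemma continuousOn_mul_sineModes {h1 h2 : ℝ} {n m : ℕ} {f : ℝ × ℝ → ℂ}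
    (hf : ContinuousOn f (rectC h1 h2)) :
    ContinuousOn (fun p : ℝ × ℝ => f p * (sineMode h1 n p.1 * sineMode h2 m p.2))
      (rectC h1 h2) := by
  have c1 := continuous_sineMode h1 n
  have c2 := continuous_sineMode h2 m
  exact hf.mul (Continuous.continuousOn (by fun_prop))

lemma sineCoef_inner {h1 h2 : ℝ} (n m : ℕ) (f : ℝ × ℝ → ℂ) :
    sineCoef h1 h2 n m f =
      ∫ y in (0 : ℝ)..h2, (∫ x in (0 : ℝ)..h1, f (x, y) * sineMode h1 n x) * sineMode h2 m y := by
  unfold sineCoef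
  congr 1; funext y
  rw [← intervalIntegral.integral_mul_const]
  congr 1; funext x; ring

lemma sineCoef_swap {h1 h2 : ℝ} (hh1 : 0 < h1) (hh2 : 0 < h2) {n m : ℕ} {f : ℝ × ℝ → ℂ}
    (hf : ContinuousOn f (rectC h1 h2)) :
    sineCoef h1 h2 n m f =
      ∫ x in (0 : ℝ)..h1, (∫ y in (0 : ℝ)..h2, f (x, y) * sineMode h2 m y) * sineMode h1 n x := by
  unfold sineCoef
  rw [rect_integral_swap hh1 hh2 (continuousOn_mul_sineModes hf)]
  congr 1; funext y
  rw [← intervalIntegral.integral_mul_const]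
  congr 1; funext x; ring

lemma ContinuousOn.rect_slice_left {h1 h2 : ℝ} {g : ℝ × ℝ → ℂ}
    (hg : ContinuousOn g (rectC h1 h2)) {y : ℝ} (hy : y ∈ Icc 0 h2) :
    ContinuousOn (fun x => g (x, y)) (Icc 0 h1) :=
  hg.comp (Continuous.continuousOn (by fun_prop)) fun _ hx => ⟨hx, hy⟩

lemma ContinuousOn.rect_slice_right {h1 h2 : ℝ} {g : ℝ × ℝ → ℂ}
    (hg : ContinuousOn g (rectC h1 h2)) {x : ℝ} (hx : x ∈ Icc 0 h1) :
    ContinuousOn (fun y => g (x, y)) (Icc 0 h2) :=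
  hg.comp (Continuous.continuousOn (by fun_prop)) fun _ hy => ⟨hx, hy⟩

lemma ContinuousOn.intervalIntegrable_zero {h : ℝ} (hh : 0 < h) {f : ℝ → ℂ}
    (hf : ContinuousOn f (Icc 0 h)) : IntervalIntegrable f volume 0 h :=
  ContinuousOn.intervalIntegrable (by rwa [uIcc_of_le hh.le])

lemma sineCoef_add {h1 h2 : ℝ} (hh1 : 0 < h1) (hh2 : 0 < h2) {n m : ℕ} {f g : ℝ × ℝ → ℂ}
    (hf : ContinuousOn f (rectC h1 h2)) (hg : ContinuousOn g (rectC h1 h2)) :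
    sineCoef h1 h2 n m (fun x => f x + g x) = sineCoef h1 h2 n m f + sineCoef h1 h2 n m g := by
  have cf := continuousOn_mul_sineModes (n := n) (m := m) hf
  have cg := continuousOn_mul_sineModes (n := n) (m := m) hg
  unfold sineCoef
  rw [← intervalIntegral.integral_add
    ((continuousOn_rect_integral hh1 hh2 cf).intervalIntegrable_zero hh2)
    ((continuousOn_rect_integral hh1 hh2 cg).intervalIntegrable_zero hh2)]
  apply intervalIntegral.integral_congr
  intro y hy
  rw [uIcc_of_le hh2.le] at hy
  simp only
  rw [← intervalIntegral.integral_add ((cf.rect_slice_left hy).intervalIntegrable_zero hh1)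
    ((cg.rect_slice_left hy).intervalIntegrable_zero hh1)]
  congr 1; funext x; ring

lemma sineCoef_const_mul {h1 h2 : ℝ} {n m : ℕ} {f : ℝ × ℝ → ℂ} (c : ℂ) :
    sineCoef h1 h2 n m (fun x => c * f x) = c * sineCoef h1 h2 n m f := by
  unfold sineCoef
  simp_rw [mul_assoc, intervalIntegral.integral_const_mul]

lemma norm_sineCoef_le {h1 h2 : ℝ} (hh1 : 0 < h1) (hh2 : 0 < h2) {n m : ℕ} {f : ℝ × ℝ → ℂ} {B : ℝ}
    (hB : ∀ p ∈ rectC h1 h2, ‖f p‖ ≤ B) : ‖sineCoef h1 h2 n m f‖ ≤ B * h1 * h2 := by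
  unfold sineCoef
  have : ∀ y ∈ uIoc 0 h2,
      ‖∫ x in (0 : ℝ)..h1, f (x, y) * (sineMode h1 n x * sineMode h2 m y)‖ ≤ B * h1 := by
    intro y hy
    rw [uIoc_of_le hh2.le] at hy
    have := intervalIntegral.norm_integral_le_of_norm_le_const (a := 0) (b := h1) (C := B)
      (f := fun x => f (x, y) * (sineMode h1 n x * sineMode h2 m y)) (fun x hx => by
        rw [uIoc_of_le hh1.le] at hx
        rw [norm_mul, norm_mul]
        have h := hB (x, y) ⟨⟨hx.1.le, hx.2⟩, ⟨hy.1.le, hy.2⟩⟩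
        calc _ ≤ ‖f (x, y)‖ * (1 * 1) := by
              gcongr <;> exact norm_sineMode_le _ _ _
          _ ≤ B := by linarith)
    rwa [sub_zero, abs_of_pos hh1] at this
  have := intervalIntegral.norm_integral_le_of_norm_le_const this
  rwa [sub_zero, abs_of_pos hh2] at this

/-- Green's formula against a product of sines: a Helmholtz function has vanishing double sine
coefficient when the sine coefficients of its boundary traces vanish. -/
lemma RectHelm.sineCoef_eq_zero {κ h1 h2 : ℝ} (hh1 : 0 < h1) (hh2 : 0 < h2) {f : ℝ × ℝ → ℂ}
    (hf : RectHelm κ h1 h2 f) {n m : ℕ} (hκ : κ ^ 2 ≠ (n * π / h1) ^ 2 + (m * π / h2) ^ 2)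
    (hB : ∫ x in (0 : ℝ)..h1, f (x, 0) * sineMode h1 n x = 0)
    (hT : ∫ x in (0 : ℝ)..h1, f (x, h2) * sineMode h1 n x = 0)
    (hL : ∫ y in (0 : ℝ)..h2, f (0, y) * sineMode h2 m y = 0)
    (hR : ∫ y in (0 : ℝ)..h2, f (h1, y) * sineMode h2 m y = 0) :
    sineCoef h1 h2 n m f = 0 := by
  obtain ⟨fx, fxx, fy, fyy, hd, c1, c2, c3⟩ := hf
  have m0 : (0 : ℝ) ∈ Icc 0 h1 := ⟨le_rfl, hh1.le⟩
  have m1 : h1 ∈ Icc 0 h1 := ⟨hh1.le, le_rfl⟩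
  have n0 : (0 : ℝ) ∈ Icc 0 h2 := ⟨le_rfl, hh2.le⟩
  have n1 : h2 ∈ Icc 0 h2 := ⟨hh2.le, le_rfl⟩
  set α : ℂ := ((n * π / h1 : ℝ) : ℂ)
  set β : ℂ := ((m * π / h2 : ℝ) : ℂ)
  have s1 : ∀ k (q : ℝ → ℂ), ContinuousOn q (Icc 0 h2) →
      IntervalIntegrable (fun y => q y * sineMode h2 k y) volume 0 h2 := fun k q hq =>
    (hq.mul (continuous_sineMode h2 k).continuousOn).intervalIntegrable_zero hh2
  have s2 : ∀ k (q : ℝ → ℂ), ContinuousOn q (Icc 0 h1) →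
      IntervalIntegrable (fun y => q y * sineMode h1 k y) volume 0 h1 := fun k q hq =>
    (hq.mul (continuous_sineMode h1 k).continuousOn).intervalIntegrable_zero hh1
  have cs1 : ContinuousOn (fun p : ℝ × ℝ => f p * sineMode h1 n p.1) (rectC h1 h2) :=
    c1.mul ((continuous_sineMode h1 n).comp continuous_fst).continuousOn
  have cs2 : ContinuousOn (fun p : ℝ × ℝ => f p * sineMode h2 m p.2) (rectC h1 h2) :=
    c1.mul ((continuous_sineMode h2 m).comp continuous_snd).continuousOn
  have ex : sineCoef h1 h2 n m fxx = -α ^ 2 * sineCoef h1 h2 n m f := by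
    rw [sineCoef_inner, sineCoef_inner]
    have : ∀ y ∈ uIcc 0 h2, (∫ x in (0 : ℝ)..h1, fxx (x, y) * sineMode h1 n x) * sineMode h2 m y =
        α * (f (0, y) * sineMode h2 m y) - α * (-1) ^ n * (f (h1, y) * sineMode h2 m y)
        - α ^ 2 * ((∫ x in (0 : ℝ)..h1, f (x, y) * sineMode h1 n x) * sineMode h2 m y) := by
      intro y hy
      rw [uIcc_of_le hh2.le] at hy
      rw [integral_deriv2_mul_sineMode hh1 n (fun x hx => (hd x hx y hy).1)
        (fun x hx => (hd x hx y hy).2.1) (c2.rect_slice_left hy)]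
      ring
    rw [intervalIntegral.integral_congr this, intervalIntegral.integral_sub,
      intervalIntegral.integral_sub, intervalIntegral.integral_const_mul,
      intervalIntegral.integral_const_mul, intervalIntegral.integral_const_mul, hL, hR]
    · ring
    · exact (s1 m _ (c1.rect_slice_right m0)).const_mul _
    · exact (s1 m _ (c1.rect_slice_right m1)).const_mul _
    · exact ((s1 m _ (c1.rect_slice_right m0)).const_mul _).sub
        ((s1 m _ (c1.rect_slice_right m1)).const_mul _)
    · exact (s1 m _ (continuousOn_rect_integral hh1 hh2 cs1)).const_mul _
  have ccs : ContinuousOn (fun x => ∫ y in (0 : ℝ)..h2, f (x, y) * sineMode h2 m y) (Icc 0 h1) :=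
    continuousOn_rect_integral hh2 hh1 (g := fun p : ℝ × ℝ => f (p.2, p.1) * sineMode h2 m p.1)
      (cs2.comp continuous_swap.continuousOn fun p hp => ⟨hp.2, hp.1⟩)
  have ey : sineCoef h1 h2 n m fyy = -β ^ 2 * sineCoef h1 h2 n m f := by
    rw [sineCoef_swap hh1 hh2 c3, sineCoef_swap hh1 hh2 c1]
    have : ∀ x ∈ uIcc 0 h1, (∫ y in (0 : ℝ)..h2, fyy (x, y) * sineMode h2 m y) * sineMode h1 n x =
        β * (f (x, 0) * sineMode h1 n x) - β * (-1) ^ m * (f (x, h2) * sineMode h1 n x)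
        - β ^ 2 * ((∫ y in (0 : ℝ)..h2, f (x, y) * sineMode h2 m y) * sineMode h1 n x) := by
      intro x hx
      rw [uIcc_of_le hh1.le] at hx
      rw [integral_deriv2_mul_sineMode hh2 m (fun y hy => (hd x hx y hy).2.2.1)
        (fun y hy => (hd x hx y hy).2.2.2.1) (c3.rect_slice_right hx)]
      ring
    rw [intervalIntegral.integral_congr this, intervalIntegral.integral_sub,
      intervalIntegral.integral_sub, intervalIntegral.integral_const_mul,
      intervalIntegral.integral_const_mul, intervalIntegral.integral_const_mul, hB, hT]
    · ring
    · exact (s2 n _ (c1.rect_slice_left n0)).const_mul _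
    · exact (s2 n _ (c1.rect_slice_left n1)).const_mul _
    · exact ((s2 n _ (c1.rect_slice_left n0)).const_mul _).sub
        ((s2 n _ (c1.rect_slice_left n1)).const_mul _)
    · exact (s2 n _ ccs).const_mul _
  have e0 : sineCoef h1 h2 n m (fun p => (fxx p + fyy p) + (κ : ℂ) ^ 2 * f p) = 0 := by
    have : ‖sineCoef h1 h2 n m (fun p => (fxx p + fyy p) + (κ : ℂ) ^ 2 * f p)‖ ≤ 0 * h1 * h2 :=
      norm_sineCoef_le hh1 hh2 fun p hp => by
        rw [(hd p.1 hp.1 p.2 hp.2).2.2.2.2, norm_zero]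
    simpa using this
  rw [sineCoef_add hh1 hh2 (f := fun p => fxx p + fyy p) (g := fun p => (κ : ℂ) ^ 2 * f p)
    (c2.add c3) (continuousOn_const.mul c1), sineCoef_add hh1 hh2 c2 c3,
    sineCoef_const_mul, ex, ey] at e0
  have e1 : ((κ : ℂ) ^ 2 - (α ^ 2 + β ^ 2)) * sineCoef h1 h2 n m f = 0 := by
    linear_combination e0
  refine (mul_eq_zero.mp e1).resolve_left (sub_ne_zero.mpr ?_)
  simp only [α, β]
  exact_mod_cast hκ

/-- Completeness of the double sine system. -/
lemma eq_zero_of_sineCoef_eq_zero {h1 h2 : ℝ} (hh1 : 0 < h1) (hh2 : 0 < h2) {f : ℝ × ℝ → ℂ}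
    (hf : ContinuousOn f (rectC h1 h2))
    (h0 : ∀ n m, 1 ≤ n → 1 ≤ m → sineCoef h1 h2 n m f = 0) :
    ∀ x ∈ Ioo 0 h1, ∀ y ∈ Ioo 0 h2, f (x, y) = 0 := by
  intro x hx y hy
  refine eq_zero_of_integral_mul_sineMode hh1
    (hf.rect_slice_left ⟨hy.1.le, hy.2.le⟩) (fun n hn => ?_) x hx
  refine eq_zero_of_integral_mul_sineMode hh2
    (f := fun y => ∫ x in (0 : ℝ)..h1, f (x, y) * sineMode h1 n x)
    (continuousOn_rect_integral hh1 hh2 (g := fun p : ℝ × ℝ => f p * sineMode h1 n p.1)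
    (hf.mul ((continuous_sineMode h1 n).comp continuous_fst).continuousOn)) (fun m hm => ?_) y hy
  rw [← sineCoef_inner]
  exact h0 n m hn hm

/-! ### Single-edge modes -/

lemma csqrt_sq (r : ℝ) : csqrt r ^ 2 = (r : ℂ) := by
  unfold csqrt
  rw [← Complex.cpow_nat_mul]
  norm_num

lemma csqrt_of_nonneg {r : ℝ} (hr : 0 ≤ r) : csqrt r = (Real.sqrt r : ℂ) := by
  unfold csqrt
  rw [Real.sqrt_eq_rpow, Complex.ofReal_cpow hr]
  norm_num

lemma csqrt_of_nonpos {r : ℝ} (hr : r ≤ 0) : csqrt r = Complex.I * (Real.sqrt (-r) : ℂ) := by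
  unfold csqrt
  have : ((-r : ℝ) : ℂ) = -(r : ℂ) := by push_cast; rfl
  rw [Complex.ofReal_cpow_of_nonpos hr, Real.sqrt_eq_rpow, Complex.ofReal_cpow (by linarith), this,
    mul_comm]
  congr 1
  · rw [show (π : ℂ) * Complex.I * (1 / 2 : ℂ) = π / 2 * Complex.I by ring]
    exact Complex.exp_pi_div_two_mul_I
  · norm_num

/-- The normalised sine `sin (a x) / sin (a h)`. -/
def ratio (a : ℂ) (h x : ℝ) : ℂ := Complex.sin (a * x) / Complex.sin (a * h)

lemma ratio_zero (a : ℂ) (h : ℝ) : ratio a h 0 = 0 := by simp [ratio]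

lemma ratio_self {a : ℂ} {h : ℝ} (ha : Complex.sin (a * h) ≠ 0) : ratio a h h = 1 := by
  simp [ratio, ha]

lemma sinLike_ratio (a : ℂ) (h : ℝ) : SinLike a (ratio a h) :=
  ⟨(Complex.sin (a * h))⁻¹, 0, fun x => by rw [ratio, add_zero]; ring⟩

lemma sinLike_sineMode (h : ℝ) (n : ℕ) : SinLike ((n * π / h : ℝ) : ℂ) (sineMode h n) :=
  ⟨1, 0, fun x => by simp [sineMode]⟩

lemma SinLike.reflect {a : ℂ} {p : ℝ → ℂ} (hp : SinLike a p) (h : ℝ) :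
    SinLike a (fun x => p (h - x)) := by
  obtain ⟨A, b, hp⟩ := hp
  refine ⟨-A, -(a * h + b), fun x => ?_⟩
  simp only [hp]
  rw [show a * x + -(a * h + b) = -(a * ((h - x : ℝ) : ℂ) + b) by push_cast; ring,
    Complex.sin_neg]
  ring

lemma hasDerivAt_ratio (a : ℂ) (h x : ℝ) :
    HasDerivAt (ratio a h) (a * Complex.cos (a * x) / Complex.sin (a * h)) x := by
  have := (hasDerivAt_csin_affine a 0 x).div_const (Complex.sin (a * h))
  simp only [add_zero] at this
  exact this

lemma ratio_I_mul (c h x : ℝ) :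
    ratio (Complex.I * c) h x = ((Real.sinh (c * x) / Real.sinh (c * h) : ℝ) : ℂ) := by
  unfold ratio
  have : ∀ x : ℝ, Complex.sin (Complex.I * c * x) = (Real.sinh (c * x) : ℂ) * Complex.I := by
    intro x
    rw [show Complex.I * c * x = ((c * x : ℝ) : ℂ) * Complex.I by push_cast; ring,
      Complex.sin_mul_I]
    push_cast; ring
  rw [this, this, mul_div_mul_right _ _ Complex.I_ne_zero]
  push_cast; ring

lemma norm_ratio_I_mul_le {c h x : ℝ} (hc : 0 ≤ c) (hx : x ∈ Icc 0 h) :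
    ‖ratio (Complex.I * c) h x‖ ≤ 1 := by
  rw [ratio_I_mul, Complex.norm_real, Real.norm_eq_abs,
    abs_of_nonneg (div_nonneg (Real.sinh_nonneg_iff.mpr (mul_nonneg hc hx.1))
      (Real.sinh_nonneg_iff.mpr (mul_nonneg hc (hx.1.trans hx.2))))]
  apply div_le_one_of_le₀
  · exact Real.sinh_le_sinh.mpr (mul_le_mul_of_nonneg_left hx.2 hc)
  · exact Real.sinh_nonneg_iff.mpr (mul_nonneg hc (hx.1.trans hx.2))

lemma norm_cos_div_sin_I_mul_le {c h x : ℝ} (hc : 0 < c) (hh : 0 < h) (hx : x ∈ Icc 0 h) :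
    ‖Complex.cos (Complex.I * c * x) / Complex.sin (Complex.I * c * h)‖ ≤ 1 + 1 / (c * h) := by
  have e1 : Complex.sin (Complex.I * c * h) = (Real.sinh (c * h) : ℂ) * Complex.I := by
    rw [show Complex.I * c * h = ((c * h : ℝ) : ℂ) * Complex.I by push_cast; ring,
      Complex.sin_mul_I]
    push_cast; ring
  have e2 : Complex.cos (Complex.I * c * x) = (Real.cosh (c * x) : ℂ) := by
    rw [show Complex.I * c * x = ((c * x : ℝ) : ℂ) * Complex.I by push_cast; ring,
      Complex.cos_mul_I]
    push_cast; ring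
  have hch : 0 < c * h := mul_pos hc hh
  have hs : c * h ≤ Real.sinh (c * h) := Real.self_le_sinh_iff.mpr hch.le
  have hs0 : 0 < Real.sinh (c * h) := by linarith
  rw [e1, e2, norm_div, norm_mul, Complex.norm_I, mul_one, Complex.norm_real, Complex.norm_real,
    Real.norm_eq_abs, Real.norm_eq_abs, abs_of_pos (Real.cosh_pos _), abs_of_pos hs0,
    div_le_iff₀ hs0]
  have h1 : Real.cosh (c * x) ≤ Real.cosh (c * h) := by
    rw [Real.cosh_le_cosh, abs_of_nonneg (mul_nonneg hc.le hx.1), abs_of_pos hch]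
    exact mul_le_mul_of_nonneg_left hx.2 hc.le
  have h2 : Real.cosh (c * h) - Real.sinh (c * h) ≤ 1 := by
    rw [Real.cosh_sub_sinh]; exact Real.exp_le_one_iff.mpr (by linarith)
  have h3 : 1 ≤ 1 / (c * h) * Real.sinh (c * h) := by
    rw [div_mul_eq_mul_div, one_mul, le_div_iff₀ hch]; linarith
  nlinarith

lemma phiHat_eq {κ : ℝ} (hκ : 0 < κ) (h1 h2 : ℝ) (n : ℕ) (x y : ℝ) :
    phiHat κ h1 h2 n (x, y) =
      sineMode h1 n x * ratio (κ * csqrt (1 - nuHat κ h1 n ^ 2)) h2 y := by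
  have e : κ * nuHat κ h1 n = n * π / h1 := by
    unfold nuHat; field_simp
  simp only [phiHat, sineMode, ratio, e]
  rw [show (y : ℂ) * κ * csqrt (1 - nuHat κ h1 n ^ 2) =
      κ * csqrt (1 - nuHat κ h1 n ^ 2) * y by ring,
    show (h2 : ℂ) * κ * csqrt (1 - nuHat κ h1 n ^ 2) =
      κ * csqrt (1 - nuHat κ h1 n ^ 2) * h2 by ring]
  push_cast
  ring

lemma freq_sq_add {κ : ℝ} (hκ : 0 < κ) (h1 : ℝ) (n : ℕ) :
    ((n * π / h1 : ℝ) : ℂ) ^ 2 + (κ * csqrt (1 - nuHat κ h1 n ^ 2)) ^ 2 = (κ : ℂ) ^ 2 := by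
  have e : (n * π / h1 : ℝ) = κ * nuHat κ h1 n := by
    unfold nuHat; field_simp
  rw [mul_pow, csqrt_sq, e]
  push_cast; ring

lemma RectHelm.swap {κ h1 h2 : ℝ} {f : ℝ × ℝ → ℂ} (hf : RectHelm κ h2 h1 f) :
    RectHelm κ h1 h2 (fun p => f (p.2, p.1)) := by
  obtain ⟨fx, fxx, fy, fyy, hd, c1, c2, c3⟩ := hf
  have hm : MapsTo (fun p : ℝ × ℝ => (p.2, p.1)) (rectC h1 h2) (rectC h2 h1) :=
    fun p hp => ⟨hp.2, hp.1⟩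
  have hc : ContinuousOn (fun p : ℝ × ℝ => (p.2, p.1)) (rectC h1 h2) :=
    Continuous.continuousOn (by fun_prop)
  refine ⟨fun p => fy (p.2, p.1), fun p => fyy (p.2, p.1), fun p => fx (p.2, p.1),
    fun p => fxx (p.2, p.1), fun x hx y hy => ?_, c1.comp hc hm, c3.comp hc hm, c2.comp hc hm⟩
  obtain ⟨d1, d2, d3, d4, e⟩ := hd y hy x hx
  exact ⟨d3, d4, d1, d2, by linear_combination e⟩

lemma rectHelm_phiHat {κ : ℝ} (hκ : 0 < κ) (h1 h2 : ℝ) (n : ℕ) :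
    RectHelm κ h1 h2 (phiHat κ h1 h2 n) := by
  have := RectHelm.of_sinLike (h1 := h1) (h2 := h2) (sinLike_sineMode h1 n)
    (sinLike_ratio (κ * csqrt (1 - nuHat κ h1 n ^ 2)) h2) (freq_sq_add hκ h1 n)
  convert this using 1
  funext p
  exact phiHat_eq hκ h1 h2 n p.1 p.2

lemma rectHelm_phiHat_reflect {κ : ℝ} (hκ : 0 < κ) (h1 h2 : ℝ) (n : ℕ) :
    RectHelm κ h1 h2 (fun p => phiHat κ h1 h2 n (p.1, h2 - p.2)) := by
  have := RectHelm.of_sinLike (h1 := h1) (h2 := h2) (sinLike_sineMode h1 n)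
    ((sinLike_ratio (κ * csqrt (1 - nuHat κ h1 n ^ 2)) h2).reflect h2) (freq_sq_add hκ h1 n)
  convert this using 1
  funext p
  exact phiHat_eq hκ h1 h2 n p.1 (h2 - p.2)

/-- Neumann non-resonance prevents the denominators of the modes from vanishing. -/
lemma sin_ne_zero_of_A0 {κ h1 h2 : ℝ} (hκ : 0 < κ) (hh2 : 0 < h2) (hA : A0cond κ h1 h2) (n : ℕ) :
    Complex.sin (κ * csqrt (1 - nuHat κ h1 n ^ 2) * h2) ≠ 0 := by
  rw [Complex.sin_ne_zero_iff]
  intro k hk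
  apply hA n k.natAbs
  have h := freq_sq_add hκ h1 n
  have hk2 : (κ * csqrt (1 - nuHat κ h1 n ^ 2)) ^ 2 = (((k : ℝ) * π / h2 : ℝ) : ℂ) ^ 2 := by
    have : (h2 : ℂ) ≠ 0 := by exact_mod_cast hh2.ne'
    have e : κ * csqrt (1 - nuHat κ h1 n ^ 2) = (((k : ℝ) * π / h2 : ℝ) : ℂ) := by
      push_cast
      rw [eq_div_iff this, hk]
    rw [e]
  rw [hk2] at h
  have h' : (n * π / h1 : ℝ) ^ 2 + ((k : ℝ) * π / h2) ^ 2 = κ ^ 2 := by exact_mod_cast h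
  rw [← h']
  congr 1
  rw [div_pow, div_pow, mul_pow, mul_pow]
  congr 2
  rw [Nat.cast_natAbs, Int.cast_abs, sq_abs]

lemma A0cond.symm {κ h1 h2 : ℝ} (h : A0cond κ h1 h2) : A0cond κ h2 h1 := fun n m => by
  rw [add_comm]; exact h m n

/-- `f` is differentiable at `x` with derivative bounded by `B`. -/
def DerivBound (f : ℝ → ℂ) (x B : ℝ) : Prop := ∃ d, HasDerivAt f d x ∧ ‖d‖ ≤ B

lemma DerivBound.add {f g : ℝ → ℂ} {x B B' : ℝ} (hf : DerivBound f x B) (hg : DerivBound g x B') :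
    DerivBound (fun s => f s + g s) x (B + B') := by
  obtain ⟨d, h, hd⟩ := hf
  obtain ⟨d', h', hd'⟩ := hg
  exact ⟨d + d', h.add h', (norm_add_le _ _).trans (add_le_add hd hd')⟩

lemma DerivBound.const_mul {f : ℝ → ℂ} {x B b : ℝ} {c : ℂ} (hf : DerivBound f x B) (hc : ‖c‖ ≤ b) :
    DerivBound (fun s => c * f s) x (b * B) := by
  obtain ⟨d, h, hd⟩ := hf
  refine ⟨c * d, h.const_mul c, ?_⟩
  rw [norm_mul]
  exact mul_le_mul hc hd (norm_nonneg _) ((norm_nonneg _).trans hc)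

lemma DerivBound.reflect {f : ℝ → ℂ} {h x B : ℝ} (hf : DerivBound f (h - x) B) :
    DerivBound (fun s => f (h - s)) x B := by
  obtain ⟨d, hd, hB⟩ := hf
  exact ⟨-d, hd.comp_const_sub h x, by rwa [norm_neg]⟩

lemma DerivBound.norm_deriv_le {f : ℝ → ℂ} {x B : ℝ} (hf : DerivBound f x B) :
    ‖deriv f x‖ ≤ B := by
  obtain ⟨d, h, hd⟩ := hf
  rwa [h.deriv]

lemma DerivBound.hasDerivAt {f : ℝ → ℂ} {x B : ℝ} (hf : DerivBound f x B) :
    HasDerivAt f (deriv f x) x := by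
  obtain ⟨d, h, hd⟩ := hf
  rwa [h.deriv]

section Evanescent

variable {κ h1 h2 : ℝ} {n : ℕ}

lemma freq_evanescent (hν : 1 ≤ nuHat κ h1 n) :
    κ * csqrt (1 - nuHat κ h1 n ^ 2) =
      Complex.I * ((κ * Real.sqrt (nuHat κ h1 n ^ 2 - 1) : ℝ) : ℂ) := by
  rw [csqrt_of_nonpos (by nlinarith), neg_sub]
  push_cast; ring

lemma norm_phiHat_le (hκ : 0 < κ) (hν : 1 ≤ nuHat κ h1 n) (x : ℝ) {y : ℝ} (hy : y ∈ Icc 0 h2) :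
    ‖phiHat κ h1 h2 n (x, y)‖ ≤ 1 := by
  rw [phiHat_eq hκ, norm_mul, freq_evanescent hν]
  exact mul_le_one₀ (norm_sineMode_le _ _ _) (norm_nonneg _)
    (norm_ratio_I_mul_le (mul_nonneg hκ.le (Real.sqrt_nonneg _)) hy)

lemma derivBound_phiHat_fst (hκ : 0 < κ) (hν : 1 ≤ nuHat κ h1 n) (hh1 : 0 < h1) (x : ℝ) {y : ℝ}
    (hy : y ∈ Icc 0 h2) {hm : ℝ} (hm0 : 0 < hm) (hm1 : hm ≤ h1) :
    DerivBound (fun s => phiHat κ h1 h2 n (s, y)) x ((n * π + 1) / hm) := by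
  simp_rw [phiHat_eq hκ]
  refine ⟨_, (hasDerivAt_sineMode h1 n x).mul_const _, ?_⟩
  rw [freq_evanescent hν, norm_mul, norm_mul, Complex.norm_real, Real.norm_eq_abs,
    abs_of_nonneg (by positivity)]
  calc n * π / h1 * ‖cosMode h1 n x‖ * _ ≤ n * π / h1 * 1 * 1 := by
        gcongr
        · exact norm_cosMode_le _ _ _
        · exact norm_ratio_I_mul_le (mul_nonneg hκ.le (Real.sqrt_nonneg _)) hy
    _ = n * π / h1 := by ring
    _ ≤ (n * π + 1) / h1 := by gcongr; linarith
    _ ≤ _ := by gcongr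

lemma derivBound_phiHat_snd (hκ : 0 < κ) (hν : 1 ≤ nuHat κ h1 n) (hh1 : 0 < h1) (hh2 : 0 < h2)
    (x : ℝ) {y : ℝ} (hy : y ∈ Icc 0 h2) {hm : ℝ} (hm0 : 0 < hm) (hm1 : hm ≤ h1) (hm2 : hm ≤ h2) :
    DerivBound (fun s => phiHat κ h1 h2 n (x, s)) y ((n * π + 1) / hm) := by
  simp_rw [phiHat_eq hκ]
  refine ⟨_, (hasDerivAt_ratio _ h2 y).const_mul _, ?_⟩
  set c := κ * Real.sqrt (nuHat κ h1 n ^ 2 - 1) with hc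
  have hc0 : 0 ≤ c := mul_nonneg hκ.le (Real.sqrt_nonneg _)
  have hcn : c ≤ n * π / h1 := by
    have : κ * nuHat κ h1 n = n * π / h1 := by unfold nuHat; field_simp
    rw [← this]
    apply mul_le_mul_of_nonneg_left _ hκ.le
    rw [Real.sqrt_le_left (by linarith)]
    linarith
  rw [freq_evanescent hν, norm_mul, mul_div_assoc, norm_mul, norm_mul, Complex.norm_I, one_mul,
    Complex.norm_real, Real.norm_eq_abs, ← hc, abs_of_nonneg hc0]
  have key : c * ‖Complex.cos (Complex.I * c * y) / Complex.sin (Complex.I * c * h2)‖ ≤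
      c + 1 / h2 := by
    rcases hc0.eq_or_lt with h0 | h0
    · rw [← h0]; simp; positivity
    · calc _ ≤ c * (1 + 1 / (c * h2)) := by
            gcongr; exact norm_cos_div_sin_I_mul_le h0 hh2 hy
        _ = _ := by field_simp
  calc ‖sineMode h1 n x‖ * _ ≤ 1 * (c + 1 / h2) := by
        gcongr
        exact norm_sineMode_le _ _ _
    _ ≤ n * π / h1 + 1 / h2 := by linarith
    _ ≤ n * π / hm + 1 / hm := by gcongr
    _ = _ := by ring

end Evanescent

/-! ### Expansion of a Helmholtz function in single-edge modes on a rectangle -/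

/-- The `n`-th mode contribution of the four edges of a rectangle. -/
def cellTerm (κ h1 h2 : ℝ) (aB aT aL aR : ℕ → ℂ) (n : ℕ) (p : ℝ × ℝ) : ℂ :=
  aB n * phiHat κ h1 h2 n (p.1, h2 - p.2) + aT n * phiHat κ h1 h2 n p +
    aL n * phiHat κ h2 h1 n (p.2, h1 - p.1) + aR n * phiHat κ h2 h1 n (p.2, p.1)

section CellTerm

variable {κ h1 h2 : ℝ} {aB aT aL aR : ℕ → ℂ} {n : ℕ}

lemma rectHelm_cellTerm (hκ : 0 < κ) (n : ℕ) :
    RectHelm κ h1 h2 (cellTerm κ h1 h2 aB aT aL aR n) :=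
  ((((rectHelm_phiHat_reflect hκ h1 h2 n).const_mul (aB n)).add
    ((rectHelm_phiHat hκ h1 h2 n).const_mul (aT n))).add
    ((rectHelm_phiHat_reflect hκ h2 h1 n).swap.const_mul (aL n))).add
    ((rectHelm_phiHat hκ h2 h1 n).swap.const_mul (aR n))

lemma phiHat_fst_zero (hκ : 0 < κ) (h1 h2 : ℝ) (n : ℕ) (y : ℝ) : phiHat κ h1 h2 n (0, y) = 0 := by
  rw [phiHat_eq hκ, sineMode_zero, zero_mul]

lemma phiHat_fst_right (hκ : 0 < κ) (hh1 : 0 < h1) (h2 : ℝ) (n : ℕ) (y : ℝ) :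
    phiHat κ h1 h2 n (h1, y) = 0 := by
  rw [phiHat_eq hκ, sineMode_right hh1, zero_mul]

lemma phiHat_snd_zero (hκ : 0 < κ) (h1 h2 : ℝ) (n : ℕ) (x : ℝ) : phiHat κ h1 h2 n (x, 0) = 0 := by
  rw [phiHat_eq hκ, ratio_zero, mul_zero]

lemma phiHat_snd_right (hκ : 0 < κ) (hh2 : 0 < h2) (hA : A0cond κ h1 h2) (n : ℕ) (x : ℝ) :
    phiHat κ h1 h2 n (x, h2) = sineMode h1 n x := by
  rw [phiHat_eq hκ, ratio_self (sin_ne_zero_of_A0 hκ hh2 hA n), mul_one]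

lemma cellTerm_bottom (hκ : 0 < κ) (hh2 : 0 < h2) (hA : A0cond κ h1 h2) (x : ℝ) :
    cellTerm κ h1 h2 aB aT aL aR n (x, 0) = aB n * sineMode h1 n x := by
  simp [cellTerm, phiHat_fst_zero hκ, phiHat_snd_zero hκ, phiHat_snd_right hκ hh2 hA]

lemma cellTerm_top (hκ : 0 < κ) (hh2 : 0 < h2) (hA : A0cond κ h1 h2) (x : ℝ) :
    cellTerm κ h1 h2 aB aT aL aR n (x, h2) = aT n * sineMode h1 n x := by
  simp [cellTerm, phiHat_fst_right hκ hh2, phiHat_snd_zero hκ, phiHat_snd_right hκ hh2 hA]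

lemma cellTerm_left (hκ : 0 < κ) (hh1 : 0 < h1) (hA : A0cond κ h1 h2) (y : ℝ) :
    cellTerm κ h1 h2 aB aT aL aR n (0, y) = aL n * sineMode h2 n y := by
  simp [cellTerm, phiHat_fst_zero hκ, phiHat_snd_zero hκ, phiHat_snd_right hκ hh1 hA.symm]

lemma cellTerm_right (hκ : 0 < κ) (hh1 : 0 < h1) (hA : A0cond κ h1 h2) (y : ℝ) :
    cellTerm κ h1 h2 aB aT aL aR n (h1, y) = aR n * sineMode h2 n y := by
  simp [cellTerm, phiHat_fst_right hκ hh1, phiHat_snd_zero hκ, phiHat_snd_right hκ hh1 hA.symm]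

variable {b hm : ℝ}

lemma norm_cellTerm_le (hκ : 0 < κ) (hν1 : 1 ≤ nuHat κ h1 n) (hν2 : 1 ≤ nuHat κ h2 n)
    (hB : ‖aB n‖ ≤ b) (hT : ‖aT n‖ ≤ b) (hL : ‖aL n‖ ≤ b) (hR : ‖aR n‖ ≤ b) {p : ℝ × ℝ}
    (hp : p ∈ rectC h1 h2) : ‖cellTerm κ h1 h2 aB aT aL aR n p‖ ≤ 4 * b := by
  obtain ⟨hx, hy⟩ := hp
  have hx' : h1 - p.1 ∈ Icc 0 h1 := ⟨by linarith [hx.2], by linarith [hx.1]⟩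
  have hy' : h2 - p.2 ∈ Icc 0 h2 := ⟨by linarith [hy.2], by linarith [hy.1]⟩
  have hb : 0 ≤ b := (norm_nonneg _).trans hB
  have key : ∀ (a : ℂ) (z : ℂ), ‖a‖ ≤ b → ‖z‖ ≤ 1 → ‖a * z‖ ≤ b := fun a z h h' => by
    rw [norm_mul]; nlinarith [norm_nonneg a, norm_nonneg z]
  have e1 := key _ _ hB (norm_phiHat_le hκ hν1 p.1 hy')
  have e2 := key _ _ hT (norm_phiHat_le hκ hν1 p.1 hy)
  have e3 := key _ _ hL (norm_phiHat_le hκ hν2 p.2 hx')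
  have e4 := key _ _ hR (norm_phiHat_le hκ hν2 p.2 hx)
  unfold cellTerm
  calc _ ≤ _ := norm_add₄_le
    _ ≤ b + b + b + b := by gcongr
    _ = _ := by ring

lemma derivBound_cellTerm_fst (hκ : 0 < κ) (hν1 : 1 ≤ nuHat κ h1 n) (hν2 : 1 ≤ nuHat κ h2 n)
    (hm0 : 0 < hm) (hm1 : hm ≤ h1) (hm2 : hm ≤ h2)
    (hB : ‖aB n‖ ≤ b) (hT : ‖aT n‖ ≤ b) (hL : ‖aL n‖ ≤ b) (hR : ‖aR n‖ ≤ b) {x y : ℝ}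
    (hx : x ∈ Icc 0 h1) (hy : y ∈ Icc 0 h2) :
    DerivBound (fun s => cellTerm κ h1 h2 aB aT aL aR n (s, y)) x
      (4 * (b * ((n * π + 1) / hm))) := by
  have hx' : h1 - x ∈ Icc 0 h1 := ⟨by linarith [hx.2], by linarith [hx.1]⟩
  have hy' : h2 - y ∈ Icc 0 h2 := ⟨by linarith [hy.2], by linarith [hy.1]⟩
  have hh1 := hm0.trans_le hm1
  have hh2 := hm0.trans_le hm2
  have := ((((derivBound_phiHat_fst hκ hν1 hh1 x hy' hm0 hm1).const_mul hB).add
    ((derivBound_phiHat_fst hκ hν1 hh1 x hy hm0 hm1).const_mul hT)).add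
    ((derivBound_phiHat_snd hκ hν2 hh2 hh1 y hx' hm0 hm2 hm1).reflect.const_mul hL)).add
    ((derivBound_phiHat_snd hκ hν2 hh2 hh1 y hx hm0 hm2 hm1).const_mul hR)
  rw [show 4 * (b * ((n * π + 1) / hm)) = b * ((n * π + 1) / hm) + b * ((n * π + 1) / hm) +
    b * ((n * π + 1) / hm) + b * ((n * π + 1) / hm) by ring]
  exact this

lemma derivBound_cellTerm_snd (hκ : 0 < κ) (hν1 : 1 ≤ nuHat κ h1 n) (hν2 : 1 ≤ nuHat κ h2 n)
    (hm0 : 0 < hm) (hm1 : hm ≤ h1) (hm2 : hm ≤ h2)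
    (hB : ‖aB n‖ ≤ b) (hT : ‖aT n‖ ≤ b) (hL : ‖aL n‖ ≤ b) (hR : ‖aR n‖ ≤ b) {x y : ℝ}
    (hx : x ∈ Icc 0 h1) (hy : y ∈ Icc 0 h2) :
    DerivBound (fun s => cellTerm κ h1 h2 aB aT aL aR n (x, s)) y
      (4 * (b * ((n * π + 1) / hm))) := by
  have hx' : h1 - x ∈ Icc 0 h1 := ⟨by linarith [hx.2], by linarith [hx.1]⟩
  have hy' : h2 - y ∈ Icc 0 h2 := ⟨by linarith [hy.2], by linarith [hy.1]⟩
  have hh1 := hm0.trans_le hm1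
  have hh2 := hm0.trans_le hm2
  have := ((((derivBound_phiHat_snd hκ hν1 hh1 hh2 x hy' hm0 hm1 hm2).reflect.const_mul hB).add
    ((derivBound_phiHat_snd hκ hν1 hh1 hh2 x hy hm0 hm1 hm2).const_mul hT)).add
    ((derivBound_phiHat_fst hκ hν2 hh2 y hx' hm0 hm2).const_mul hL)).add
    ((derivBound_phiHat_fst hκ hν2 hh2 y hx hm0 hm2).const_mul hR)
  rw [show 4 * (b * ((n * π + 1) / hm)) = b * ((n * π + 1) / hm) + b * ((n * π + 1) / hm) +
    b * ((n * π + 1) / hm) + b * ((n * π + 1) / hm) by ring]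
  exact this

end CellTerm

/-- The sine coefficient of a one-dimensional remainder vanishes. -/
lemma integral_sub_sineSum_eq_zero {h : ℝ} (hh : 0 < h) {f : ℝ → ℂ} (hf : ContinuousOn f (Icc 0 h))
    {a : ℕ → ℂ} {M m : ℕ} (hm : 1 ≤ m) (hmM : m < M)
    (ha : a m = 2 / h * ∫ x in (0 : ℝ)..h, f x * sineMode h m x) :
    ∫ x in (0 : ℝ)..h, (f x - ∑ n ∈ Finset.range M, a n * sineMode h n x) * sineMode h m x = 0 := by
  have hs := continuous_sineMode h
  have e : ∀ x, (f x - ∑ n ∈ Finset.range M, a n * sineMode h n x) * sineMode h m x =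
      f x * sineMode h m x - ∑ n ∈ Finset.range M, a n * (sineMode h n x * sineMode h m x) := by
    intro x
    rw [sub_mul, Finset.sum_mul]
    simp_rw [mul_assoc]
  simp_rw [e]
  rw [intervalIntegral.integral_sub, intervalIntegral.integral_finsetSum]
  · simp_rw [intervalIntegral.integral_const_mul, integral_sineMode_mul_sineMode hh hm]
    have : (h : ℂ) ≠ 0 := by exact_mod_cast hh.ne'
    rw [Finset.sum_eq_single m (fun n _ hn => by simp [hn]) (fun h => by simp at h; omega),
      if_pos rfl,
      ha]
    push_cast
    field_simp
    ring
  · intro n _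
    exact (continuous_const.mul ((hs n).mul (hs m))).intervalIntegrable _ _
  · exact (hf.mul (hs m).continuousOn).intervalIntegrable_zero hh
  · exact (continuous_finsetSum _ fun n _ =>
      continuous_const.mul ((hs n).mul (hs m))).intervalIntegrable _ _

/-- Truncation error of the single-edge mode expansion of a Helmholtz function on a rectangle. -/
lemma RectHelm.truncation_bound {κ h1 h2 hm : ℝ} (hκ : 0 < κ) (hm0 : 0 < hm) (hm1 : hm ≤ h1)
    (hm2 : hm ≤ h2) (hA : A0cond κ h1 h2) {w : ℝ × ℝ → ℂ} (hw : RectHelm κ h1 h2 w)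
    {aB aT aL aR : ℕ → ℂ}
    (hB : ∀ n, aB n = 2 / h1 * ∫ x in (0 : ℝ)..h1, w (x, 0) * sineMode h1 n x)
    (hT : ∀ n, aT n = 2 / h1 * ∫ x in (0 : ℝ)..h1, w (x, h2) * sineMode h1 n x)
    (hL : ∀ n, aL n = 2 / h2 * ∫ y in (0 : ℝ)..h2, w (0, y) * sineMode h2 n y)
    (hR : ∀ n, aR n = 2 / h2 * ∫ y in (0 : ℝ)..h2, w (h1, y) * sineMode h2 n y)
    {n0 : ℕ} {b : ℕ → ℝ} (hν1 : ∀ n, n0 ≤ n → 1 ≤ nuHat κ h1 n)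
    (hν2 : ∀ n, n0 ≤ n → 1 ≤ nuHat κ h2 n)
    (hbB : ∀ n, n0 ≤ n → ‖aB n‖ ≤ b n) (hbT : ∀ n, n0 ≤ n → ‖aT n‖ ≤ b n)
    (hbL : ∀ n, n0 ≤ n → ‖aL n‖ ≤ b n) (hbR : ∀ n, n0 ≤ n → ‖aR n‖ ≤ b n)
    {S : ℝ} (hS : HasSum (fun k => b (k + n0) * (((k + n0 : ℕ) : ℝ) * π + 1)) S)
    {R : ℝ × ℝ → ℂ}
    (hRdef : ∀ p, R p = w p - ∑ n ∈ Finset.range n0, cellTerm κ h1 h2 aB aT aL aR n p)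
    {x y : ℝ} (hx : x ∈ Ioo 0 h1) (hy : y ∈ Ioo 0 h2) :
    ‖R (x, y)‖ ≤ 4 * S ∧ ‖deriv (fun s => R (s, y)) x‖ ≤ 4 * S / hm ∧
      ‖deriv (fun s => R (x, s)) y‖ ≤ 4 * S / hm := by
  have hh1 := hm0.trans_le hm1
  have hh2 := hm0.trans_le hm2
  set T := cellTerm κ h1 h2 aB aT aL aR with hTdef
  have hb0 : ∀ n, n0 ≤ n → 0 ≤ b n := fun n hn => (norm_nonneg _).trans (hbB n hn)
  have le0 : ∀ k : ℕ, n0 ≤ k + n0 := fun k => Nat.le_add_left _ _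
  set u : ℕ → ℝ := fun k => 4 * (b (k + n0) * (((k + n0 : ℕ) : ℝ) * π + 1)) with hu
  have hus : HasSum u (4 * S) := hS.mul_left 4
  have hTu : ∀ k, ∀ p ∈ rectC h1 h2, ‖T (k + n0) p‖ ≤ u k := fun k p hp => by
    refine (norm_cellTerm_le hκ (hν1 _ (le0 k)) (hν2 _ (le0 k)) (hbB _ (le0 k)) (hbT _ (le0 k))
      (hbL _ (le0 k)) (hbR _ (le0 k)) hp).trans ?_
    simp only [hu]
    gcongr
    apply le_mul_of_one_le_right (hb0 _ (le0 k))
    have : 0 ≤ (((k + n0 : ℕ) : ℝ) * π) := by positivity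
    linarith
  have hD1 : ∀ k, ∀ x ∈ Icc 0 h1, ∀ y ∈ Icc 0 h2,
      DerivBound (fun s => T (k + n0) (s, y)) x (u k / hm) := fun k x hx y hy => by
    have := derivBound_cellTerm_fst hκ (hν1 _ (le0 k)) (hν2 _ (le0 k)) hm0 hm1 hm2 (hbB _ (le0 k))
      (hbT _ (le0 k)) (hbL _ (le0 k)) (hbR _ (le0 k)) hx hy
    convert this using 1
    simp only [hu]; ring
  have hD2 : ∀ k, ∀ x ∈ Icc 0 h1, ∀ y ∈ Icc 0 h2,
      DerivBound (fun s => T (k + n0) (x, s)) y (u k / hm) := fun k x hx y hy => by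
    have := derivBound_cellTerm_snd hκ (hν1 _ (le0 k)) (hν2 _ (le0 k)) hm0 hm1 hm2 (hbB _ (le0 k))
      (hbT _ (le0 k)) (hbL _ (le0 k)) (hbR _ (le0 k)) hx hy
    convert this using 1
    simp only [hu]; ring
  have hTc : ∀ n, ContinuousOn (T n) (rectC h1 h2) := fun n => (rectHelm_cellTerm hκ n).continuousOn
  set P : ℕ → ℝ × ℝ → ℂ := fun M p => w p - ∑ n ∈ Finset.range M, T n p with hP
  have hPH : ∀ M, RectHelm κ h1 h2 (P M) := fun M =>
    hw.sub (RectHelm.sum _ fun n _ => rectHelm_cellTerm hκ n)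
  have m0 : (0 : ℝ) ∈ Icc 0 h1 := ⟨le_rfl, hh1.le⟩
  have m1 : h1 ∈ Icc 0 h1 := ⟨hh1.le, le_rfl⟩
  have k0 : (0 : ℝ) ∈ Icc 0 h2 := ⟨le_rfl, hh2.le⟩
  have k1 : h2 ∈ Icc 0 h2 := ⟨hh2.le, le_rfl⟩
  have hPz : ∀ M n m, 1 ≤ n → 1 ≤ m → n < M → m < M → sineCoef h1 h2 n m (P M) = 0 := by
    intro M n m hn hmm hnM hmM
    apply (hPH M).sineCoef_eq_zero hh1 hh2 (hA n m)
    · simp only [hP, hTdef, cellTerm_bottom hκ hh2 hA]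
      exact integral_sub_sineSum_eq_zero hh1 (hw.continuousOn.rect_slice_left k0) hn hnM (hB n)
    · simp only [hP, hTdef, cellTerm_top hκ hh2 hA]
      exact integral_sub_sineSum_eq_zero hh1 (hw.continuousOn.rect_slice_left k1) hn hnM (hT n)
    · simp only [hP, hTdef, cellTerm_left hκ hh1 hA]
      exact integral_sub_sineSum_eq_zero hh2 (hw.continuousOn.rect_slice_right m0) hmm hmM (hL m)
    · simp only [hP, hTdef, cellTerm_right hκ hh1 hA]
      exact integral_sub_sineSum_eq_zero hh2 (hw.continuousOn.rect_slice_right m1) hmm hmM (hR m)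
  set D : ℝ × ℝ → ℂ := fun p => R p - ∑' k, T (k + n0) p with hD
  have hRP : R = P n0 := funext hRdef
  have hDc : ContinuousOn D (rectC h1 h2) := by
    refine ContinuousOn.sub ?_ (continuousOn_tsum (fun k => hTc _) hus.summable hTu)
    rw [hRP]
    exact (hPH n0).continuousOn
  have hunif := tendstoUniformlyOn_tsum_nat hus.summable hTu
  have hDz : ∀ n m, 1 ≤ n → 1 ≤ m → sineCoef h1 h2 n m D = 0 := by
    intro n m hn hmm
    by_contra hne
    have hpos : 0 < ‖sineCoef h1 h2 n m D‖ / (2 * h1 * h2) := by positivity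
    have hev := (Metric.tendstoUniformlyOn_iff.mp hunif _ hpos).and
      (Filter.eventually_gt_atTop (n + m))
    obtain ⟨M, hM1, hM2⟩ := hev.exists
    have e1 : sineCoef h1 h2 n m D = sineCoef h1 h2 n m (P (n0 + M)) +
        sineCoef h1 h2 n m (fun p => (-1) * (P (n0 + M) p - D p)) := by
      rw [← sineCoef_add hh1 hh2 (g := fun p => (-1) * (P (n0 + M) p - D p)) (hPH _).continuousOn
        (continuousOn_const.mul ((hPH _).continuousOn.sub hDc))]
      congr 1; funext p; ring
    rw [hPz _ n m hn hmm (by omega) (by omega), zero_add] at e1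
    have e2 : ‖sineCoef h1 h2 n m D‖ ≤ ‖sineCoef h1 h2 n m D‖ / (2 * h1 * h2) * h1 * h2 := by
      conv_lhs => rw [e1]
      refine norm_sineCoef_le hh1 hh2 fun p hp => ?_
      have e : -1 * (P (n0 + M) p - D p) =
          -(∑' k, T (k + n0) p - ∑ k ∈ Finset.range M, T (k + n0) p) := by
        simp only [hD, hP, hRdef, Finset.sum_range_add, Nat.add_comm _ n0]
        ring
      rw [e, norm_neg, ← dist_eq_norm]
      exact (hM1 p hp).le
    have e3 : ‖sineCoef h1 h2 n m D‖ / (2 * h1 * h2) * h1 * h2 = ‖sineCoef h1 h2 n m D‖ / 2 := by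
      field_simp
    rw [e3] at e2
    have : 0 < ‖sineCoef h1 h2 n m D‖ := norm_pos_iff.mpr hne
    linarith
  have hRsum : ∀ x ∈ Ioo 0 h1, ∀ y ∈ Ioo 0 h2, R (x, y) = ∑' k, T (k + n0) (x, y) :=
    fun x hx y hy => sub_eq_zero.mp (eq_zero_of_sineCoef_eq_zero hh1 hh2 hDc hDz x hx y hy)
  have hxc := Ioo_subset_Icc_self hx
  have hyc := Ioo_subset_Icc_self hy
  have husm : HasSum (fun k => u k / hm) (4 * S / hm) := hus.div_const hm
  have hsum0 : Summable fun k => T (k + n0) (x, y) :=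
    Summable.of_norm_bounded hus.summable fun k => hTu k _ ⟨hxc, hyc⟩
  refine ⟨?_, ?_, ?_⟩
  · rw [hRsum x hx y hy]
    exact tsum_of_norm_bounded hus fun k => hTu k _ ⟨hxc, hyc⟩
  · have hd := hasDerivAt_tsum_of_isPreconnected (g := fun k s => T (k + n0) (s, y))
      (g' := fun k s => deriv (fun s => T (k + n0) (s, y)) s) husm.summable isOpen_Ioo
      isPreconnected_Ioo
      (fun k s hs => (hD1 k s (Ioo_subset_Icc_self hs) y hyc).hasDerivAt)
      (fun k s hs => (hD1 k s (Ioo_subset_Icc_self hs) y hyc).norm_deriv_le) hx hsum0 hx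
    have he : (fun s => R (s, y)) =ᶠ[nhds x] fun s => ∑' k, T (k + n0) (s, y) := by
      filter_upwards [isOpen_Ioo.mem_nhds hx] with s hs using hRsum s hs y hy
    rw [he.deriv_eq, hd.deriv]
    exact tsum_of_norm_bounded husm fun k => (hD1 k x hxc y hyc).norm_deriv_le
  · have hd := hasDerivAt_tsum_of_isPreconnected (g := fun k s => T (k + n0) (x, s))
      (g' := fun k s => deriv (fun s => T (k + n0) (x, s)) s) husm.summable isOpen_Ioo
      isPreconnected_Ioo
      (fun k s hs => (hD2 k x hxc s (Ioo_subset_Icc_self hs)).hasDerivAt)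
      (fun k s hs => (hD2 k x hxc s (Ioo_subset_Icc_self hs)).norm_deriv_le) hy hsum0 hy
    have he : (fun s => R (x, s)) =ᶠ[nhds y] fun s => ∑' k, T (k + n0) (x, s) := by
      filter_upwards [isOpen_Ioo.mem_nhds hy] with s hs using hRsum x hx s hs
    rw [he.deriv_eq, hd.deriv]
    exact tsum_of_norm_bounded husm fun k => (hD2 k x hxc y hyc).norm_deriv_le

/-! ### Lagrange coefficients at the node frequencies -/

open Polynomial in
/-- The linear functional on polynomials with prescribed moments. -/
def momentFun (b : ℕ → ℂ) : ℂ[X] →ₗ[ℂ] ℂ := Polynomial.lsum fun i => b i • LinearMap.id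

section Moments

open Polynomial

lemma momentFun_monomial (b : ℕ → ℂ) (i : ℕ) (a : ℂ) : momentFun b (monomial i a) = a * b i := by
  simp [momentFun, Polynomial.lsum_apply, mul_comm]

lemma momentFun_X_pow (b : ℕ → ℂ) (i : ℕ) : momentFun b (X ^ i) = b i := by
  rw [← monomial_one_right_eq_X_pow, momentFun_monomial, one_mul]

lemma momentFun_X_mul (b : ℕ → ℂ) (q : ℂ[X]) :
    momentFun b (X * q) = momentFun (fun i => b (i + 1)) q := by
  induction q using Polynomial.induction_on' with
  | add p q hp hq => rw [mul_add, map_add, map_add, hp, hq]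
  | monomial n a => rw [X_mul_monomial, momentFun_monomial, momentFun_monomial]

lemma momentFun_C_mul (b : ℕ → ℂ) (a : ℂ) (q : ℂ[X]) :
    momentFun b (C a * q) = a * momentFun b q := by
  rw [← smul_eq_C_mul, map_smul, smul_eq_mul]

lemma norm_momentFun_prod_le (s : Finset ℕ) {x : ℕ → ℝ} (hx : ∀ k, 0 ≤ x k) {M : ℝ} :
    ∀ b : ℕ → ℂ, (∀ i ≤ s.card, ‖b i‖ ≤ M) →
      ‖momentFun b (∏ k ∈ s, (X + C (x k : ℂ)))‖ ≤ M * ∏ k ∈ s, (1 + x k) := by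
  induction s using Finset.induction_on with
  | empty =>
    intro b hb
    have := momentFun_X_pow b 0
    rw [pow_zero] at this
    simpa [this] using hb 0
  | insert a s ha ih =>
    intro b hb
    rw [Finset.card_insert_of_notMem ha] at hb
    rw [Finset.prod_insert ha, Finset.prod_insert ha, add_mul, map_add, momentFun_X_mul,
      momentFun_C_mul]
    have h1 := ih (fun i => b (i + 1)) fun i hi => hb (i + 1) (by omega)
    have h2 := ih b fun i hi => hb i (by omega)
    calc _ ≤ _ := norm_add_le _ _
      _ ≤ M * ∏ k ∈ s, (1 + x k) + x a * (M * ∏ k ∈ s, (1 + x k)) := by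
        rw [norm_mul, Complex.norm_real, Real.norm_eq_abs, abs_of_nonneg (hx a)]
        gcongr
        exact hx a
      _ = _ := by ring

lemma prod_erase_abs_sub (m j : ℕ) :
    ∏ k ∈ (Finset.range (m + 1 + j)).erase m, |(k : ℝ) - m| = (m.factorial * j.factorial : ℕ) := by
  induction j with
  | zero =>
    have : (Finset.range (m + 1)).erase m = Finset.range m := by
      ext k; simp; omega
    rw [add_zero, this, ← Finset.prod_range_reflect]
    rw [Nat.factorial_zero, mul_one, ← Finset.prod_range_add_one_eq_factorial]
    push_cast
    refine Finset.prod_congr rfl fun k hk => ?_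
    rw [Finset.mem_range] at hk
    have : ((m - 1 - k : ℕ) : ℝ) = m - 1 - k := by
      rw [Nat.cast_sub (by omega), Nat.cast_sub (by omega)]; simp
    rw [this, abs_sub_comm, abs_of_nonneg (by linarith [(Nat.cast_nonneg k : (0 : ℝ) ≤ k)])]
    ring
  | succ j ih =>
    have : (Finset.range (m + 1 + (j + 1))).erase m =
        insert (m + 1 + j) ((Finset.range (m + 1 + j)).erase m) := by
      ext k; simp; omega
    rw [this, Finset.prod_insert (by simp), ih, Nat.factorial_succ]
    push_cast
    rw [show (m : ℝ) + 1 + j - m = j + 1 by ring, abs_of_nonneg (by positivity)]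
    ring

lemma prod_range_add_succ_mul_factorial (m N : ℕ) :
    (∏ k ∈ Finset.range N, ((k : ℝ) + m + 1)) * m.factorial = (N + m).factorial := by
  induction N with
  | zero => simp
  | succ N ih =>
    rw [Finset.prod_range_succ, mul_right_comm, ih, show N + 1 + m = (N + m) + 1 by ring,
      Nat.factorial_succ]
    push_cast; ring

lemma prod_odd_sq_le (N : ℕ) :
    ∏ k ∈ Finset.range (N + 1), (2 * (k : ℝ) + 1) ^ 2 ≤ 4 ^ N * ((N + 1).factorial : ℝ) ^ 2 := by
  induction N with
  | zero => simp
  | succ N ih =>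
    rw [Finset.prod_range_succ, Nat.factorial_succ (N + 1)]
    calc _ ≤ (4 ^ N * ((N + 1).factorial : ℝ) ^ 2) * (4 * ((N + 1 : ℕ) + 1 : ℝ) ^ 2) := by
          gcongr
          nlinarith [(Nat.cast_nonneg (N + 1) : (0 : ℝ) ≤ ((N + 1 : ℕ) : ℝ))]
      _ = _ := by push_cast; ring

lemma factorial_mul_factorial_ge (m j : ℕ) :
    (m + j).factorial * (m + j + 1).factorial ≤ j.factorial * (m + 1 + j + m).factorial := by
  have h := Nat.choose_le_middle (m + 1 + j + m) (2 * (m + j) + 1)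
  have e1 := Nat.choose_mul_factorial_mul_factorial (show m + 1 + j + m ≤ 2 * (m + j) + 1 by omega)
  have e2 := Nat.choose_mul_factorial_mul_factorial (show m + j ≤ 2 * (m + j) + 1 by omega)
  rw [show (2 * (m + j) + 1) / 2 = m + j by omega] at h
  rw [show 2 * (m + j) + 1 - (m + 1 + j + m) = j by omega] at e1
  rw [show 2 * (m + j) + 1 - (m + j) = m + j + 1 by omega, ← e1] at e2
  have hp : 0 < (2 * (m + j) + 1).choose (m + j) := Nat.choose_pos (by omega)
  refine le_of_mul_le_mul_left ?_ hp
  calc _ = _ := by rw [← mul_assoc, e2]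
    _ ≤ (2 * (m + j) + 1).choose (m + j) * (m + 1 + j + m).factorial * j.factorial := by gcongr
    _ = _ := by ring

/-- The Lebesgue-type product for the squared odd integers. -/
lemma prod_erase_odd_sq_le {N m : ℕ} (hm : m < N) :
    ∏ k ∈ (Finset.range N).erase m,
      ((2 * (k : ℝ) + 1) ^ 2 / |(2 * (k : ℝ) + 1) ^ 2 - (2 * (m : ℝ) + 1) ^ 2|) ≤ (N : ℝ) := by
  obtain ⟨j, rfl⟩ : ∃ j, N = m + 1 + j := ⟨N - (m + 1), by omega⟩
  have hmem : m ∈ Finset.range (m + 1 + j) := Finset.mem_range.mpr hm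
  have hcard : ((Finset.range (m + 1 + j)).erase m).card = m + j := by
    rw [Finset.card_erase_of_mem hmem, Finset.card_range]; omega
  have e : ∀ k : ℕ, |(2 * (k : ℝ) + 1) ^ 2 - (2 * (m : ℝ) + 1) ^ 2| =
      4 * |(k : ℝ) - m| * ((k : ℝ) + m + 1) := fun k => by
    rw [show (2 * (k : ℝ) + 1) ^ 2 - (2 * (m : ℝ) + 1) ^ 2 =
      4 * ((k : ℝ) - m) * ((k : ℝ) + m + 1) by
      ring, abs_mul, abs_mul, abs_of_nonneg (show (0 : ℝ) ≤ (k : ℝ) + m + 1 by positivity)]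
    norm_num
  simp_rw [e]
  rw [Finset.prod_div_distrib, Finset.prod_mul_distrib, Finset.prod_mul_distrib,
    prod_erase_abs_sub, Finset.prod_const, hcard]
  have h1 := Finset.mul_prod_erase (Finset.range (m + 1 + j)) (fun k => (k : ℝ) + m + 1) hmem
  have h2 := Finset.mul_prod_erase (Finset.range (m + 1 + j)) (fun k => (2 * (k : ℝ) + 1) ^ 2) hmem
  have h3 := prod_range_add_succ_mul_factorial m (m + 1 + j)
  have h4 := prod_odd_sq_le (m + j)
  rw [show m + j + 1 = m + 1 + j by ring] at h4
  set A := ∏ k ∈ (Finset.range (m + 1 + j)).erase m, (2 * (k : ℝ) + 1) ^ 2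
  set B := ∏ k ∈ (Finset.range (m + 1 + j)).erase m, ((k : ℝ) + m + 1)
  have hB : (0 : ℝ) < B := Finset.prod_pos fun k _ => by positivity
  have hA : 0 ≤ A := Finset.prod_nonneg fun k _ => by positivity
  have h5 : (((m + j).factorial * (m + 1 + j).factorial : ℕ) : ℝ) ≤
      (j.factorial * (m + 1 + j + m).factorial : ℕ) := by
    have := factorial_mul_factorial_ge m j
    rw [show m + j + 1 = m + 1 + j by ring] at this
    exact_mod_cast this
  push_cast at h5
  rw [div_le_iff₀ (by positivity)]
  have h6 : (0 : ℝ) < 2 * m + 1 := by positivity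
  refine le_of_mul_le_mul_left (a := (2 * (m : ℝ) + 1) ^ 2) ?_ (by positivity)
  rw [h2]
  refine h4.trans ?_
  have h7 : ((m + 1 + j).factorial : ℝ) = ((m + 1 + j : ℕ) : ℝ) * ((m + j).factorial : ℝ) := by
    rw [show m + 1 + j = (m + j) + 1 by ring, Nat.factorial_succ]; push_cast; ring
  have h8 : (2 * (m : ℝ) + 1) * B * m.factorial = ((m + 1 + j + m).factorial : ℝ) := by
    rw [← h3, ← h1]; ring
  calc (4 : ℝ) ^ (m + j) * ((m + 1 + j).factorial : ℝ) ^ 2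
      = 4 ^ (m + j) * ((m + 1 + j : ℕ) : ℝ) *
        (((m + j).factorial : ℝ) * ((m + 1 + j).factorial : ℝ)) := by
        rw [sq]; nth_rewrite 1 [h7]; ring
    _ ≤ 4 ^ (m + j) * ((m + 1 + j : ℕ) : ℝ) *
        ((j.factorial : ℝ) * ((m + 1 + j + m).factorial : ℝ)) := by gcongr
    _ = 4 ^ (m + j) * ((m + 1 + j : ℕ) : ℝ) *
        ((j.factorial : ℝ) * (1 * (2 * (m : ℝ) + 1) * B * m.factorial)) := by rw [← h8]; ring
    _ ≤ 4 ^ (m + j) * ((m + 1 + j : ℕ) : ℝ) *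
        ((j.factorial : ℝ) * ((2 * (m : ℝ) + 1) * (2 * (m : ℝ) + 1) * B * m.factorial)) := by
        gcongr
        linarith [(Nat.cast_nonneg m : (0 : ℝ) ≤ m)]
    _ = _ := by push_cast; ring

/-- The node frequencies `(2m+1)π/(2t)`. -/
def nodeNu (t : ℝ) (m : ℕ) : ℝ := (2 * (m : ℝ) + 1) * π / (2 * t)

lemma nodeNu_pos {t : ℝ} (ht : 0 < t) (m : ℕ) : 0 < nodeNu t m := by
  unfold nodeNu; positivity

/-- Quadrature representation of a moment functional at the squared node frequencies. -/
lemma exists_node_coefs {t : ℝ} (ht : 0 < t) (N : ℕ) {b : ℕ → ℂ} {M : ℝ} (hM : 0 ≤ M)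
    (hb : ∀ i < N, ‖b i‖ ≤ M) :
    ∃ c : ℕ → ℂ, (∀ q : ℂ[X], q.degree < N →
        momentFun b q = ∑ m ∈ Finset.range N, c m * q.eval (-(nodeNu t m : ℂ) ^ 2)) ∧
      ∀ m < N, ‖c m‖ ≤ N * (∏ k ∈ Finset.range N, (1 + 1 / nodeNu t k ^ 2)) * M := by
  set z : ℕ → ℂ := fun m => -(nodeNu t m : ℂ) ^ 2 with hz
  have hinj : Set.InjOn z (Finset.range N) := by
    intro a _ b _ hab
    simp only [hz, neg_inj] at hab
    have h1 : nodeNu t a ^ 2 = nodeNu t b ^ 2 := by exact_mod_cast hab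
    have h2 := (sq_eq_sq₀ (nodeNu_pos ht a).le (nodeNu_pos ht b).le).mp h1
    unfold nodeNu at h2
    have h3 : 2 * (a : ℝ) + 1 = 2 * (b : ℝ) + 1 := by
      field_simp at h2
      exact h2
    exact_mod_cast (by linarith : (a : ℝ) = b)
  refine ⟨fun m => momentFun b (Lagrange.basis (Finset.range N) z m), fun q hq => ?_,
    fun m hm => ?_⟩
  · have h0 := congrArg (momentFun b)
      (Lagrange.eq_interpolate (s := Finset.range N) (f := q) hinj (by simpa using hq))
    rw [h0, Lagrange.interpolate_apply, map_sum]
    refine Finset.sum_congr rfl fun m _ => ?_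
    rw [momentFun_C_mul, mul_comm]
  · have hmem : m ∈ Finset.range N := Finset.mem_range.mpr hm
    have e : Lagrange.basis (Finset.range N) z m =
        C (∏ k ∈ (Finset.range N).erase m, (z m - z k)⁻¹) *
          ∏ k ∈ (Finset.range N).erase m, (X + C ((nodeNu t k ^ 2 : ℝ) : ℂ)) := by
      unfold Lagrange.basis Lagrange.basisDivisor
      rw [Finset.prod_mul_distrib, map_prod]
      congr 1
      refine Finset.prod_congr rfl fun k _ => ?_
      simp [hz]
    simp only
    rw [e, momentFun_C_mul, norm_mul, norm_prod]
    have h1 := norm_momentFun_prod_le ((Finset.range N).erase m) (x := fun k => nodeNu t k ^ 2)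
      (fun k => sq_nonneg _) (M := M) b fun i hi => hb i (by
        rw [Finset.card_erase_of_mem hmem, Finset.card_range] at hi; omega)
    have h2 := prod_erase_odd_sq_le hm
    have h3 : ∏ k ∈ (Finset.range N).erase m, (1 + 1 / nodeNu t k ^ 2) ≤
        ∏ k ∈ Finset.range N, (1 + 1 / nodeNu t k ^ 2) := by
      rw [← Finset.mul_prod_erase _ _ hmem]
      refine le_mul_of_one_le_left (Finset.prod_nonneg fun k _ => by positivity) ?_
      have : 0 ≤ 1 / nodeNu t m ^ 2 := by positivity
      linarith
    calc _ ≤ (∏ k ∈ (Finset.range N).erase m, ‖(z m - z k)⁻¹‖) *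
          (M * ∏ k ∈ (Finset.range N).erase m, (1 + nodeNu t k ^ 2)) := by gcongr
      _ = (∏ k ∈ (Finset.range N).erase m,
            (2 * (k : ℝ) + 1) ^ 2 / |(2 * (k : ℝ) + 1) ^ 2 - (2 * (m : ℝ) + 1) ^ 2|) *
          (∏ k ∈ (Finset.range N).erase m, (1 + 1 / nodeNu t k ^ 2)) * M := by
        rw [mul_comm M, ← mul_assoc, ← Finset.prod_mul_distrib, ← Finset.prod_mul_distrib]
        congr 1
        refine Finset.prod_congr rfl fun k hk => ?_
        have hkm : k ≠ m := Finset.ne_of_mem_erase hk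
        have e1 : z m - z k = ((nodeNu t k ^ 2 - nodeNu t m ^ 2 : ℝ) : ℂ) := by
          simp only [hz]; push_cast; ring
        have hd : |(2 * (k : ℝ) + 1) ^ 2 - (2 * (m : ℝ) + 1) ^ 2| ≠ 0 := by
          rw [abs_ne_zero, show (2 * (k : ℝ) + 1) ^ 2 - (2 * (m : ℝ) + 1) ^ 2 =
            4 * ((k : ℝ) - m) * (k + m + 1) by ring]
          have : (k : ℝ) - m ≠ 0 := sub_ne_zero.mpr (by exact_mod_cast hkm)
          positivity
        have e2 : |nodeNu t k ^ 2 - nodeNu t m ^ 2| = (π / (2 * t)) ^ 2 *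
            |(2 * (k : ℝ) + 1) ^ 2 - (2 * (m : ℝ) + 1) ^ 2| := by
          rw [show nodeNu t k ^ 2 - nodeNu t m ^ 2 = (π / (2 * t)) ^ 2 *
            ((2 * (k : ℝ) + 1) ^ 2 - (2 * (m : ℝ) + 1) ^ 2) by unfold nodeNu; ring, abs_mul,
            abs_of_nonneg (sq_nonneg (π / (2 * t)))]
        have hπ := Real.pi_pos
        have e3 : nodeNu t k ^ 2 = (π / (2 * t)) ^ 2 * (2 * (k : ℝ) + 1) ^ 2 := by
          unfold nodeNu; ring
        rw [e1, norm_inv, Complex.norm_real, Real.norm_eq_abs, e2, e3]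
        have : (π / (2 * t)) ^ 2 ≠ 0 := by positivity
        generalize (π / (2 * t)) ^ 2 = P at *
        have : (2 * (k : ℝ) + 1) ^ 2 ≠ 0 := by positivity
        field_simp
        ring
      _ ≤ N * (∏ k ∈ Finset.range N, (1 + 1 / nodeNu t k ^ 2)) * M := by
        refine mul_le_mul_of_nonneg_right (mul_le_mul h2 h3 ?_ (Nat.cast_nonneg N)) hM
        exact Finset.prod_nonneg fun k _ => by positivity

end Moments

/-! ### The hyperbolic sine product -/

lemma prod_le_sinh {t : ℝ} (ht : 0 < t) (M : ℕ) :
    t * ∏ k ∈ Finset.range M, (1 + t ^ 2 / (((k : ℝ) + 1) ^ 2 * π ^ 2)) ≤ Real.sinh t := by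
  have hπ := Real.pi_pos
  set f : ℕ → ℝ := fun M => t * ∏ k ∈ Finset.range M, (1 + t ^ 2 / (((k : ℝ) + 1) ^ 2 * π ^ 2))
  have hmono : Monotone f := monotone_nat_of_le_succ fun n => by
    simp only [f, Finset.prod_range_succ]
    have h1 : 0 ≤ ∏ k ∈ Finset.range n, (1 + t ^ 2 / (((k : ℝ) + 1) ^ 2 * π ^ 2)) :=
      Finset.prod_nonneg fun k _ => by positivity
    gcongr
    apply le_mul_of_one_le_right h1
    have : 0 ≤ t ^ 2 / (((n : ℝ) + 1) ^ 2 * π ^ 2) := by positivity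
    linarith
  have hlim := Complex.tendsto_euler_sin_prod ((t / π : ℝ) * Complex.I)
  have hl : Filter.Tendsto f Filter.atTop (nhds (Real.sinh t)) := by
    have h2 : ∀ n : ℕ, π * ((t / π : ℝ) * Complex.I) * ∏ j ∈ Finset.range n,
        (1 - ((t / π : ℝ) * Complex.I) ^ 2 / ((j : ℂ) + 1) ^ 2) = (f n : ℂ) * Complex.I := by
      intro n
      simp only [f]
      have hc : (π : ℂ) ≠ 0 := by exact_mod_cast hπ.ne'
      push_cast
      rw [show (π : ℂ) * (t / π * Complex.I) = t * Complex.I by field_simp]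
      rw [mul_right_comm]
      congr 2
      refine Finset.prod_congr rfl fun j _ => ?_
      rw [mul_pow, Complex.I_sq]
      have : (j : ℂ) + 1 ≠ 0 := by exact_mod_cast j.succ_ne_zero
      field_simp
      ring
    have h3 : Complex.sin (π * ((t / π : ℝ) * Complex.I)) = (Real.sinh t : ℂ) * Complex.I := by
      rw [show (π : ℂ) * ((t / π : ℝ) * Complex.I) = (t : ℂ) * Complex.I by
        have hc : (π : ℂ) ≠ 0 := by exact_mod_cast hπ.ne'
        push_cast; field_simp, Complex.sin_mul_I]
      push_cast; rfl
    simp_rw [h2, h3] at hlim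
    have h4 := (Complex.continuous_im.tendsto _).comp hlim
    simpa [Function.comp_def, Complex.sinh_ofReal_re] using h4
  exact hmono.ge_of_tendsto hl M

/-- The node product is exponentially smaller than `exp t`. -/
lemma prod_nodeNu_le {t τ : ℝ} (ht : 1 ≤ t) (hτ : 1 ≤ τ) {N : ℕ} (hN : (N : ℝ) = τ / π * t)
    (hN1 : 1 ≤ N) :
    ∏ k ∈ Finset.range N, (1 + 1 / nodeNu t k ^ 2) ≤
      (1 + 4 * t ^ 2) * Real.exp t * ((1 + 1 / (4 * τ ^ 2)) ^ N)⁻¹ := by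
  have hπ := Real.pi_pos
  have ht0 : 0 < t := by linarith
  obtain ⟨n, rfl⟩ : ∃ n, N = n + 1 := ⟨N - 1, by omega⟩
  set g : ℕ → ℝ := fun k => 1 + t ^ 2 / (((k : ℝ) + 1) ^ 2 * π ^ 2) with hg
  have hg0 : ∀ k, 0 < g k := fun k => by simp only [hg]; positivity
  have h1 : ∏ k ∈ Finset.range (n + 1), (1 + 1 / nodeNu t k ^ 2) ≤
      (∏ k ∈ Finset.range n, g k) * (1 + 4 * t ^ 2) := by
    rw [Finset.prod_range_succ']
    apply mul_le_mul
    · apply Finset.prod_le_prod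
      · intro k _; positivity
      · intro k _
        simp only [hg, nodeNu]
        rw [div_pow, one_div_div]
        push_cast
        gcongr 1 + ?_
        rw [div_le_div_iff₀ (by positivity) (by positivity)]
        have : (0 : ℝ) ≤ k := Nat.cast_nonneg k
        have h : (2 * ((k : ℝ) + 1)) ^ 2 ≤ (2 * ((k : ℝ) + 1) + 1) ^ 2 := by gcongr; linarith
        nlinarith [mul_le_mul_of_nonneg_left h (show 0 ≤ t ^ 2 * π ^ 2 by positivity)]
    · simp only [nodeNu]
      rw [div_pow, one_div_div]
      gcongr 1 + ?_
      rw [div_le_iff₀ (by positivity)]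
      have : 1 ≤ π ^ 2 := by nlinarith [Real.pi_gt_three]
      push_cast
      nlinarith [mul_le_mul_of_nonneg_left this (show 0 ≤ t ^ 2 by positivity)]
    · positivity
    · exact Finset.prod_nonneg fun k _ => (hg0 k).le
  have h2 := prod_le_sinh ht0 (n + (n + 1))
  rw [Finset.prod_range_add] at h2
  have h3 : (1 + 1 / (4 * τ ^ 2)) ^ (n + 1) ≤ ∏ k ∈ Finset.range (n + 1), g (n + k) := by
    have : (1 + 1 / (4 * τ ^ 2)) ^ (n + 1) =
        ∏ k ∈ Finset.range (n + 1), (1 + 1 / (4 * τ ^ 2)) := by simp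
    rw [this]
    apply Finset.prod_le_prod
    · intro k _; positivity
    · intro k hk
      rw [Finset.mem_range] at hk
      simp only [hg]
      gcongr 1 + ?_
      rw [div_le_div_iff₀ (by positivity) (by positivity)]
      have h5 : ((n + k : ℕ) : ℝ) + 1 ≤ 2 * ((n + 1 : ℕ) : ℝ) := by
        exact_mod_cast (by omega : n + k + 1 ≤ 2 * (n + 1))
      rw [hN] at h5
      have h6 : (((n + k : ℕ) : ℝ) + 1) ^ 2 ≤ (2 * (τ / π * t)) ^ 2 := by gcongr
      have h7 : (2 * (τ / π * t)) ^ 2 * π ^ 2 = t ^ 2 * (4 * τ ^ 2) := by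
        field_simp; ring
      nlinarith [mul_le_mul_of_nonneg_right h6 (show 0 ≤ π ^ 2 by positivity)]
  have h4 : Real.sinh t ≤ Real.exp t := by
    have h5 := Real.cosh_add_sinh t
    have h6 := Real.cosh_pos t
    linarith
  have hpg : 0 ≤ ∏ k ∈ Finset.range n, g k := Finset.prod_nonneg fun k _ => (hg0 k).le
  have h5 : (∏ k ∈ Finset.range n, g k) * (1 + 1 / (4 * τ ^ 2)) ^ (n + 1) ≤ Real.exp t := by
    refine le_trans ?_ (h2.trans h4)
    have h8 : (∏ k ∈ Finset.range n, g k) * (1 + 1 / (4 * τ ^ 2)) ^ (n + 1) ≤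
        (∏ k ∈ Finset.range n, g k) * ∏ k ∈ Finset.range (n + 1), g (n + k) := by gcongr
    refine h8.trans (le_mul_of_one_le_left ?_ ht)
    exact mul_nonneg hpg (Finset.prod_nonneg fun k _ => (hg0 _).le)
  refine h1.trans ?_
  rw [← div_eq_mul_inv, le_div_iff₀ (by positivity)]
  calc _ = (1 + 4 * t ^ 2) * ((∏ k ∈ Finset.range n, g k) * (1 + 1 / (4 * τ ^ 2)) ^ (n + 1)) := by
        ring
    _ ≤ _ := by gcongr

/-! ### Decay of sine coefficients of corrected edge traces -/

/-- Successive derivatives of `csin (a x + b)`. -/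
def harm (a b : ℂ) (k : ℕ) (x : ℝ) : ℂ := a ^ k * Complex.sin (a * x + b + k * (π / 2 : ℝ))

lemma hasDerivAt_harm (a b : ℂ) (k : ℕ) (x : ℝ) :
    HasDerivAt (harm a b k) (harm a b (k + 1) x) x := by
  have h1 := (hasDerivAt_csin_affine a (b + k * (π / 2 : ℝ)) x).const_mul (a ^ k)
  simp only [← add_assoc] at h1
  refine h1.congr_deriv ?_
  unfold harm
  rw [show a * (x : ℂ) + b + ((k + 1 : ℕ) : ℂ) * (π / 2 : ℝ) =
    a * x + b + k * (π / 2 : ℝ) + (π / 2 : ℂ) by push_cast; ring, Complex.sin_add_pi_div_two]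
  ring

lemma harm_even (a b : ℂ) (j : ℕ) (x : ℝ) :
    harm a b (2 * j) x = (-a ^ 2) ^ j * Complex.sin (a * x + b) := by
  induction j with
  | zero => simp [harm]
  | succ j ih =>
    rw [pow_succ, mul_right_comm, ← ih]
    unfold harm
    rw [show a * (x : ℂ) + b + ((2 * (j + 1) : ℕ) : ℂ) * (π / 2 : ℝ) =
      a * x + b + (2 * j : ℕ) * (π / 2 : ℝ) + π by push_cast; ring, Complex.sin_add_pi]
    ring

lemma harm_odd (a b : ℂ) (j : ℕ) (x : ℝ) :
    harm a b (2 * j + 1) x = a * ((-a ^ 2) ^ j * Complex.cos (a * x + b)) := by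
  have h1 := (hasDerivAt_harm a b (2 * j) x)
  have h2 : HasDerivAt (harm a b (2 * j)) (a * ((-a ^ 2) ^ j * Complex.cos (a * x + b))) x := by
    have : harm a b (2 * j) = fun y : ℝ => (-a ^ 2) ^ j * Complex.sin (a * y + b) :=
      funext fun y => harm_even a b j y
    rw [this]
    exact ((hasDerivAt_csin_affine a b x).const_mul _).congr_deriv (by ring)
  exact h1.unique h2

/-- Sine coefficients of an edge trace corrected by corner modes decay algebraically at the order
of the corner matching. -/
lemma norm_integral_corrected_trace_le {h κ τ M0 Mc Q : ℝ} (hh : 0 < h) (hκ : 0 ≤ κ) (hτ : 0 ≤ τ)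
    {N : ℕ} {G : ℕ → ℝ → ℂ} {a c0 c1 : ℕ → ℂ}
    (hG : ∀ k, ∀ x ∈ Icc 0 h, HasDerivAt (G k) (G (k + 1) x) x)
    (hG0 : ∀ j ≤ N, G (2 * j) 0 = ∑ m ∈ Finset.range (N + 1), c0 m * (-a m ^ 2) ^ j)
    (hGh : ∀ j ≤ N, G (2 * j) h = ∑ m ∈ Finset.range (N + 1), c1 m * (-a m ^ 2) ^ j)
    (hGM : ∀ x ∈ Icc 0 h, ‖G (2 * N + 1) x‖ ≤ κ ^ (2 * N + 1) * M0)
    (hs : ∀ m < N + 1, Complex.sin (a m * h) ≠ 0)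
    (ha : ∀ m < N + 1, ‖a m‖ ≤ κ * τ)
    (hQ : ∀ m < N + 1, ∀ x ∈ Icc 0 h, ‖Complex.cos (a m * x) / Complex.sin (a m * h)‖ ≤ Q)
    (hc0 : ∀ m < N + 1, ‖c0 m‖ ≤ Mc) (hc1 : ∀ m < N + 1, ‖c1 m‖ ≤ Mc) {n : ℕ} (hn : 1 ≤ n) :
    ‖∫ x in (0 : ℝ)..h, (G 0 x - ∑ m ∈ Finset.range (N + 1), c0 m * ratio (a m) h (h - x) -
        ∑ m ∈ Finset.range (N + 1), c1 m * ratio (a m) h x) * sineMode h n x‖ ≤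
      h * (κ * h / (n * π)) ^ (2 * N + 1) *
        (M0 + 2 * (N + 1) * Mc * τ ^ (2 * N + 1) * Q) := by
  have hπ := Real.pi_pos
  set F : ℕ → ℝ → ℂ := fun k x => G k x -
    ∑ m ∈ Finset.range (N + 1), c0 m * (harm (-a m) (a m * h) k x / Complex.sin (a m * h)) -
    ∑ m ∈ Finset.range (N + 1), c1 m * (harm (a m) 0 k x / Complex.sin (a m * h)) with hF
  have hF0 : ∀ x : ℝ, F 0 x = G 0 x -
      ∑ m ∈ Finset.range (N + 1), c0 m * ratio (a m) h (h - x) -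
        ∑ m ∈ Finset.range (N + 1), c1 m * ratio (a m) h x := by
    intro x
    simp only [hF, harm, ratio]
    congr 2
    · refine Finset.sum_congr rfl fun m _ => ?_
      rw [show -a m * (x : ℂ) + a m * h + (0 : ℕ) * (π / 2 : ℝ) = a m * ((h - x : ℝ) : ℂ) by
        push_cast; ring]
      simp
    · funext m
      simp
  simp_rw [← hF0]
  have hdF : ∀ k, ∀ x ∈ Icc 0 h, HasDerivAt (F k) (F (k + 1) x) x := by
    intro k x hx
    refine ((hG k x hx).sub (HasDerivAt.fun_sum fun m _ => ?_)).sub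
      (HasDerivAt.fun_sum fun m _ => ?_)
    · exact ((hasDerivAt_harm _ _ k x).div_const _).const_mul _
    · exact ((hasDerivAt_harm _ _ k x).div_const _).const_mul _
  have hend : ∀ j ≤ N, F (2 * j) 0 = 0 ∧ F (2 * j) h = 0 := by
    intro j hj
    constructor
    · simp only [hF]
      rw [hG0 j hj, sub_sub, ← Finset.sum_add_distrib, ← Finset.sum_sub_distrib]
      refine Finset.sum_eq_zero fun m hm => ?_
      have := hs m (Finset.mem_range.mp hm)
      rw [harm_even, harm_even]
      simp only [Complex.ofReal_zero, mul_zero, zero_add, Complex.sin_zero, zero_div, add_zero,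
        neg_sq]
      field_simp
      ring
    · simp only [hF]
      rw [hGh j hj, sub_sub, ← Finset.sum_add_distrib, ← Finset.sum_sub_distrib]
      refine Finset.sum_eq_zero fun m hm => ?_
      have := hs m (Finset.mem_range.mp hm)
      rw [harm_even, harm_even, show -a m * (h : ℂ) + a m * h = 0 by ring]
      simp only [Complex.sin_zero, mul_zero, zero_div, add_zero, zero_add]
      field_simp
      ring
  have hpow : ∀ m < N + 1, ‖a m‖ * ‖a m‖ ^ (2 * N) ≤ κ ^ (2 * N + 1) * τ ^ (2 * N + 1) := by
    intro m hm
    rw [← pow_succ', ← mul_pow]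
    exact pow_le_pow_left₀ (norm_nonneg _) (ha m hm) _
  have hQ0 : 0 ≤ Q := (norm_nonneg _).trans (hQ 0 (by omega) 0 ⟨le_rfl, hh.le⟩)
  have hMc : 0 ≤ Mc := (norm_nonneg _).trans (hc0 0 (by omega))
  have hbd : ∀ x ∈ Icc 0 h, ‖F (2 * N + 1) x‖ ≤
      κ ^ (2 * N + 1) * (M0 + 2 * (N + 1) * Mc * τ ^ (2 * N + 1) * Q) := by
    intro x hx
    have hx' : h - x ∈ Icc 0 h := ⟨by linarith [hx.2], by linarith [hx.1]⟩
    have key : ∀ c : ℕ → ℂ, (∀ m < N + 1, ‖c m‖ ≤ Mc) → ∀ g : ℕ → ℂ,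
        (∀ m < N + 1, ‖g m‖ ≤ κ ^ (2 * N + 1) * τ ^ (2 * N + 1) * Q) →
        ‖∑ m ∈ Finset.range (N + 1), c m * g m‖ ≤
          (N + 1) * (Mc * (κ ^ (2 * N + 1) * τ ^ (2 * N + 1) * Q)) := by
      intro c hc g hg
      refine (norm_sum_le_of_le _ (f := fun m => c m * g m)
        (n := fun _ => Mc * (κ ^ (2 * N + 1) * τ ^ (2 * N + 1) * Q)) fun m hm => ?_).trans ?_
      · rw [norm_mul]
        have hm' := Finset.mem_range.mp hm
        exact mul_le_mul (hc m hm') (hg m hm') (norm_nonneg _) hMc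
      · simp
    have k1 := key c0 hc0 (fun m => harm (-a m) (a m * h) (2 * N + 1) x / Complex.sin (a m * h))
      fun m hm => by
        rw [harm_odd, show -a m * (x : ℂ) + a m * h = a m * ((h - x : ℝ) : ℂ) by push_cast; ring,
          mul_div_assoc, mul_div_assoc, norm_mul, norm_mul, norm_pow, norm_neg, norm_neg, norm_pow,
          norm_neg, ← pow_mul, ← mul_assoc]
        exact mul_le_mul (hpow m hm) (hQ m hm _ hx') (norm_nonneg _) (by positivity)
    have k2 := key c1 hc1 (fun m => harm (a m) 0 (2 * N + 1) x / Complex.sin (a m * h))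
      fun m hm => by
        rw [harm_odd, add_zero,
          mul_div_assoc, mul_div_assoc, norm_mul, norm_mul, norm_pow, norm_neg, norm_pow,
          ← pow_mul, ← mul_assoc]
        exact mul_le_mul (hpow m hm) (hQ m hm _ hx) (norm_nonneg _) (by positivity)
    calc ‖F (2 * N + 1) x‖ ≤ _ := (norm_sub_le _ _).trans (add_le_add_left (norm_sub_le _ _) _)
      _ ≤ κ ^ (2 * N + 1) * M0 + (N + 1) * (Mc * (κ ^ (2 * N + 1) * τ ^ (2 * N + 1) * Q)) +
          (N + 1) * (Mc * (κ ^ (2 * N + 1) * τ ^ (2 * N + 1) * Q)) :=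
        add_le_add (add_le_add (hGM x hx) k1) k2
      _ = _ := by ring
  refine (norm_integral_mul_sineMode_le hh hn _ N F hdF hend hbd).trans (le_of_eq ?_)
  rw [show κ * h / (n * π) = h / (n * π) * κ by ring, mul_pow]
  ring

/-! ### Node frequencies and resonance bounds -/

lemma le_abs_sin_of_forall_le {x d : ℝ} (hx : 0 ≤ x) (hd : ∀ m : ℕ, d ≤ |x - m * π|) :
    2 / π * d ≤ |Real.sin x| := by
  have hπ := Real.pi_pos
  obtain ⟨m, hm⟩ : ∃ m : ℕ, |x - m * π| ≤ π / 2 := by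
    have h0 : 0 ≤ round (x / π) := by
      rw [round_eq]
      exact Int.floor_nonneg.mpr (by positivity)
    refine ⟨(round (x / π)).toNat, ?_⟩
    have e : (((round (x / π)).toNat : ℕ) : ℝ) = (round (x / π) : ℝ) := by
      exact_mod_cast Int.toNat_of_nonneg h0
    have h1 := abs_sub_round (x / π)
    rw [e, show x - (round (x / π) : ℝ) * π = (x / π - round (x / π)) * π by field_simp, abs_mul,
      abs_of_pos hπ]
    nlinarith
  have h1 := Real.mul_abs_le_abs_sin hm
  have h2 : |Real.sin (x - m * π)| = |Real.sin x| := by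
    rw [Real.sin_sub_nat_mul_pi, abs_mul, abs_pow]; simp
  rw [h2] at h1
  refine le_trans ?_ h1
  gcongr
  exact hd m

lemma nuT_succ (t : ℝ) (m : ℕ) : nuT t (m + 1) = nodeNu t m := by
  unfold nuT nodeNu; push_cast; ring

section Resonance

variable {ρ t : ℝ} {C' : ℝ≥0∞}

lemma one_le_mul_of_DT_le (hC : C' ≠ ⊤) (hDT : DT ρ t ≤ C' * ENNReal.ofReal (t ^ 2)) {m : ℕ}
    (hν : nodeNu t m < 1) (k : ℕ) :
    1 ≤ C'.toReal * t ^ 2 * |Real.sqrt (1 - nodeNu t m ^ 2) - k * π * ρ / t| := by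
  set d := |Real.sqrt (1 - nodeNu t m ^ 2) - k * π * ρ / t|
  have hB : C' * ENNReal.ofReal (t ^ 2) = ENNReal.ofReal (C'.toReal * t ^ 2) := by
    rw [ENNReal.ofReal_mul ENNReal.toReal_nonneg, ENNReal.ofReal_toReal hC]
  have h1 : dT ρ t ≤ ENNReal.ofReal d := by
    unfold dT
    refine iInf_le_of_le (m + 1) (iInf_le_of_le (by omega) (iInf_le_of_le ?_ (iInf_le_of_le k ?_)))
    · rwa [nuT_succ]
    · rw [nuT_succ]
  have h2 : 1 / ENNReal.ofReal d ≤ ENNReal.ofReal (C'.toReal * t ^ 2) := by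
    rw [← hB]
    refine (ENNReal.div_le_div_left h1 1).trans (le_trans ?_ hDT)
    unfold DT
    rw [add_right_comm]
    exact le_add_self
  rw [ENNReal.div_le_iff_le_mul (Or.inr ENNReal.ofReal_ne_top) (Or.inl ENNReal.ofReal_ne_top),
    ← ENNReal.ofReal_mul (by positivity), ← ENNReal.ofReal_one] at h2
  rwa [ENNReal.ofReal_le_ofReal_iff (by positivity)] at h2

lemma one_le_mul_of_DT_le' (hC : C' ≠ ⊤) (hDT : DT ρ t ≤ C' * ENNReal.ofReal (t ^ 2)) {m : ℕ}
    (hν : 1 < nodeNu t m) :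
    1 ≤ (C'.toReal * t ^ 2) ^ 2 * Real.sqrt (nodeNu t m ^ 2 - 1) := by
  set d := Real.sqrt (nodeNu t m ^ 2 - 1)
  have hd : 0 ≤ d := Real.sqrt_nonneg _
  have hB : C' * ENNReal.ofReal (t ^ 2) = ENNReal.ofReal (C'.toReal * t ^ 2) := by
    rw [ENNReal.ofReal_mul ENNReal.toReal_nonneg, ENNReal.ofReal_toReal hC]
  have h1 : dT0 t ≤ ENNReal.ofReal d := by
    unfold dT0
    refine iInf_le_of_le (m + 1) (iInf_le_of_le (by omega) (iInf_le_of_le ?_ ?_))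
    · rwa [nuT_succ]
    · rw [nuT_succ]
  have h2 : 1 / ENNReal.ofReal (d ^ (1 / 2 : ℝ)) ≤ ENNReal.ofReal (C'.toReal * t ^ 2) := by
    rw [← hB, ← ENNReal.ofReal_rpow_of_nonneg hd (by norm_num)]
    refine (ENNReal.div_le_div_left (ENNReal.rpow_le_rpow h1 (by norm_num)) 1).trans
      (le_trans ?_ hDT)
    unfold DT
    exact le_add_self
  rw [ENNReal.div_le_iff_le_mul (Or.inr ENNReal.ofReal_ne_top) (Or.inl ENNReal.ofReal_ne_top),
    ← ENNReal.ofReal_mul (by positivity), ← ENNReal.ofReal_one,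
    ENNReal.ofReal_le_ofReal_iff (by positivity), ← Real.sqrt_eq_rpow] at h2
  have h3 := mul_self_le_mul_self zero_le_one h2
  calc (1 : ℝ) = 1 * 1 := by ring
    _ ≤ _ := h3
    _ = (C'.toReal * t ^ 2) ^ 2 * (Real.sqrt d * Real.sqrt d) := by ring
    _ = _ := by rw [Real.mul_self_sqrt hd]

end Resonance

section NodeModes

variable {κ h1 h2 : ℝ}

lemma node_freq_mul (hκ : 0 < κ) (hh1 : 0 < h1) (m : ℕ) :
    κ * nodeNu (κ * h1) m * h1 = (2 * (m : ℝ) + 1) * (π / 2) := by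
  unfold nodeNu; field_simp

lemma abs_sin_node (hκ : 0 < κ) (hh1 : 0 < h1) (m : ℕ) :
    |Real.sin (κ * nodeNu (κ * h1) m * h1)| = 1 := by
  rw [node_freq_mul hκ hh1, show (2 * (m : ℝ) + 1) * (π / 2) = π / 2 - (-(m : ℝ)) * π by ring,
    Real.sin_pi_div_two_sub, Real.abs_cos_eq_one_iff]
  exact ⟨-m, by push_cast; ring⟩

lemma csin_node (κ h1 : ℝ) (m : ℕ) : Complex.sin ((κ * nodeNu (κ * h1) m : ℝ) * (h1 : ℂ)) =
    (Real.sin (κ * nodeNu (κ * h1) m * h1) : ℂ) := by push_cast; rfl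

lemma csin_node_ne_zero (hκ : 0 < κ) (hh1 : 0 < h1) (m : ℕ) :
    Complex.sin ((κ * nodeNu (κ * h1) m : ℝ) * (h1 : ℂ)) ≠ 0 := by
  rw [csin_node]
  have := abs_sin_node hκ hh1 m
  intro h
  rw [Complex.ofReal_eq_zero.mp h] at this
  simp at this

lemma norm_cos_div_sin_node_le (hκ : 0 < κ) (hh1 : 0 < h1) (m : ℕ) (x : ℝ) :
    ‖Complex.cos ((κ * nodeNu (κ * h1) m : ℝ) * (x : ℂ)) /
      Complex.sin ((κ * nodeNu (κ * h1) m : ℝ) * (h1 : ℂ))‖ ≤ 1 := by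
  rw [norm_div, csin_node, Complex.norm_real, Real.norm_eq_abs, abs_sin_node hκ hh1, div_one,
    ← Complex.ofReal_mul, ← Complex.ofReal_cos, Complex.norm_real]
  exact Real.abs_cos_le_one _

lemma nodeNu_le {τ : ℝ} {N m : ℕ} (ht : 0 < κ * h1) (hN : (N : ℝ) = τ / π * (κ * h1))
    (hm : m < N) : nodeNu (κ * h1) m ≤ τ := by
  have hπ := Real.pi_pos
  have hm2 : (2 * (m : ℝ) + 1) ≤ 2 * N := by exact_mod_cast (by omega : 2 * m + 1 ≤ 2 * N)
  rw [hN] at hm2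
  unfold nodeNu
  rw [div_le_iff₀ (by positivity)]
  calc _ ≤ 2 * (τ / π * (κ * h1)) * π := by gcongr
    _ = _ := by field_simp

lemma norm_csqrt_le {τ ν : ℝ} (hτ : 1 ≤ τ) (hν0 : 0 ≤ ν) (hν : ν ≤ τ) :
    ‖csqrt (1 - ν ^ 2)‖ ≤ τ := by
  have h : ‖csqrt (1 - ν ^ 2)‖ ^ 2 ≤ τ ^ 2 := by
    rw [← norm_pow, csqrt_sq, Complex.norm_real, Real.norm_eq_abs, abs_le]
    constructor <;> nlinarith
  exact (sq_le_sq₀ (norm_nonneg _) (by linarith)).mp h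

lemma csin_node_vert_ne_zero (hκ : 0 < κ) (hh2 : 0 < h2) (hA : A2cond κ h1 h2) (m : ℕ) :
    Complex.sin (κ * csqrt (1 - nodeNu (κ * h1) m ^ 2) * h2) ≠ 0 := by
  have := sin_ne_zero_of_A0 hκ hh2 hA (2 * m + 1)
  rwa [show nuHat κ (2 * h1) (2 * m + 1) = nodeNu (κ * h1) m by
    unfold nuHat nodeNu; push_cast; ring] at this

lemma norm_cos_div_sin_node_vert_le (hκ : 0 < κ) (hh1 : 0 < h1) (hh2 : 0 < h2)
    {C' : ℝ≥0∞} (hC : C' ≠ ⊤)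
    (hDT : DT (h1 / h2) (κ * h1) ≤ C' * ENNReal.ofReal ((κ * h1) ^ 2)) (hA : A2cond κ h1 h2)
    (m : ℕ) {x : ℝ} (hx : x ∈ Icc 0 h2) :
    ‖Complex.cos (κ * csqrt (1 - nodeNu (κ * h1) m ^ 2) * x) /
      Complex.sin (κ * csqrt (1 - nodeNu (κ * h1) m ^ 2) * h2)‖ ≤
      1 + 2 * (h1 / h2) * C'.toReal * (κ * h1) + (h1 / h2) * C'.toReal ^ 2 * (κ * h1) ^ 3 := by
  have hπ := Real.pi_pos
  have hν0 := nodeNu_pos (mul_pos hκ hh1) m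
  have hC0 : 0 ≤ C'.toReal := ENNReal.toReal_nonneg
  rcases lt_trichotomy (nodeNu (κ * h1) m) 1 with hν | hν | hν
  · have h0 : 0 ≤ 1 - nodeNu (κ * h1) m ^ 2 := by nlinarith
    have hs := csin_node_vert_ne_zero hκ hh2 hA m
    rw [csqrt_of_nonneg h0] at hs ⊢
    have key := one_le_mul_of_DT_le hC hDT hν
    set s := Real.sqrt (1 - nodeNu (κ * h1) m ^ 2)
    have hs0 : 0 ≤ s := Real.sqrt_nonneg _
    have h3 : 2 / π * (κ * h2 * (C'.toReal * (κ * h1) ^ 2)⁻¹) ≤ |Real.sin (κ * s * h2)| := by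
      refine le_abs_sin_of_forall_le (by positivity) fun k => ?_
      rw [show κ * s * h2 - k * π = κ * h2 * (s - k * π * (h1 / h2) / (κ * h1)) by field_simp,
        abs_mul, abs_of_pos (mul_pos hκ hh2)]
      gcongr
      have h4 := key k
      have h5 : 0 < C'.toReal * (κ * h1) ^ 2 := by
        by_contra h
        have h6 : C'.toReal * (κ * h1) ^ 2 = 0 := le_antisymm (not_lt.mp h) (by positivity)
        rw [h6, zero_mul] at h4; linarith
      rw [inv_le_iff_one_le_mul₀ h5]
      linarith
    have h5 : 0 < C'.toReal := by
      rcases hC0.lt_or_eq with h | h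
      · exact h
      · have h4 := key 0
        rw [← h] at h4; simp at h4; linarith
    rw [norm_div, ← Complex.ofReal_mul, ← Complex.ofReal_mul, ← Complex.ofReal_mul,
      ← Complex.ofReal_cos, ← Complex.ofReal_sin, Complex.norm_real, Complex.norm_real,
      Real.norm_eq_abs, Real.norm_eq_abs]
    have h6 : |Real.cos (κ * s * x)| / |Real.sin (κ * s * h2)| ≤
        1 / (2 / π * (κ * h2 * (C'.toReal * (κ * h1) ^ 2)⁻¹)) := by
      gcongr
      exact Real.abs_cos_le_one _
    refine h6.trans ?_
    have h7 : 1 / (2 / π * (κ * h2 * (C'.toReal * (κ * h1) ^ 2)⁻¹)) =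
        π / 2 * (h1 / h2) * C'.toReal * (κ * h1) := by field_simp
    rw [h7]
    have h8 : π / 2 * (h1 / h2) * C'.toReal * (κ * h1) ≤
        2 * (h1 / h2) * C'.toReal * (κ * h1) := by
      gcongr; linarith [Real.pi_le_four]
    have h9 : 0 ≤ (h1 / h2) * C'.toReal ^ 2 * (κ * h1) ^ 3 := by positivity
    linarith
  · exact absurd (csin_node_vert_ne_zero hκ hh2 hA m) (by
      rw [hν]; simp [csqrt_of_nonneg])
  · have h0 : 1 - nodeNu (κ * h1) m ^ 2 ≤ 0 := by nlinarith
    have key := one_le_mul_of_DT_le' hC hDT hν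
    rw [csqrt_of_nonpos h0, show -(1 - nodeNu (κ * h1) m ^ 2) = nodeNu (κ * h1) m ^ 2 - 1 by ring]
    set s := Real.sqrt (nodeNu (κ * h1) m ^ 2 - 1)
    have hs0 : 0 < s := Real.sqrt_pos.mpr (by nlinarith)
    rw [show (κ : ℂ) * (Complex.I * s) = Complex.I * ((κ * s : ℝ) : ℂ) by push_cast; ring]
    refine (norm_cos_div_sin_I_mul_le (by positivity) hh2 hx).trans ?_
    have h1' : 1 / (κ * s * h2) ≤ (C'.toReal * (κ * h1) ^ 2) ^ 2 / (κ * h2) := by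
      rw [div_le_div_iff₀ (by positivity) (by positivity)]
      nlinarith [mul_le_mul_of_nonneg_left key (mul_pos hκ hh2).le]
    have h2' : (C'.toReal * (κ * h1) ^ 2) ^ 2 / (κ * h2) =
        (h1 / h2) * C'.toReal ^ 2 * (κ * h1) ^ 3 := by field_simp
    have h9 : 0 ≤ 2 * (h1 / h2) * C'.toReal * (κ * h1) := by positivity
    linarith

end NodeModes

/-! ### Analytic Helmholtz solutions -/

/-- A family of functions on `S` behaving like the mixed partial derivatives of a Helmholtz
solution. -/
structure HelmholtzJet (κ : ℝ) (S : Set (ℝ × ℝ)) (D : ℕ → ℕ → ℝ × ℝ → ℂ) : Prop where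
  dx : ∀ i j, ∀ x ∈ S, HasDerivAt (fun s => D i j (s, x.2)) (D (i + 1) j x) x.1
  dy : ∀ i j, ∀ x ∈ S, HasDerivAt (fun s => D i j (x.1, s)) (D i (j + 1) x) x.2
  cont : ∀ i j, ContinuousOn (D i j) S
  helm : ∀ i j, ∀ x ∈ S, D (i + 2) j x + D i (j + 2) x + (κ : ℂ) ^ 2 * D i j x = 0

section Analytic

variable {f : ℝ × ℝ → ℂ} {U : Set (ℝ × ℝ)}

lemma AnalyticAt.hasDerivAt_fst {x : ℝ × ℝ} (hf : AnalyticAt ℝ f x) :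
    HasDerivAt (fun s => f (s, x.2)) (fderiv ℝ f x (1, 0)) x.1 := by
  have h1 : HasDerivAt (fun s : ℝ => (s, x.2)) ((1 : ℝ), (0 : ℝ)) x.1 :=
    (hasDerivAt_id x.1).prodMk (hasDerivAt_const _ _)
  exact HasFDerivAt.comp_hasDerivAt (x := x.1) (f := fun s : ℝ => (s, x.2))
    hf.differentiableAt.hasFDerivAt h1

lemma AnalyticAt.hasDerivAt_snd {x : ℝ × ℝ} (hf : AnalyticAt ℝ f x) :
    HasDerivAt (fun s => f (x.1, s)) (fderiv ℝ f x (0, 1)) x.2 := by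
  have h1 : HasDerivAt (fun s : ℝ => (x.1, s)) ((0 : ℝ), (1 : ℝ)) x.2 :=
    (hasDerivAt_const _ _).prodMk (hasDerivAt_id x.2)
  exact HasFDerivAt.comp_hasDerivAt (x := x.2) (f := fun s : ℝ => (x.1, s))
    hf.differentiableAt.hasFDerivAt h1

lemma AnalyticAt.pd1_eq {x : ℝ × ℝ} (hf : AnalyticAt ℝ f x) : pd1 f x = fderiv ℝ f x (1, 0) :=
  hf.hasDerivAt_fst.deriv

lemma AnalyticAt.pd2_eq {x : ℝ × ℝ} (hf : AnalyticAt ℝ f x) : pd2 f x = fderiv ℝ f x (0, 1) :=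
  hf.hasDerivAt_snd.deriv

lemma AnalyticOnNhd.fderiv_apply (hf : AnalyticOnNhd ℝ f U) (v : ℝ × ℝ) :
    AnalyticOnNhd ℝ (fun x => fderiv ℝ f x v) U := fun x hx =>
  (ContinuousLinearMap.analyticAt (ContinuousLinearMap.apply ℝ ℂ v) _).comp (hf.fderiv x hx)

lemma AnalyticOnNhd.pd1 (hU : IsOpen U) (hf : AnalyticOnNhd ℝ f U) :
    AnalyticOnNhd ℝ (pd1 f) U :=
  (hf.fderiv_apply (1, 0)).congr hU fun x hx => ((hf x hx).pd1_eq).symm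

lemma AnalyticOnNhd.pd2 (hU : IsOpen U) (hf : AnalyticOnNhd ℝ f U) :
    AnalyticOnNhd ℝ (pd2 f) U :=
  (hf.fderiv_apply (0, 1)).congr hU fun x hx => ((hf x hx).pd2_eq).symm

lemma pd1_congr_of_isOpen (hU : IsOpen U) {g : ℝ × ℝ → ℂ} (h : ∀ x ∈ U, f x = g x) :
    ∀ x ∈ U, pd1 f x = pd1 g x := by
  intro x hx
  apply Filter.EventuallyEq.deriv_eq
  have hc : ContinuousAt (fun s : ℝ => (s, x.2)) x.1 := by fun_prop
  filter_upwards [hc.eventually (hU.mem_nhds hx)] with s hs using h _ hs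

lemma pd2_congr_of_isOpen (hU : IsOpen U) {g : ℝ × ℝ → ℂ} (h : ∀ x ∈ U, f x = g x) :
    ∀ x ∈ U, pd2 f x = pd2 g x := by
  intro x hx
  apply Filter.EventuallyEq.deriv_eq
  have hc : ContinuousAt (fun s : ℝ => (x.1, s)) x.2 := by fun_prop
  filter_upwards [hc.eventually (hU.mem_nhds hx)] with s hs using h _ hs

lemma AnalyticOnNhd.pd2_pd1_comm (hU : IsOpen U) (hf : AnalyticOnNhd ℝ f U) :
    ∀ x ∈ U, _root_.pd2 (_root_.pd1 f) x = _root_.pd1 (_root_.pd2 f) x := by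
  intro x hx
  have hs : IsSymmSndFDerivAt ℝ f x :=
    (hf x hx).contDiffAt.isSymmSndFDerivAt (n := ⊤) (by simp)
  have h1 : ∀ v w : ℝ × ℝ, fderiv ℝ (fun y => fderiv ℝ f y v) x w =
      fderiv ℝ (fderiv ℝ f) x w v := by
    intro v w
    have hd : DifferentiableAt ℝ (fderiv ℝ f) x := (hf.fderiv x hx).differentiableAt
    rw [fderiv_clm_apply hd (differentiableAt_const v)]
    simp
  rw [pd2_congr_of_isOpen hU (fun y hy => (hf y hy).pd1_eq) x hx,
    pd1_congr_of_isOpen hU (fun y hy => (hf y hy).pd2_eq) x hx,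
    (hf.fderiv_apply (1, 0) x hx).pd2_eq, (hf.fderiv_apply (0, 1) x hx).pd1_eq, h1, h1]
  exact hs.eq _ _

lemma pdM_succ_left (i j : ℕ) : pdM (i + 1) j f = pd1 (pdM i j f) :=
  Function.iterate_succ_apply' _ _ _

lemma AnalyticOnNhd.pdM (hU : IsOpen U) (hf : AnalyticOnNhd ℝ f U) (i j : ℕ) :
    AnalyticOnNhd ℝ (pdM i j f) U := by
  induction i with
  | succ i ih => rw [pdM_succ_left]; exact ih.pd1 hU
  | zero =>
    induction j with
    | zero => exact hf
    | succ j ih =>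
      have : _root_.pdM 0 (j + 1) f = _root_.pd2 (_root_.pdM 0 j f) :=
        Function.iterate_succ_apply' _ _ _
      rw [this]; exact ih.pd2 hU

lemma AnalyticOnNhd.pd2_pdM (hU : IsOpen U) (hf : AnalyticOnNhd ℝ f U) (i j : ℕ) :
    ∀ x ∈ U, _root_.pd2 (_root_.pdM i j f) x = _root_.pdM i (j + 1) f x := by
  induction i with
  | zero =>
    intro x _
    exact congrFun (Function.iterate_succ_apply' _root_.pd2 j f).symm x
  | succ i ih =>
    intro x hx
    rw [pdM_succ_left, pdM_succ_left, (hf.pdM hU i j).pd2_pd1_comm hU x hx]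
    exact pd1_congr_of_isOpen hU ih x hx

lemma AnalyticHelmholtz.jet {κ : ℝ} {Ω : Set (ℝ × ℝ)} (hΩ : IsOpen Ω) {u : ℝ × ℝ → ℂ}
    (hu : AnalyticHelmholtz κ Ω u) : HelmholtzJet κ (closure Ω) fun i j => pdM i j u := by
  obtain ⟨⟨U, hU, hsub, ha⟩, hh⟩ := hu
  have hx : ∀ i j, ∀ x ∈ U, HasDerivAt (fun s => pdM i j u (s, x.2)) (pdM (i + 1) j u x) x.1 := by
    intro i j x hx
    have h := ha.pdM hU i j x hx
    rw [pdM_succ_left, h.pd1_eq]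
    exact h.hasDerivAt_fst
  have hy : ∀ i j, ∀ x ∈ U, HasDerivAt (fun s => pdM i j u (x.1, s)) (pdM i (j + 1) u x) x.2 := by
    intro i j x hx
    have h := ha.pdM hU i j x hx
    rw [← ha.pd2_pdM hU i j x hx, h.pd2_eq]
    exact h.hasDerivAt_snd
  have hΩU : Ω ⊆ U := subset_closure.trans hsub
  have hin : ∀ j i, ∀ x ∈ Ω,
      pdM (i + 2) j u x + pdM i (j + 2) u x + (κ : ℂ) ^ 2 * pdM i j u x = 0 := by
    intro j
    induction j with
    | zero =>
      intro i
      induction i with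
      | zero => exact hh
      | succ i ih =>
        intro x hxΩ
        have h1 := ((hx (i + 2) 0 x (hΩU hxΩ)).add (hx i 2 x (hΩU hxΩ))).add
          ((hx i 0 x (hΩU hxΩ)).const_mul ((κ : ℂ) ^ 2))
        refine h1.unique ((hasDerivAt_const x.1 (0 : ℂ)).congr_of_eventuallyEq ?_)
        have hc : ContinuousAt (fun s : ℝ => (s, x.2)) x.1 := by fun_prop
        filter_upwards [hc.eventually (hΩ.mem_nhds hxΩ)] with s hs using ih _ hs
    | succ j ih =>
      intro i x hxΩ
      have h1 := ((hy (i + 2) j x (hΩU hxΩ)).add (hy i (j + 2) x (hΩU hxΩ))).add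
        ((hy i j x (hΩU hxΩ)).const_mul ((κ : ℂ) ^ 2))
      refine h1.unique ((hasDerivAt_const x.2 (0 : ℂ)).congr_of_eventuallyEq ?_)
      have hc : ContinuousAt (fun s : ℝ => (x.1, s)) x.2 := by fun_prop
      filter_upwards [hc.eventually (hΩ.mem_nhds hxΩ)] with s hs using ih i _ hs
  have hcont : ∀ i j, ∀ x ∈ U, ContinuousAt (pdM i j u) x := fun i j x hx =>
    (ha.pdM hU i j x hx).continuousAt
  refine ⟨fun i j x h => hx i j x (hsub h), fun i j x h => hy i j x (hsub h),
    fun i j x h => (hcont i j x (hsub h)).continuousWithinAt, fun i j x h => ?_⟩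
  have hc : ContinuousAt (fun x =>
      pdM (i + 2) j u x + pdM i (j + 2) u x + (κ : ℂ) ^ 2 * pdM i j u x) x :=
    ((hcont _ _ x (hsub h)).add (hcont _ _ x (hsub h))).add
      (continuousAt_const.mul (hcont _ _ x (hsub h)))
  have : (nhdsWithin x Ω).NeBot := mem_closure_iff_nhdsWithin_neBot.mp h
  refine tendsto_nhds_unique (l := nhdsWithin x Ω) (hc.tendsto.mono_left nhdsWithin_le_nhds)
    (tendsto_const_nhds.congr' ?_)
  filter_upwards [self_mem_nhdsWithin] with y hyΩ using (hin j i y hyΩ).symm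

end Analytic

/-! ### Pointwise bounds by square integrals -/

lemma norm_sq_le_integral_of_hasDerivAt {a b κ : ℝ} (hab : a < b) (hκ : 0 < κ) {g g' : ℝ → ℂ}
    (hg : ∀ x ∈ Icc a b, HasDerivAt g (g' x) x) (hc : ContinuousOn g' (Icc a b)) {x₀ : ℝ}
    (hx₀ : x₀ ∈ Icc a b) :
    ‖g x₀‖ ^ 2 ≤ (1 / (b - a) + κ) * (∫ x in a..b, ‖g x‖ ^ 2) +
      1 / κ * ∫ x in a..b, ‖g' x‖ ^ 2 := by
  have hba : 0 < b - a := by linarith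
  have hgc : ContinuousOn g (Icc a b) := fun x hx => (hg x hx).continuousAt.continuousWithinAt
  have hi1 : IntervalIntegrable (fun x => ‖g x‖ ^ 2) volume a b :=
    (hgc.norm.pow 2).intervalIntegrable_of_Icc hab.le
  have hi2 : IntervalIntegrable (fun x => ‖g' x‖ ^ 2) volume a b :=
    (hc.norm.pow 2).intervalIntegrable_of_Icc hab.le
  set w : ℝ → ℝ := fun x => κ * ‖g x‖ ^ 2 + 1 / κ * ‖g' x‖ ^ 2
  have hiw : IntervalIntegrable w volume a b := (hi1.const_mul κ).add (hi2.const_mul (1 / κ))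
  have hw0 : ∀ x, 0 ≤ w x := fun x => by positivity
  have hww : ∀ x, |2 * inner ℝ (g x) (g' x)| ≤ w x := by
    intro x
    have h1 := abs_real_inner_le_norm (g x) (g' x)
    rw [abs_mul, abs_two]
    have h2 : 2 * (‖g x‖ * ‖g' x‖) ≤ w x := by
      have h3 := mul_nonneg (one_div_pos.mpr hκ).le (sq_nonneg (κ * ‖g x‖ - ‖g' x‖))
      have h4 : 1 / κ * (κ * ‖g x‖ - ‖g' x‖) ^ 2 = w x - 2 * (‖g x‖ * ‖g' x‖) := by
        simp only [w]; field_simp; ring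
      linarith
    linarith
  have key : ∀ x ∈ Icc a b, ‖g x₀‖ ^ 2 ≤ ‖g x‖ ^ 2 + ∫ s in a..b, w s := by
    intro x hx
    have hsub : uIcc x x₀ ⊆ Icc a b := uIcc_subset_Icc hx hx₀
    have h1 : ∫ s in x..x₀, 2 * inner ℝ (g s) (g' s) = ‖g x₀‖ ^ 2 - ‖g x‖ ^ 2 := by
      refine intervalIntegral.integral_eq_sub_of_hasDerivAt
        (fun s hs => (hg s (hsub hs)).norm_sq) ?_
      exact (continuousOn_const.mul ((hgc.mono hsub).inner (hc.mono hsub))).intervalIntegrable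
    have h2 : |∫ s in x..x₀, 2 * inner ℝ (g s) (g' s)| ≤ |∫ s in x..x₀, w s| := by
      refine intervalIntegral.norm_integral_le_abs_of_norm_le
        (f := fun s => 2 * inner ℝ (g s) (g' s)) (Filter.Eventually.of_forall
        fun s => hww s) (hiw.mono_set ?_)
      rwa [uIcc_of_le hab.le]
    have h3 : |∫ s in x..x₀, w s| ≤ |∫ s in a..b, w s| := by
      refine intervalIntegral.abs_integral_mono_interval ?_ ?_ hiw
      · rw [uIoc_of_le hab.le]
        rcases le_total x x₀ with h | h
        · rw [uIoc_of_le h]; exact Ioc_subset_Ioc hx.1 hx₀.2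
        · rw [uIoc_of_ge h]; exact Ioc_subset_Ioc hx₀.1 hx.2
      · exact Filter.Eventually.of_forall hw0
    rw [abs_of_nonneg (intervalIntegral.integral_nonneg hab.le fun s _ => hw0 s)] at h3
    have h4 := (le_abs_self _).trans (h2.trans h3)
    rw [h1] at h4
    linarith
  have h5 : ∫ _x in a..b, ‖g x₀‖ ^ 2 ≤ ∫ x in a..b, (‖g x‖ ^ 2 + ∫ s in a..b, w s) :=
    intervalIntegral.integral_mono_on hab.le intervalIntegrable_const
      (hi1.add intervalIntegrable_const) key
  rw [intervalIntegral.integral_add hi1 intervalIntegrable_const, intervalIntegral.integral_const,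
    intervalIntegral.integral_const, smul_eq_mul, smul_eq_mul,
    intervalIntegral.integral_add (hi1.const_mul κ) (hi2.const_mul (1 / κ)),
    intervalIntegral.integral_const_mul, intervalIntegral.integral_const_mul] at h5
  refine le_of_mul_le_mul_left (h5.trans (le_of_eq ?_)) hba
  field_simp
  ring

section SupBound

variable {a1 b1 a2 b2 : ℝ} {g : ℝ × ℝ → ℝ}

lemma integral_integral_eq_setIntegral (h1 : a1 < b1) (h2 : a2 < b2)
    (hg : ContinuousOn g (Icc a1 b1 ×ˢ Icc a2 b2)) :
    ∫ x in a1..b1, ∫ y in a2..b2, g (x, y) = ∫ z in Ioo a1 b1 ×ˢ Ioo a2 b2, g z := by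
  have hi : IntegrableOn g (Ioo a1 b1 ×ˢ Ioo a2 b2) :=
    (hg.integrableOn_compact (isCompact_Icc.prod isCompact_Icc)).mono_set
      (prod_mono Ioo_subset_Icc_self Ioo_subset_Icc_self)
  rw [Measure.volume_eq_prod] at hi ⊢
  rw [setIntegral_prod _ hi, intervalIntegral.integral_of_le h1.le, integral_Ioc_eq_integral_Ioo]
  simp_rw [intervalIntegral.integral_of_le h2.le, integral_Ioc_eq_integral_Ioo]

lemma intervalIntegrable_integral (h1 : a1 < b1) (h2 : a2 < b2)
    (hg : ContinuousOn g (Icc a1 b1 ×ˢ Icc a2 b2)) :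
    IntervalIntegrable (fun x => ∫ y in a2..b2, g (x, y)) volume a1 b1 := by
  have hi : IntegrableOn g (Ioc a1 b1 ×ˢ Ioc a2 b2) :=
    (hg.integrableOn_compact (isCompact_Icc.prod isCompact_Icc)).mono_set
      (prod_mono Ioc_subset_Icc_self Ioc_subset_Icc_self)
  rw [intervalIntegrable_iff_integrableOn_Ioc_of_le h1.le]
  simp_rw [intervalIntegral.integral_of_le h2.le]
  unfold IntegrableOn at hi ⊢
  rw [Measure.volume_eq_prod, ← Measure.prod_restrict] at hi
  exact hi.integral_prod_left

/-- A pointwise bound by square integrals of the four lowest mixed derivatives. -/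
lemma HelmholtzJet.norm_sq_le {κ : ℝ} (hκ : 0 < κ) (h1 : a1 < b1) (h2 : a2 < b2)
    {S : Set (ℝ × ℝ)} {D : ℕ → ℕ → ℝ × ℝ → ℂ} (hJ : HelmholtzJet κ S D)
    (hS : Icc a1 b1 ×ˢ Icc a2 b2 ⊆ S) (i j : ℕ) {p : ℝ × ℝ}
    (hp : p ∈ Icc a1 b1 ×ˢ Icc a2 b2) :
    ‖D i j p‖ ^ 2 ≤ (1 / (b1 - a1) + κ) * (1 / (b2 - a2) + κ) *
      ((∫ z in Ioo a1 b1 ×ˢ Ioo a2 b2, ‖D i j z‖ ^ 2) +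
        1 / κ ^ 2 * (∫ z in Ioo a1 b1 ×ˢ Ioo a2 b2, ‖D (i + 1) j z‖ ^ 2) +
        1 / κ ^ 2 * (∫ z in Ioo a1 b1 ×ˢ Ioo a2 b2, ‖D i (j + 1) z‖ ^ 2) +
        1 / κ ^ 4 * ∫ z in Ioo a1 b1 ×ˢ Ioo a2 b2, ‖D (i + 1) (j + 1) z‖ ^ 2) := by
  obtain ⟨x0, y0⟩ := p
  obtain ⟨hx0, hy0⟩ := hp
  simp only at hx0 hy0
  have hba1 : 0 < b1 - a1 := by linarith
  have hba2 : 0 < b2 - a2 := by linarith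
  have hc : ∀ i j, ContinuousOn (fun z => ‖D i j z‖ ^ 2) (Icc a1 b1 ×ˢ Icc a2 b2) :=
    fun i j => ((hJ.cont i j).mono hS).norm.pow 2
  have hrow : ∀ i j, ContinuousOn (fun x => D i j (x, y0)) (Icc a1 b1) := fun i j =>
    ((hJ.cont i j).mono hS).comp (Continuous.continuousOn (by fun_prop)) fun _ hx => ⟨hx, hy0⟩
  have hcol : ∀ i j, ∀ x ∈ Icc a1 b1, ContinuousOn (fun y => D i j (x, y)) (Icc a2 b2) :=
    fun i j x hx => ((hJ.cont i j).mono hS).comp (Continuous.continuousOn (by fun_prop))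
      fun _ hy => ⟨hx, hy⟩
  set I : ℕ → ℕ → ℝ := fun i j => ∫ z in Ioo a1 b1 ×ˢ Ioo a2 b2, ‖D i j z‖ ^ 2 with hI
  have hI0 : ∀ i j, 0 ≤ I i j := fun i j => integral_nonneg fun z => by positivity
  have hline : ∀ i, ∫ x in a1..b1, ‖D i j (x, y0)‖ ^ 2 ≤
      (1 / (b2 - a2) + κ) * I i j + 1 / κ * I i (j + 1) := by
    intro i
    have k1 := (intervalIntegrable_integral h1 h2 (hc i j)).const_mul (1 / (b2 - a2) + κ)
    have k2 := (intervalIntegrable_integral h1 h2 (hc i (j + 1))).const_mul (1 / κ)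
    have k3 := intervalIntegral.integral_mono_on (f := fun x => ‖D i j (x, y0)‖ ^ 2) h1.le
      (((hrow i j).norm.pow 2).intervalIntegrable_of_Icc h1.le) (k1.add k2)
      fun x hx => norm_sq_le_integral_of_hasDerivAt (g := fun y => D i j (x, y)) h2 hκ
        (fun y hy => hJ.dy i j (x, y) (hS ⟨hx, hy⟩)) (hcol i (j + 1) x hx) hy0
    rw [intervalIntegral.integral_add k1 k2, intervalIntegral.integral_const_mul,
      intervalIntegral.integral_const_mul, integral_integral_eq_setIntegral h1 h2 (hc i j),
      integral_integral_eq_setIntegral h1 h2 (hc i (j + 1))] at k3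
    exact k3
  have hmain := norm_sq_le_integral_of_hasDerivAt (g := fun x => D i j (x, y0)) h1 hκ
    (fun x hx => hJ.dx i j (x, y0) (hS ⟨hx, hy0⟩)) (hrow (i + 1) j) hx0
  have hA : 1 / κ ≤ 1 / κ ^ 2 * (1 / (b1 - a1) + κ) := by
    rw [mul_add, show 1 / κ ^ 2 * κ = 1 / κ by field_simp]
    have : 0 ≤ 1 / κ ^ 2 * (1 / (b1 - a1)) := by positivity
    linarith
  have hB : 1 / κ ≤ 1 / κ ^ 2 * (1 / (b2 - a2) + κ) := by
    rw [mul_add, show 1 / κ ^ 2 * κ = 1 / κ by field_simp]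
    have : 0 ≤ 1 / κ ^ 2 * (1 / (b2 - a2)) := by positivity
    linarith
  set α := 1 / (b1 - a1) + κ
  set β := 1 / (b2 - a2) + κ
  have hα : 0 ≤ α := by positivity
  have hβ : 0 ≤ β := by positivity
  have hline' : ∀ i, ∫ x in a1..b1, ‖D i j (x, y0)‖ ^ 2 ≤
      β * (I i j + 1 / κ ^ 2 * I i (j + 1)) := by
    intro i
    refine (hline i).trans ?_
    have := mul_le_mul_of_nonneg_right hB (hI0 i (j + 1))
    linarith
  have hnn : 0 ≤ ∫ x in a1..b1, ‖D (i + 1) j (x, y0)‖ ^ 2 :=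
    intervalIntegral.integral_nonneg h1.le fun _ _ => by positivity
  calc ‖D i j (x0, y0)‖ ^ 2 ≤ α * (∫ x in a1..b1, ‖D i j (x, y0)‖ ^ 2) +
        1 / κ ^ 2 * α * ∫ x in a1..b1, ‖D (i + 1) j (x, y0)‖ ^ 2 :=
        hmain.trans (add_le_add_right (mul_le_mul_of_nonneg_right hA hnn) _)
    _ ≤ α * (β * (I i j + 1 / κ ^ 2 * I i (j + 1))) +
        1 / κ ^ 2 * α * (β * (I (i + 1) j + 1 / κ ^ 2 * I (i + 1) (j + 1))) := by
        gcongr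
        · exact hline' i
        · exact hline' (i + 1)
    _ = _ := by field_simp; ring

/-- Pointwise bounds of derivatives by the weighted Sobolev norm. -/
lemma norm_pdM_le_sobNorm {κ : ℝ} (hκ : 0 < κ) (h1 : a1 < b1) (h2 : a2 < b2)
    {Ω : Set (ℝ × ℝ)} {u : ℝ × ℝ → ℂ} (hJ : HelmholtzJet κ (closure Ω) fun i j => pdM i j u)
    (hcomp : IsCompact (closure Ω)) (hS : Icc a1 b1 ×ˢ Icc a2 b2 ⊆ closure Ω)
    (hO : Ioo a1 b1 ×ˢ Ioo a2 b2 ⊆ Ω) {M i j : ℕ} (hij : i + j + 2 ≤ M) {p : ℝ × ℝ}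
    (hp : p ∈ Icc a1 b1 ×ˢ Icc a2 b2) :
    ‖pdM i j u p‖ ≤ κ ^ (i + j) *
      (Real.sqrt ((1 / (b1 - a1) + κ) * (1 / (b2 - a2) + κ)) * sobNorm κ M Ω u) := by
  have hba1 : 0 < b1 - a1 := by linarith
  have hba2 : 0 < b2 - a2 := by linarith
  have hkey := hJ.norm_sq_le hκ h1 h2 hS i j hp
  set J : ℕ → ℕ → ℝ := fun i j => ∫ z in Ω, ‖pdM i j u z‖ ^ 2 with hJdef
  have hmono : ∀ i j, ∫ z in Ioo a1 b1 ×ˢ Ioo a2 b2, ‖pdM i j u z‖ ^ 2 ≤ J i j := fun i j =>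
    setIntegral_mono_set ((((hJ.cont i j).norm.pow 2).integrableOn_compact hcomp).mono_set
      subset_closure) (Filter.Eventually.of_forall fun z => by positivity)
      hO.eventuallyLE
  have hnn : ∀ p : ℕ × ℕ, 0 ≤ (κ ^ (2 * (p.1 + p.2)))⁻¹ * J p.1 p.2 := fun p =>
    mul_nonneg (by positivity) (integral_nonneg fun z => by positivity)
  have hsum : (κ ^ (2 * (i + j)))⁻¹ * (J i j + 1 / κ ^ 2 * J (i + 1) j + 1 / κ ^ 2 * J i (j + 1) +
      1 / κ ^ 4 * J (i + 1) (j + 1)) ≤ sobNormSq κ M Ω u := by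
    have hsub : ({(i, j), (i + 1, j), (i, j + 1), (i + 1, j + 1)} : Finset (ℕ × ℕ)) ⊆ idxLe M := by
      intro q hq
      simp only [Finset.mem_insert, Finset.mem_singleton] at hq
      simp only [idxLe, Finset.mem_filter, Finset.mem_product, Finset.mem_range]
      rcases hq with rfl | rfl | rfl | rfl <;> simp only <;> omega
    have h := Finset.sum_le_sum_of_subset_of_nonneg
      (f := fun p : ℕ × ℕ => (κ ^ (2 * (p.1 + p.2)))⁻¹ * J p.1 p.2) hsub fun p _ _ => hnn p
    refine le_trans (le_of_eq ?_) h
    rw [Finset.sum_insert (by simp), Finset.sum_insert (by simp), Finset.sum_insert (by simp),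
      Finset.sum_singleton]
    simp only
    rw [show 2 * (i + 1 + j) = 2 * (i + j) + 2 by ring,
      show 2 * (i + (j + 1)) = 2 * (i + j) + 2 by ring,
      show 2 * (i + 1 + (j + 1)) = 2 * (i + j) + 4 by ring, pow_add _ _ 2, pow_add _ _ 4]
    field_simp
    ring
  have hle : ‖pdM i j u p‖ ^ 2 ≤ (1 / (b1 - a1) + κ) * (1 / (b2 - a2) + κ) *
      (κ ^ (2 * (i + j)) * sobNormSq κ M Ω u) := by
    refine hkey.trans ?_
    gcongr
    rw [← inv_mul_le_iff₀ (by positivity)]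
    refine le_trans ?_ hsum
    gcongr <;> exact hmono _ _
  refine (Real.le_sqrt (norm_nonneg _) ?_ |>.mpr hle).trans (le_of_eq ?_)
  · exact (sq_nonneg _).trans hle
  · unfold sobNorm
    rw [Real.sqrt_mul (by positivity), show 2 * (i + j) = (i + j) * 2 by ring, pow_mul,
      Real.sqrt_mul (by positivity) (sobNormSq κ M Ω u), Real.sqrt_sq (by positivity)]
    ring

end SupBound

/-- Horizontal frequency of the node modes. -/
def freqH (κ h1 : ℝ) (m : ℕ) : ℂ := ((κ * nodeNu (κ * h1) m : ℝ) : ℂ)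

/-- Vertical frequency of the node modes. -/
def freqV (κ h1 : ℝ) (m : ℕ) : ℂ := κ * csqrt (1 - nodeNu (κ * h1) m ^ 2)

lemma freqV_sq (κ h1 : ℝ) (m : ℕ) :
    freqV κ h1 m ^ 2 = (κ : ℂ) ^ 2 * (1 - (nodeNu (κ * h1) m : ℂ) ^ 2) := by
  rw [freqV, mul_pow, csqrt_sq]; push_cast; ring

lemma freqH_sq_add_freqV_sq (κ h1 : ℝ) (m : ℕ) :
    freqH κ h1 m ^ 2 + freqV κ h1 m ^ 2 = (κ : ℂ) ^ 2 := by
  rw [freqV_sq, freqH]; push_cast; ring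

/-- Coefficients of node modes matching the even pure derivatives at a point. -/
structure NodeFit (κ h1 : ℝ) (N : ℕ) (D : ℕ → ℕ → ℝ × ℝ → ℂ) (p : ℝ × ℝ) (c : ℕ → ℂ)
    (B : ℝ) : Prop where
  horiz : ∀ j < N, D (2 * j) 0 p = ∑ m ∈ Finset.range N, c m * (-freqH κ h1 m ^ 2) ^ j
  vert : ∀ j < N, D 0 (2 * j) p = ∑ m ∈ Finset.range N, c m * (-freqV κ h1 m ^ 2) ^ j
  le : ∀ m < N, ‖c m‖ ≤ B

open Polynomial in
lemma HelmholtzJet.even_deriv_eq {κ : ℝ} (hκ : 0 < κ) {S : Set (ℝ × ℝ)}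
    {D : ℕ → ℕ → ℝ × ℝ → ℂ} (hJ : HelmholtzJet κ S D) {p : ℝ × ℝ} (hp : p ∈ S) (j : ℕ) :
    ∀ i, D (2 * i) (2 * j) p = (κ : ℂ) ^ (2 * (i + j)) *
      momentFun (fun i => ((κ : ℂ) ^ (2 * i))⁻¹ * D (2 * i) 0 p) (X ^ i * (-(1 + X)) ^ j) := by
  have hκ' : (κ : ℂ) ≠ 0 := by exact_mod_cast hκ.ne'
  induction j with
  | zero =>
    intro i
    rw [pow_zero, mul_one, momentFun_X_pow, add_zero, mul_inv_cancel_left₀ (pow_ne_zero _ hκ')]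
  | succ j ih =>
    intro i
    have h := hJ.helm (2 * i) (2 * j) p hp
    rw [show 2 * i + 2 = 2 * (i + 1) by ring, show 2 * j + 2 = 2 * (j + 1) by ring, ih, ih] at h
    rw [show (X : ℂ[X]) ^ i * (-(1 + X)) ^ (j + 1) =
      -(X ^ (i + 1) * (-(1 + X)) ^ j + X ^ i * (-(1 + X)) ^ j) by ring, map_neg, map_add]
    linear_combination h

open Polynomial in
lemma HelmholtzJet.exists_nodeFit {κ h1 : ℝ} (hκ : 0 < κ) (hh1 : 0 < h1) {S : Set (ℝ × ℝ)}
    {D : ℕ → ℕ → ℝ × ℝ → ℂ} (hJ : HelmholtzJet κ S D) {p : ℝ × ℝ} (hp : p ∈ S) {N : ℕ} {M : ℝ}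
    (hM0 : 0 ≤ M) (hM : ∀ i < N, ‖D (2 * i) 0 p‖ ≤ κ ^ (2 * i) * M) :
    ∃ c, NodeFit κ h1 N D p c
      (N * (∏ k ∈ Finset.range N, (1 + 1 / nodeNu (κ * h1) k ^ 2)) * M) := by
  obtain ⟨c, hc, hcM⟩ := exists_node_coefs (mul_pos hκ hh1) N
    (b := fun i => ((κ : ℂ) ^ (2 * i))⁻¹ * D (2 * i) 0 p) hM0 fun i hi => by
      rw [norm_mul, norm_inv, norm_pow, Complex.norm_real, Real.norm_eq_abs, abs_of_pos hκ,
        inv_mul_le_iff₀ (by positivity)]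
      exact hM i hi
  refine ⟨c, fun j hj => ?_, fun j hj => ?_, hcM⟩
  · have h := hJ.even_deriv_eq hκ hp 0 j
    rw [mul_zero] at h
    rw [h, pow_zero, mul_one, hc _ (by rw [degree_X_pow]; exact_mod_cast hj), Finset.mul_sum]
    refine Finset.sum_congr rfl fun m _ => ?_
    rw [eval_pow, eval_X, freqH, add_zero, pow_mul, mul_left_comm, ← mul_pow]
    congr 2
    push_cast; ring
  · have h := hJ.even_deriv_eq hκ hp j 0
    rw [mul_zero] at h
    have hdeg : ((-(1 + X) : ℂ[X]) ^ j).degree < N := by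
      rw [degree_pow, degree_neg, add_comm, show (1 : ℂ[X]) = C 1 by simp, degree_X_add_C]
      simpa using hj
    rw [h, pow_zero, one_mul, hc _ hdeg, Finset.mul_sum]
    refine Finset.sum_congr rfl fun m _ => ?_
    rw [eval_pow, freqV_sq, zero_add, pow_mul, mul_left_comm, ← mul_pow]
    congr 2
    simp; ring

/-- Translation of a jet. -/
def shiftJet (D : ℕ → ℕ → ℝ × ℝ → ℂ) (a : ℝ × ℝ) : ℕ → ℕ → ℝ × ℝ → ℂ :=
  fun i j p => D i j (a.1 + p.1, a.2 + p.2)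

lemma HelmholtzJet.shift {κ : ℝ} {S S' : Set (ℝ × ℝ)} {D : ℕ → ℕ → ℝ × ℝ → ℂ}
    (hJ : HelmholtzJet κ S D) (a : ℝ × ℝ) (hS : ∀ p ∈ S', (a.1 + p.1, a.2 + p.2) ∈ S) :
    HelmholtzJet κ S' (shiftJet D a) where
  dx i j x hx := by
    have := hJ.dx i j _ (hS x hx)
    exact HasDerivAt.comp_const_add (f := fun s => D i j (s, a.2 + x.2)) a.1 x.1 this
  dy i j x hx := by
    have := hJ.dy i j _ (hS x hx)
    exact HasDerivAt.comp_const_add (f := fun s => D i j (a.1 + x.1, s)) a.2 x.2 this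
  cont i j := (hJ.cont i j).comp (Continuous.continuousOn (by fun_prop)) hS
  helm i j x hx := hJ.helm i j _ (hS x hx)

/-- The trace on an edge after subtraction of the node modes of its end points. -/
def edgeTrace (N : ℕ) (a : ℕ → ℂ) (h : ℝ) (c0 c1 : ℕ → ℂ) (g : ℝ → ℂ) (x : ℝ) : ℂ :=
  g x - ∑ m ∈ Finset.range N, c0 m * ratio (a m) h (h - x) -
    ∑ m ∈ Finset.range N, c1 m * ratio (a m) h x

/-- The sine coefficients of a corrected edge trace. -/
def edgeCoef (N : ℕ) (a : ℕ → ℂ) (h : ℝ) (c0 c1 : ℕ → ℂ) (g : ℝ → ℂ) (n : ℕ) : ℂ :=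
  2 / h * ∫ x in (0 : ℝ)..h, edgeTrace N a h c0 c1 g x * sineMode h n x

/-- The amplitude in the decay of the edge coefficients. -/
def edgeAmp (N : ℕ) (τ M0 Mc Q : ℝ) : ℝ := M0 + 2 * (N + 1) * Mc * τ ^ (2 * N + 1) * Q

lemma norm_edgeCoef_le {h t κ τ M0 Mc Q : ℝ} (hh : 0 < h) (hκ : 0 < κ) (ht : κ * h ≤ t)
    (hτ : 0 ≤ τ) {N : ℕ} {G : ℕ → ℝ → ℂ} {a c0 c1 : ℕ → ℂ}
    (hG : ∀ k, ∀ x ∈ Icc 0 h, HasDerivAt (G k) (G (k + 1) x) x)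
    (hG0 : ∀ j < N + 1, G (2 * j) 0 = ∑ m ∈ Finset.range (N + 1), c0 m * (-a m ^ 2) ^ j)
    (hGh : ∀ j < N + 1, G (2 * j) h = ∑ m ∈ Finset.range (N + 1), c1 m * (-a m ^ 2) ^ j)
    (hGM : ∀ x ∈ Icc 0 h, ‖G (2 * N + 1) x‖ ≤ κ ^ (2 * N + 1) * M0)
    (hs : ∀ m, Complex.sin (a m * h) ≠ 0)
    (ha : ∀ m < N + 1, ‖a m‖ ≤ κ * τ)
    (hQ : ∀ m, ∀ x ∈ Icc 0 h, ‖Complex.cos (a m * x) / Complex.sin (a m * h)‖ ≤ Q)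
    (hc0 : ∀ m < N + 1, ‖c0 m‖ ≤ Mc) (hc1 : ∀ m < N + 1, ‖c1 m‖ ≤ Mc) {n : ℕ} (hn : 1 ≤ n) :
    ‖edgeCoef (N + 1) a h c0 c1 (G 0) n‖ ≤
      2 * (t / (n * π)) ^ (2 * N + 1) * edgeAmp N τ M0 Mc Q := by
  have hπ := Real.pi_pos
  have key := norm_integral_corrected_trace_le hh hκ.le hτ hG (fun j hj => hG0 j (by omega))
    (fun j hj => hGh j (by omega)) hGM (fun m _ => hs m) ha (fun m _ => hQ m) hc0 hc1 hn
  have hA : 0 ≤ M0 + 2 * (N + 1) * Mc * τ ^ (2 * N + 1) * Q := by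
    have h1 : 0 ≤ M0 := by
      have := (norm_nonneg _).trans (hGM 0 ⟨le_rfl, hh.le⟩)
      exact nonneg_of_mul_nonneg_right this (by positivity)
    have h2 : 0 ≤ Mc := (norm_nonneg _).trans (hc0 0 (by omega))
    have h3 : 0 ≤ Q := (norm_nonneg _).trans (hQ 0 0 ⟨le_rfl, hh.le⟩)
    positivity
  rw [edgeCoef, norm_mul, show ‖(2 / h : ℂ)‖ = 2 / h by
    rw [norm_div, Complex.norm_real, Real.norm_eq_abs, abs_of_pos hh]; simp]
  calc 2 / h * _ ≤ 2 / h * (h * (κ * h / (n * π)) ^ (2 * N + 1) *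
        (M0 + 2 * (N + 1) * Mc * τ ^ (2 * N + 1) * Q)) := by gcongr; exact key
    _ = 2 * (κ * h / (n * π)) ^ (2 * N + 1) *
        (M0 + 2 * (N + 1) * Mc * τ ^ (2 * N + 1) * Q) := by field_simp
    _ ≤ 2 * (t / (n * π)) ^ (2 * N + 1) *
        (M0 + 2 * (N + 1) * Mc * τ ^ (2 * N + 1) * Q) := by gcongr

/-- The normalized node mode, equal to one at the corner `(h1, h2)`. -/
def nodeMode (κ h1 h2 : ℝ) (m : ℕ) (p : ℝ × ℝ) : ℂ :=
  ratio (freqH κ h1 m) h1 p.1 * ratio (freqV κ h1 m) h2 p.2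

/-- The sum of the node modes of the four corners of a cell. -/
def cornerSum (κ h1 h2 : ℝ) (N : ℕ) (c00 c10 c01 c11 : ℕ → ℂ) (p : ℝ × ℝ) : ℂ :=
  ∑ m ∈ Finset.range N, (c00 m * nodeMode κ h1 h2 m (h1 - p.1, h2 - p.2) +
    c10 m * nodeMode κ h1 h2 m (p.1, h2 - p.2) + c01 m * nodeMode κ h1 h2 m (h1 - p.1, p.2) +
    c11 m * nodeMode κ h1 h2 m p)

lemma rectHelm_cornerSum (κ h1 h2 : ℝ) (N : ℕ) (c00 c10 c01 c11 : ℕ → ℂ) :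
    RectHelm κ h1 h2 (cornerSum κ h1 h2 N c00 c10 c01 c11) := by
  refine RectHelm.sum _ fun m _ => ?_
  have hf := freqH_sq_add_freqV_sq κ h1 m
  have hx := sinLike_ratio (freqH κ h1 m) h1
  have hy := sinLike_ratio (freqV κ h1 m) h2
  exact ((((RectHelm.of_sinLike (hx.reflect h1) (hy.reflect h2) hf).const_mul _).add
    ((RectHelm.of_sinLike hx (hy.reflect h2) hf).const_mul _)).add
    ((RectHelm.of_sinLike (hx.reflect h1) hy hf).const_mul _)).add
    ((RectHelm.of_sinLike hx hy hf).const_mul _)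

lemma HelmholtzJet.rectHelm {κ h1 h2 : ℝ} {D : ℕ → ℕ → ℝ × ℝ → ℂ}
    (hJ : HelmholtzJet κ (rectC h1 h2) D) : RectHelm κ h1 h2 (D 0 0) :=
  ⟨D 1 0, D 2 0, D 0 1, D 0 2, fun x hx y hy => ⟨hJ.dx 0 0 (x, y) ⟨hx, hy⟩,
    hJ.dx 1 0 (x, y) ⟨hx, hy⟩, hJ.dy 0 0 (x, y) ⟨hx, hy⟩, hJ.dy 0 1 (x, y) ⟨hx, hy⟩,
    hJ.helm 0 0 (x, y) ⟨hx, hy⟩⟩, hJ.cont 0 0, hJ.cont 2 0, hJ.cont 0 2⟩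

section CornerTraces

variable {κ h1 h2 : ℝ} {N : ℕ} {c00 c10 c01 c11 : ℕ → ℂ} {w : ℝ × ℝ → ℂ}

lemma sub_cornerSum_bottom (hV : ∀ m, Complex.sin (freqV κ h1 m * h2) ≠ 0) (x : ℝ) :
    w (x, 0) - cornerSum κ h1 h2 N c00 c10 c01 c11 (x, 0) =
      edgeTrace N (freqH κ h1) h1 c00 c10 (fun x => w (x, 0)) x := by
  simp [cornerSum, edgeTrace, nodeMode, ratio_zero, ratio_self (hV _), Finset.sum_add_distrib,
    sub_sub]

lemma sub_cornerSum_top (hV : ∀ m, Complex.sin (freqV κ h1 m * h2) ≠ 0) (x : ℝ) :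
    w (x, h2) - cornerSum κ h1 h2 N c00 c10 c01 c11 (x, h2) =
      edgeTrace N (freqH κ h1) h1 c01 c11 (fun x => w (x, h2)) x := by
  simp [cornerSum, edgeTrace, nodeMode, ratio_zero, ratio_self (hV _), Finset.sum_add_distrib,
    sub_sub]

lemma sub_cornerSum_left (hH : ∀ m, Complex.sin (freqH κ h1 m * h1) ≠ 0) (y : ℝ) :
    w (0, y) - cornerSum κ h1 h2 N c00 c10 c01 c11 (0, y) =
      edgeTrace N (freqV κ h1) h2 c00 c01 (fun y => w (0, y)) y := by
  simp [cornerSum, edgeTrace, nodeMode, ratio_zero, ratio_self (hH _), Finset.sum_add_distrib,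
    sub_sub]

lemma sub_cornerSum_right (hH : ∀ m, Complex.sin (freqH κ h1 m * h1) ≠ 0) (y : ℝ) :
    w (h1, y) - cornerSum κ h1 h2 N c00 c10 c01 c11 (h1, y) =
      edgeTrace N (freqV κ h1) h2 c10 c11 (fun y => w (h1, y)) y := by
  simp [cornerSum, edgeTrace, nodeMode, ratio_zero, ratio_self (hH _), Finset.sum_add_distrib,
    sub_sub]

end CornerTraces

/-- The error on one cell after subtraction of node modes and truncated edge modes. -/
lemma HelmholtzJet.cell_bound {κ h1 h2 τ M0 Mc Q S : ℝ} (hκ : 0 < κ) (hh2 : 0 < h2)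
    (h21 : h2 ≤ h1) (hA : A0cond κ h1 h2) (hA2 : A2cond κ h1 h2) (hτ : 1 ≤ τ) {N : ℕ}
    (hν : ∀ m < N + 1, nodeNu (κ * h1) m ≤ τ) (hQ1 : 1 ≤ Q)
    (hQ : ∀ m, ∀ x ∈ Icc 0 h2,
      ‖Complex.cos (freqV κ h1 m * x) / Complex.sin (freqV κ h1 m * h2)‖ ≤ Q)
    {D : ℕ → ℕ → ℝ × ℝ → ℂ} (hJ : HelmholtzJet κ (rectC h1 h2) D)
    (hM : ∀ i j, i + j ≤ 2 * N + 1 → ∀ p ∈ rectC h1 h2, ‖D i j p‖ ≤ κ ^ (i + j) * M0)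
    {c00 c10 c01 c11 : ℕ → ℂ} (f00 : NodeFit κ h1 (N + 1) D (0, 0) c00 Mc)
    (f10 : NodeFit κ h1 (N + 1) D (h1, 0) c10 Mc) (f01 : NodeFit κ h1 (N + 1) D (0, h2) c01 Mc)
    (f11 : NodeFit κ h1 (N + 1) D (h1, h2) c11 Mc) {n0 : ℕ} (hn0 : 1 ≤ n0)
    (hn : κ * h1 ≤ n0 * π)
    (hS : HasSum (fun k => 2 * (κ * h1 / ((k + n0 : ℕ) * π)) ^ (2 * N + 1) *
      edgeAmp N τ M0 Mc Q * (((k + n0 : ℕ) : ℝ) * π + 1)) S)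
    {R : ℝ × ℝ → ℂ}
    (hR : ∀ p, R p = D 0 0 p - cornerSum κ h1 h2 (N + 1) c00 c10 c01 c11 p -
      ∑ n ∈ Finset.range n0, cellTerm κ h1 h2
        (edgeCoef (N + 1) (freqH κ h1) h1 c00 c10 fun x => D 0 0 (x, 0))
        (edgeCoef (N + 1) (freqH κ h1) h1 c01 c11 fun x => D 0 0 (x, h2))
        (edgeCoef (N + 1) (freqV κ h1) h2 c00 c01 fun y => D 0 0 (0, y))
        (edgeCoef (N + 1) (freqV κ h1) h2 c10 c11 fun y => D 0 0 (h1, y)) n p)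
    {x y : ℝ} (hx : x ∈ Ioo 0 h1) (hy : y ∈ Ioo 0 h2) :
    ‖R (x, y)‖ ≤ 4 * S ∧ ‖deriv (fun s => R (s, y)) x‖ ≤ 4 * S / h2 ∧
      ‖deriv (fun s => R (x, s)) y‖ ≤ 4 * S / h2 := by
  have hπ := Real.pi_pos
  have hh1 := hh2.trans_le h21
  have hH : ∀ m, Complex.sin (freqH κ h1 m * h1) ≠ 0 := csin_node_ne_zero hκ hh1
  have hV : ∀ m, Complex.sin (freqV κ h1 m * h2) ≠ 0 := csin_node_vert_ne_zero hκ hh2 hA2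
  have hτ0 : 0 ≤ τ := by linarith
  have hHτ : ∀ m < N + 1, ‖freqH κ h1 m‖ ≤ κ * τ := fun m hm => by
    have h0 := (nodeNu_pos (mul_pos hκ hh1) m).le
    rw [freqH, Complex.norm_real, Real.norm_eq_abs, abs_of_nonneg (by positivity)]
    exact mul_le_mul_of_nonneg_left (hν m hm) hκ.le
  have hVτ : ∀ m < N + 1, ‖freqV κ h1 m‖ ≤ κ * τ := fun m hm => by
    rw [freqV, norm_mul, Complex.norm_real, Real.norm_eq_abs, abs_of_pos hκ]
    exact mul_le_mul_of_nonneg_left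
      (norm_csqrt_le hτ (nodeNu_pos (mul_pos hκ hh1) m).le (hν m hm)) hκ.le
  have hHQ : ∀ m, ∀ x ∈ Icc 0 h1,
      ‖Complex.cos (freqH κ h1 m * x) / Complex.sin (freqH κ h1 m * h1)‖ ≤ Q := fun m x _ =>
    (norm_cos_div_sin_node_le hκ hh1 m x).trans hQ1
  have i0 : (0 : ℝ) ∈ Icc 0 h1 := ⟨le_rfl, hh1.le⟩
  have i1 : h1 ∈ Icc 0 h1 := ⟨hh1.le, le_rfl⟩
  have j0 : (0 : ℝ) ∈ Icc 0 h2 := ⟨le_rfl, hh2.le⟩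
  have j1 : h2 ∈ Icc 0 h2 := ⟨hh2.le, le_rfl⟩
  have hle2 : κ * h2 ≤ κ * h1 := mul_le_mul_of_nonneg_left h21 hκ.le
  have hnu1 : ∀ n, n0 ≤ n → 1 ≤ nuHat κ h1 n := fun n hn' => by
    have : (n0 : ℝ) ≤ n := by exact_mod_cast hn'
    rw [nuHat, le_div_iff₀ (by positivity), one_mul]
    exact hn.trans (by gcongr)
  have hnu2 : ∀ n, n0 ≤ n → 1 ≤ nuHat κ h2 n := fun n hn' => by
    have : (n0 : ℝ) ≤ n := by exact_mod_cast hn'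
    rw [nuHat, le_div_iff₀ (by positivity), one_mul]
    exact hle2.trans (hn.trans (by gcongr))
  have hbH : ∀ y ∈ Icc 0 h2, ∀ c c', NodeFit κ h1 (N + 1) D (0, y) c Mc →
      NodeFit κ h1 (N + 1) D (h1, y) c' Mc → ∀ n, n0 ≤ n →
      ‖edgeCoef (N + 1) (freqH κ h1) h1 c c' (fun x => D 0 0 (x, y)) n‖ ≤
        2 * (κ * h1 / (n * π)) ^ (2 * N + 1) * edgeAmp N τ M0 Mc Q := fun y hy c c' f f' n hn' =>
    norm_edgeCoef_le (G := fun k x => D k 0 (x, y)) hh1 hκ le_rfl hτ0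
      (fun k x hx => hJ.dx k 0 (x, y) ⟨hx, hy⟩) f.horiz f'.horiz
      (fun x hx => by simpa using hM (2 * N + 1) 0 (by omega) (x, y) ⟨hx, hy⟩) hH hHτ hHQ f.le f'.le
      (hn0.trans hn')
  have hbV : ∀ x ∈ Icc 0 h1, ∀ c c', NodeFit κ h1 (N + 1) D (x, 0) c Mc →
      NodeFit κ h1 (N + 1) D (x, h2) c' Mc → ∀ n, n0 ≤ n →
      ‖edgeCoef (N + 1) (freqV κ h1) h2 c c' (fun y => D 0 0 (x, y)) n‖ ≤
        2 * (κ * h1 / (n * π)) ^ (2 * N + 1) * edgeAmp N τ M0 Mc Q := fun x hx c c' f f' n hn' =>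
    norm_edgeCoef_le (G := fun k y => D 0 k (x, y)) hh2 hκ hle2 hτ0
      (fun k y hy => hJ.dy 0 k (x, y) ⟨hx, hy⟩) f.vert f'.vert
      (fun y hy => by simpa using hM 0 (2 * N + 1) (by omega) (x, y) ⟨hx, hy⟩) hV hVτ hQ f.le f'.le
      (hn0.trans hn')
  refine RectHelm.truncation_bound (b := fun n => 2 * (κ * h1 / (n * π)) ^ (2 * N + 1) *
      edgeAmp N τ M0 Mc Q) (w := fun p => D 0 0 p - cornerSum κ h1 h2 (N + 1) c00 c10 c01 c11 p)
    hκ hh2 h21 le_rfl hA (hJ.rectHelm.sub (rectHelm_cornerSum _ _ _ _ _ _ _ _))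
    (fun n => ?_) (fun n => ?_) (fun n => ?_) (fun n => ?_) hnu1 hnu2
    (hbH 0 j0 c00 c10 f00 f10) (hbH h2 j1 c01 c11 f01 f11) (hbV 0 i0 c00 c01 f00 f01)
    (hbV h1 i1 c10 c11 f10 f11) hS hR hx hy
  · simp_rw [sub_cornerSum_bottom hV]; rfl
  · simp_rw [sub_cornerSum_top hV]; rfl
  · simp_rw [sub_cornerSum_left hH]; rfl
  · simp_rw [sub_cornerSum_right hH]; rfl

section Grid

lemma mem_Icc_grid_iff {h x : ℝ} {i j : ℤ} (hh : 0 < h) (hx : x ∈ Ioo (i * h) ((i + 1) * h)) :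
    x ∈ Icc (j * h) ((j + 1) * h) ↔ j = i := by
  refine ⟨fun hj => ?_, fun hj => hj ▸ Ioo_subset_Icc_self hx⟩
  have h1 : (j : ℝ) < i + 1 := lt_of_mul_lt_mul_right (hj.1.trans_lt hx.2) hh.le
  have h2 : (i : ℝ) < j + 1 := lt_of_mul_lt_mul_right (hx.1.trans_le hj.2) hh.le
  have h3 : j < i + 1 := by exact_mod_cast h1
  have h4 : i < j + 1 := by exact_mod_cast h2
  omega

lemma mem_Icc_grid_sub_iff {h x : ℝ} {i j : ℤ} (hh : 0 < h)
    (hx : x ∈ Ioo (i * h) ((i + 1) * h)) : x ∈ Icc ((j - 1) * h) (j * h) ↔ j = i + 1 := by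
  have := mem_Icc_grid_iff (j := j - 1) hh hx
  push_cast at this
  rw [sub_add_cancel] at this
  rw [this]
  omega

lemma mem_Icc_grid_double_iff {h x : ℝ} {i j : ℤ} (hh : 0 < h)
    (hx : x ∈ Ioo (i * h) ((i + 1) * h)) :
    x ∈ Icc ((j - 1) * h) ((j + 1) * h) ↔ j = i ∨ j = i + 1 := by
  rw [← mem_Icc_grid_iff hh hx, ← mem_Icc_grid_sub_iff hh hx, ← mem_union, union_comm,
    Icc_union_Icc_eq_Icc] <;> nlinarith

variable {h1 h2 : ℝ} {c : ℤ × ℤ} {x : ℝ × ℝ}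

lemma mem_cellC_iff (hh1 : 0 < h1) (hh2 : 0 < h2) (hx : x ∈ cellO h1 h2 c) {e : ℤ × ℤ} :
    x ∈ cellC h1 h2 e ↔ e = c := by
  rw [cellC, mem_prod, mem_Icc_grid_iff hh1 hx.1, mem_Icc_grid_iff hh2 hx.2, Prod.ext_iff]

lemma isOpen_cellO (h1 h2 : ℝ) (c : ℤ × ℤ) : IsOpen (cellO h1 h2 c) := isOpen_Ioo.prod isOpen_Ioo

lemma cellO_subset_cellC (h1 h2 : ℝ) (c : ℤ × ℤ) : cellO h1 h2 c ⊆ cellC h1 h2 c :=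
  prod_mono Ioo_subset_Icc_self Ioo_subset_Icc_self

lemma isCompact_cellC (h1 h2 : ℝ) (c : ℤ × ℤ) : IsCompact (cellC h1 h2 c) :=
  isCompact_Icc.prod isCompact_Icc

lemma add_mem_cellC {p : ℝ × ℝ} (hp : p ∈ rectC h1 h2) :
    ((nodePt h1 h2 c).1 + p.1, (nodePt h1 h2 c).2 + p.2) ∈ cellC h1 h2 c := by
  obtain ⟨⟨a, b⟩, ⟨a', b'⟩⟩ := hp
  refine ⟨⟨?_, ?_⟩, ⟨?_, ?_⟩⟩ <;> simp only [nodePt] <;> linarith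

variable {cells : Finset (ℤ × ℤ)} {Ω : Set (ℝ × ℝ)}

lemma IsTessellation.isOpen (hT : IsTessellation h1 h2 cells Ω) : IsOpen Ω := by
  rw [hT.2.1]; exact isOpen_interior

lemma IsTessellation.isCompact_closure (hT : IsTessellation h1 h2 cells Ω) :
    IsCompact (closure Ω) := by
  rw [hT.2.2]; exact cells.isCompact_biUnion fun c _ => isCompact_cellC h1 h2 c

lemma IsTessellation.cellC_subset (hT : IsTessellation h1 h2 cells Ω) (hc : c ∈ cells) :
    cellC h1 h2 c ⊆ closure Ω := by
  rw [hT.2.2]; exact subset_biUnion_of_mem (u := fun c => cellC h1 h2 c) hc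

lemma IsTessellation.cellO_subset (hT : IsTessellation h1 h2 cells Ω) (hc : c ∈ cells) :
    cellO h1 h2 c ⊆ Ω := by
  rw [hT.2.1]
  exact interior_maximal ((cellO_subset_cellC h1 h2 c).trans
    (subset_biUnion_of_mem (u := fun c => cellC h1 h2 c) hc)) (isOpen_cellO h1 h2 c)

lemma exists_nodePt_mem_cellC (hh1 : 0 < h1) (hh2 : 0 < h2) {p : ℤ × ℤ} (hp : p ∈ meshNodes cells) :
    ∃ c ∈ cells, nodePt h1 h2 p ∈ cellC h1 h2 c := by
  simp only [meshNodes, Finset.mem_union, Finset.mem_image] at hp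
  rcases hp with ((hp | ⟨c, hp, rfl⟩) | ⟨c, hp, rfl⟩) | ⟨c, hp, rfl⟩
  all_goals
    refine ⟨_, hp, ⟨?_, ?_⟩, ⟨?_, ?_⟩⟩ <;> simp only [nodePt] <;> push_cast <;> nlinarith

end Grid

section LocalForms

variable {κ h1 h2 : ℝ} {c : ℤ × ℤ} {x : ℝ × ℝ} {cells : Finset (ℤ × ℤ)}

/-- Coordinates relative to the lower left corner of a cell. -/
def localPt (h1 h2 : ℝ) (c : ℤ × ℤ) (x : ℝ × ℝ) : ℝ × ℝ := (x.1 - c.1 * h1, x.2 - c.2 * h2)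

lemma phiEdgeH_eq (hh1 : 0 < h1) (hh2 : 0 < h2) (hc : c ∈ cells) (hx : x ∈ cellO h1 h2 c)
    (e : ℤ × ℤ) (n : ℕ) :
    phiEdgeH κ h1 h2 cells e n x =
      (if e = c then phiHat κ h1 h2 n ((localPt h1 h2 c x).1, h2 - (localPt h1 h2 c x).2) else 0) +
        if e = (c.1, c.2 + 1) then phiHat κ h1 h2 n (localPt h1 h2 c x) else 0 := by
  obtain ⟨e1, e2⟩ := e
  obtain ⟨c1, c2⟩ := c
  simp only [phiEdgeH, mem_cellC_iff hh1 hh2 hx, localPt]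
  by_cases h : (e1, e2) = (c1, c2)
  · have h' : (e1, e2) ≠ (c1, c2 + 1) := by
      rw [h]; simp
    rw [if_pos ⟨h ▸ hc, h⟩, if_pos h, if_neg h', add_zero]
    rw [Prod.mk.injEq] at h
    rw [h.1, h.2]
    congr 2; ring
  · rw [if_neg (fun h' => h h'.2), if_neg h, zero_add]
    by_cases h' : (e1, e2) = (c1, c2 + 1)
    · rw [Prod.mk.injEq] at h'
      obtain ⟨rfl, rfl⟩ := h'
      rw [if_pos ⟨by simpa using hc, by simp⟩, if_pos rfl]
      congr 2
      push_cast; ring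
    · rw [if_neg h', if_neg]
      rintro ⟨-, h''⟩
      rw [Prod.mk.injEq] at h''
      exact h' (by rw [Prod.mk.injEq]; omega)

lemma phiEdgeV_eq (hh1 : 0 < h1) (hh2 : 0 < h2) (hc : c ∈ cells) (hx : x ∈ cellO h1 h2 c)
    (e : ℤ × ℤ) (n : ℕ) :
    phiEdgeV κ h1 h2 cells e n x =
      (if e = c then phiHat κ h2 h1 n ((localPt h1 h2 c x).2, h1 - (localPt h1 h2 c x).1) else 0) +
        if e = (c.1 + 1, c.2) then
          phiHat κ h2 h1 n ((localPt h1 h2 c x).2, (localPt h1 h2 c x).1) else 0 := by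
  obtain ⟨e1, e2⟩ := e
  obtain ⟨c1, c2⟩ := c
  simp only [phiEdgeV, mem_cellC_iff hh1 hh2 hx, localPt]
  by_cases h : (e1, e2) = (c1, c2)
  · have h' : (e1, e2) ≠ (c1 + 1, c2) := by
      rw [h]; simp
    rw [if_pos ⟨h ▸ hc, h⟩, if_pos h, if_neg h', add_zero]
    rw [Prod.mk.injEq] at h
    rw [h.1, h.2]
    congr 2; ring
  · rw [if_neg (fun h' => h h'.2), if_neg h, zero_add]
    by_cases h' : (e1, e2) = (c1 + 1, c2)
    · rw [Prod.mk.injEq] at h'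
      obtain ⟨rfl, rfl⟩ := h'
      rw [if_pos ⟨by simpa using hc, by simp⟩, if_pos rfl]
      congr 2
      push_cast; ring
    · rw [if_neg h', if_neg]
      rintro ⟨-, h''⟩
      rw [Prod.mk.injEq] at h''
      exact h' (by rw [Prod.mk.injEq]; omega)

lemma phiHat_odd_eq (hκ : 0 < κ) (hh1 : 0 < h1) (h2 : ℝ) (m : ℕ) (x y : ℝ) :
    phiHat κ (2 * h1) h2 (2 * (m + 1) - 1) (x, y) =
      Complex.sin (freqH κ h1 m * h1) * nodeMode κ h1 h2 m (x, y) := by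
  have hs : Complex.sin (freqH κ h1 m * h1) ≠ 0 := csin_node_ne_zero hκ hh1 m
  have e1 : 2 * (m + 1) - 1 = 2 * m + 1 := by omega
  have e2 : nuHat κ (2 * h1) (2 * m + 1) = nodeNu (κ * h1) m := by
    unfold nuHat nodeNu; push_cast; ring
  have e3 : sineMode (2 * h1) (2 * m + 1) x = Complex.sin (freqH κ h1 m * x) := by
    rw [sineMode, freqH, ← Complex.ofReal_mul, ← Complex.ofReal_sin]
    congr 3
    unfold nodeNu; push_cast; field_simp
  have e4 : Complex.sin (freqH κ h1 m * x) =
      Complex.sin (freqH κ h1 m * h1) * ratio (freqH κ h1 m) h1 x := by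
    rw [ratio]; field_simp
  rw [e1, phiHat_eq hκ, e2, e3, e4, mul_assoc]
  rfl

lemma phiHat_odd_reflect (hκ : 0 < κ) (hh1 : 0 < h1) (h2 : ℝ) (m : ℕ) (x y : ℝ) :
    phiHat κ (2 * h1) h2 (2 * (m + 1) - 1) (2 * h1 - x, y) =
      phiHat κ (2 * h1) h2 (2 * (m + 1) - 1) (x, y) := by
  rw [phiHat_eq hκ, phiHat_eq hκ]
  congr 1
  rw [sineMode, sineMode]
  congr 1
  have e1 : 2 * (m + 1) - 1 = 2 * m + 1 := by omega
  rw [e1, show ((2 * m + 1 : ℕ) : ℝ) * π / (2 * h1) * (2 * h1 - x) =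
    (π - ((2 * m + 1 : ℕ) : ℝ) * π / (2 * h1) * x) + m * (2 * π) by
      push_cast; field_simp; ring, Real.sin_add_nat_mul_two_pi, Real.sin_pi_sub]

lemma psiNode_eq (hκ : 0 < κ) (hh1 : 0 < h1) (hh2 : 0 < h2) (hx : x ∈ cellO h1 h2 c)
    (p : ℤ × ℤ) (m : ℕ) :
    psiNode κ h1 h2 p (m + 1) x = Complex.sin (freqH κ h1 m * h1) *
      ((if p = c then
          nodeMode κ h1 h2 m (h1 - (localPt h1 h2 c x).1, h2 - (localPt h1 h2 c x).2) else 0) +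
        (if p = (c.1 + 1, c.2) then
          nodeMode κ h1 h2 m ((localPt h1 h2 c x).1, h2 - (localPt h1 h2 c x).2) else 0) +
        (if p = (c.1, c.2 + 1) then
          nodeMode κ h1 h2 m (h1 - (localPt h1 h2 c x).1, (localPt h1 h2 c x).2) else 0) +
        if p = (c.1 + 1, c.2 + 1) then nodeMode κ h1 h2 m (localPt h1 h2 c x) else 0) := by
  obtain ⟨p1, p2⟩ := p
  obtain ⟨c1, c2⟩ := c
  simp only [psiNode, localPt, mem_prod, mem_Icc_grid_double_iff hh1 hx.1,
    mem_Icc_grid_iff hh2 hx.2, mem_Icc_grid_sub_iff hh2 hx.2, Prod.mk.injEq]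
  have key := phiHat_odd_eq hκ hh1 h2 m
  have refl := phiHat_odd_reflect hκ hh1 h2 m
  by_cases hp2 : p2 = c2
  · by_cases hp1 : p1 = c1
    · subst hp1 hp2
      simp only [true_or, and_true, true_and, if_true]
      rw [show h1 - (p1 * h1 - x.1) = 2 * h1 - (h1 - (x.1 - p1 * h1)) by ring, refl, key]
      simp
      left; congr 2; ring
    · by_cases hp1' : p1 = c1 + 1
      · subst hp1' hp2
        simp only [or_true, and_true, true_and, if_true]
        rw [show h1 - (((c1 + 1 : ℤ) : ℝ) * h1 - x.1) = x.1 - c1 * h1 by push_cast; ring, key]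
        simp
        left; congr 2; ring
      · simp [hp1, hp1']
  · by_cases hp2' : p2 = c2 + 1
    · by_cases hp1 : p1 = c1
      · subst hp1 hp2'
        simp only [true_or, and_true, if_true, show ¬c2 + 1 = c2 by omega, and_false, if_false]
        rw [show h1 - (p1 * h1 - x.1) = 2 * h1 - (h1 - (x.1 - p1 * h1)) by ring, refl, key]
        simp
        left; congr 2; ring
      · by_cases hp1' : p1 = c1 + 1
        · subst hp1' hp2'
          simp only [or_true, and_true, if_true, show ¬c2 + 1 = c2 by omega, and_false, if_false]
          rw [show h1 - (((c1 + 1 : ℤ) : ℝ) * h1 - x.1) = x.1 - c1 * h1 by push_cast; ring, key]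
          simp
          left; congr 2; ring
        · simp [hp1, hp1']
    · simp [hp2, hp2']

end LocalForms

section MeshApprox

variable {κ h1 h2 : ℝ} {c : ℤ × ℤ} {x : ℝ × ℝ} {cells : Finset (ℤ × ℤ)}

/-- The element of the combined space with given normalized coefficients. -/
def meshApprox (κ h1 h2 : ℝ) (cells : Finset (ℤ × ℤ)) (Ne N : ℕ) (a αH αV : ℤ × ℤ → ℕ → ℂ) :
    ℝ × ℝ → ℂ :=
  ∑ p ∈ meshNodes cells, ∑ m ∈ Finset.range N,
      (a p m / Complex.sin (freqH κ h1 m * h1)) • psiNode κ h1 h2 p (m + 1) +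
    ∑ e ∈ hEdges cells, ∑ n ∈ Finset.range Ne, αH e (n + 1) • phiEdgeH κ h1 h2 cells e (n + 1) +
    ∑ e ∈ vEdges cells, ∑ n ∈ Finset.range Ne, αV e (n + 1) • phiEdgeV κ h1 h2 cells e (n + 1)

lemma meshApprox_mem (κ h1 h2 : ℝ) (cells : Finset (ℤ × ℤ)) (Ne N : ℕ)
    (a αH αV : ℤ × ℤ → ℕ → ℂ) :
    meshApprox κ h1 h2 cells Ne N a αH αV ∈ combinedSpace κ h1 h2 cells Ne N := by
  refine add_mem (add_mem ?_ ?_) ?_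
  · refine sum_mem fun p hp => sum_mem fun m hm => Submodule.smul_mem _ _ (Submodule.subset_span ?_)
    exact Or.inr ⟨p, hp, m + 1, by omega, by simpa using hm, rfl⟩
  · refine sum_mem fun e he => sum_mem fun n hn => Submodule.smul_mem _ _ (Submodule.subset_span ?_)
    exact Or.inl (Or.inl ⟨e, he, n + 1, by omega, by simpa using hn, rfl⟩)
  · refine sum_mem fun e he => sum_mem fun n hn => Submodule.smul_mem _ _ (Submodule.subset_span ?_)
    exact Or.inl (Or.inr ⟨e, he, n + 1, by omega, by simpa using hn, rfl⟩)

lemma meshApprox_eq (hκ : 0 < κ) (hh1 : 0 < h1) (hh2 : 0 < h2) (hc : c ∈ cells)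
    (hx : x ∈ cellO h1 h2 c) (Ne N : ℕ) (a αH αV : ℤ × ℤ → ℕ → ℂ) :
    meshApprox κ h1 h2 cells Ne N a αH αV x =
      cornerSum κ h1 h2 N (a c) (a (c.1 + 1, c.2)) (a (c.1, c.2 + 1)) (a (c.1 + 1, c.2 + 1))
          (localPt h1 h2 c x) +
        ∑ n ∈ Finset.range (Ne + 1), cellTerm κ h1 h2 (αH c) (αH (c.1, c.2 + 1)) (αV c)
          (αV (c.1 + 1, c.2)) n (localPt h1 h2 c x) := by
  have hs : ∀ m, Complex.sin (freqH κ h1 m * h1) ≠ 0 := csin_node_ne_zero hκ hh1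
  have hn1 : c ∈ meshNodes cells := by simp [meshNodes, hc]
  have hn2 : (c.1 + 1, c.2) ∈ meshNodes cells := by
    simp only [meshNodes, Finset.mem_union, Finset.mem_image]
    exact Or.inl (Or.inl (Or.inr ⟨c, hc, rfl⟩))
  have hn3 : (c.1, c.2 + 1) ∈ meshNodes cells := by
    simp only [meshNodes, Finset.mem_union, Finset.mem_image]
    exact Or.inl (Or.inr ⟨c, hc, rfl⟩)
  have hn4 : (c.1 + 1, c.2 + 1) ∈ meshNodes cells := by
    simp only [meshNodes, Finset.mem_union, Finset.mem_image]
    exact Or.inr ⟨c, hc, rfl⟩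
  have hH1 : c ∈ hEdges cells := by simp [hEdges, hc]
  have hH2 : (c.1, c.2 + 1) ∈ hEdges cells :=
    Finset.mem_union_right _ (Finset.mem_image_of_mem (fun c : ℤ × ℤ => (c.1, c.2 + 1)) hc)
  have hV1 : c ∈ vEdges cells := by simp [vEdges, hc]
  have hV2 : (c.1 + 1, c.2) ∈ vEdges cells :=
    Finset.mem_union_right _ (Finset.mem_image_of_mem (fun c : ℤ × ℤ => (c.1 + 1, c.2)) hc)
  have h0 : ∀ (α : ℝ) (β y z : ℝ), phiHat κ α β 0 (y, z) = 0 := fun α β y z => by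
    rw [phiHat_eq hκ]; simp [sineMode]
  simp only [meshApprox, Pi.add_apply, Finset.sum_apply, Pi.smul_apply, smul_eq_mul,
    phiEdgeH_eq hh1 hh2 hc hx, phiEdgeV_eq hh1 hh2 hc hx, psiNode_eq hκ hh1 hh2 hx]
  rw [Finset.sum_range_succ', show cellTerm κ h1 h2 (αH c) (αH (c.1, c.2 + 1)) (αV c)
    (αV (c.1 + 1, c.2)) 0 (localPt h1 h2 c x) = 0 by simp [cellTerm, h0, localPt], add_zero,
    Finset.sum_comm, Finset.sum_comm (s := hEdges cells), Finset.sum_comm (s := vEdges cells),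
    add_assoc, ← Finset.sum_add_distrib, cornerSum]
  congr 1
  · refine Finset.sum_congr rfl fun m _ => ?_
    simp_rw [← mul_assoc, div_mul_cancel₀ _ (hs m), mul_add, Finset.sum_add_distrib, mul_ite,
      mul_zero, Finset.sum_ite_eq', hn1, hn2, hn3, hn4, if_true]
  · refine Finset.sum_congr rfl fun n _ => ?_
    simp_rw [mul_add, Finset.sum_add_distrib, mul_ite, mul_zero, Finset.sum_ite_eq', hH1, hH2, hV1,
      hV2, if_true, cellTerm]
    ring

lemma NodeFit.shift {N : ℕ} {D : ℕ → ℕ → ℝ × ℝ → ℂ} {p q b : ℝ × ℝ} {a : ℕ → ℂ} {B : ℝ}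
    (hf : NodeFit κ h1 N D q a B) (hq : q = (b.1 + p.1, b.2 + p.2)) :
    NodeFit κ h1 N (shiftJet D b) p a B := by
  subst hq
  exact ⟨hf.horiz, hf.vert, hf.le⟩

/-- Pointwise approximation on all cells by one element of the combined space. -/
lemma exists_combinedSpace_bound {τ M0 Q S : ℝ} (hκ : 0 < κ) (hh2 : 0 < h2)
    (h21 : h2 ≤ h1) {Ω : Set (ℝ × ℝ)} (hT : IsTessellation h1 h2 cells Ω) (hA : A0cond κ h1 h2)
    (hA2 : A2cond κ h1 h2) (hτ : 1 ≤ τ) {Ne N : ℕ}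
    (hν : ∀ m < N + 1, nodeNu (κ * h1) m ≤ τ) (hQ1 : 1 ≤ Q)
    (hQ : ∀ m, ∀ x ∈ Icc 0 h2,
      ‖Complex.cos (freqV κ h1 m * x) / Complex.sin (freqV κ h1 m * h2)‖ ≤ Q)
    {u : ℝ × ℝ → ℂ} (hu : AnalyticHelmholtz κ Ω u) (hM0 : 0 ≤ M0)
    (hM : ∀ c ∈ cells, ∀ i j, i + j ≤ 2 * N + 1 → ∀ p ∈ cellC h1 h2 c,
      ‖pdM i j u p‖ ≤ κ ^ (i + j) * M0)
    (hn : κ * h1 ≤ (Ne + 1 : ℕ) * π)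
    (hS : HasSum (fun k => 2 * (κ * h1 / ((k + (Ne + 1) : ℕ) * π)) ^ (2 * N + 1) *
      edgeAmp N τ M0 (((N + 1 : ℕ) : ℝ) * (∏ k ∈ Finset.range (N + 1),
        (1 + 1 / nodeNu (κ * h1) k ^ 2)) * M0) Q * (((k + (Ne + 1) : ℕ) : ℝ) * π + 1)) S) :
    ∃ v ∈ combinedSpace κ h1 h2 cells Ne (N + 1), ∀ c ∈ cells, ∀ x ∈ cellO h1 h2 c,
      ‖(u - v) x‖ ≤ 4 * S ∧ ‖pd1 (u - v) x‖ ≤ 4 * S / h2 ∧ ‖pd2 (u - v) x‖ ≤ 4 * S / h2 := by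
  have hh1 := hh2.trans_le h21
  have hJ := hu.jet hT.isOpen
  set Mc := ((N + 1 : ℕ) : ℝ) * (∏ k ∈ Finset.range (N + 1),
        (1 + 1 / nodeNu (κ * h1) k ^ 2)) * M0
  have hfit : ∀ p : ℤ × ℤ, ∃ a, p ∈ meshNodes cells →
      NodeFit κ h1 (N + 1) (fun i j => pdM i j u) (nodePt h1 h2 p) a Mc := by
    intro p
    by_cases hp : p ∈ meshNodes cells
    · obtain ⟨c, hc, hpc⟩ := exists_nodePt_mem_cellC hh1 hh2 hp
      obtain ⟨a, ha⟩ := hJ.exists_nodeFit hκ hh1 (hT.cellC_subset hc hpc) (N := N + 1) hM0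
        fun i hi => by simpa using hM c hc (2 * i) 0 (by omega) _ hpc
      exact ⟨a, fun _ => ha⟩
    · exact ⟨0, fun h => absurd h hp⟩
  choose a ha using hfit
  set αH : ℤ × ℤ → ℕ → ℂ := fun e => edgeCoef (N + 1) (freqH κ h1) h1 (a e) (a (e.1 + 1, e.2))
    fun s => u (e.1 * h1 + s, e.2 * h2) with hαH
  set αV : ℤ × ℤ → ℕ → ℂ := fun e => edgeCoef (N + 1) (freqV κ h1) h2 (a e) (a (e.1, e.2 + 1))
    fun s => u (e.1 * h1, e.2 * h2 + s) with hαV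
  refine ⟨meshApprox κ h1 h2 cells Ne (N + 1) a αH αV, meshApprox_mem _ _ _ _ _ _ _ _ _, ?_⟩
  intro c hc x hx
  set D := shiftJet (fun i j => pdM i j u) (nodePt h1 h2 c) with hD
  have hDJ : HelmholtzJet κ (rectC h1 h2) D :=
    hJ.shift _ fun p hp => hT.cellC_subset hc (add_mem_cellC hp)
  have hcn : ∀ p : ℤ × ℤ, p = c ∨ p = (c.1 + 1, c.2) ∨ p = (c.1, c.2 + 1) ∨
      p = (c.1 + 1, c.2 + 1) → p ∈ meshNodes cells := by
    simp only [meshNodes, Finset.mem_union, Finset.mem_image]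
    rintro p (rfl | rfl | rfl | rfl)
    exacts [Or.inl (Or.inl (Or.inl hc)), Or.inl (Or.inl (Or.inr ⟨c, hc, rfl⟩)),
      Or.inl (Or.inr ⟨c, hc, rfl⟩), Or.inr ⟨c, hc, rfl⟩]
  have f00 : NodeFit κ h1 (N + 1) D (0, 0) (a c) Mc :=
    (ha c (hcn _ (by simp))).shift (by simp)
  have f10 : NodeFit κ h1 (N + 1) D (h1, 0) (a (c.1 + 1, c.2)) Mc :=
    (ha _ (hcn _ (by simp))).shift (by simp [nodePt]; ring)
  have f01 : NodeFit κ h1 (N + 1) D (0, h2) (a (c.1, c.2 + 1)) Mc :=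
    (ha _ (hcn _ (by simp))).shift (by simp [nodePt]; ring)
  have f11 : NodeFit κ h1 (N + 1) D (h1, h2) (a (c.1 + 1, c.2 + 1)) Mc :=
    (ha _ (hcn _ (by simp))).shift (by simp [nodePt]; constructor <;> ring)
  have eB : (fun s => D 0 0 (s, 0)) = fun s => u (c.1 * h1 + s, c.2 * h2) := by
    funext s; simp [hD, shiftJet, nodePt, pdM]
  have eT : (fun s => D 0 0 (s, h2)) = fun s => u (c.1 * h1 + s, ((c.2 + 1 : ℤ) : ℝ) * h2) := by
    funext s; simp only [hD, shiftJet, nodePt, pdM, Function.iterate_zero, id]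
    congr 2; push_cast; ring
  have eL : (fun s => D 0 0 (0, s)) = fun s => u (c.1 * h1, c.2 * h2 + s) := by
    funext s; simp [hD, shiftJet, nodePt, pdM]
  have eR : (fun s => D 0 0 (h1, s)) = fun s => u (((c.1 + 1 : ℤ) : ℝ) * h1, c.2 * h2 + s) := by
    funext s; simp only [hD, shiftJet, nodePt, pdM, Function.iterate_zero, id]
    congr 2; push_cast; ring
  set R : ℝ × ℝ → ℂ := fun p => D 0 0 p -
    cornerSum κ h1 h2 (N + 1) (a c) (a (c.1 + 1, c.2)) (a (c.1, c.2 + 1))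
      (a (c.1 + 1, c.2 + 1)) p - ∑ n ∈ Finset.range (Ne + 1),
        cellTerm κ h1 h2 (αH c) (αH (c.1, c.2 + 1)) (αV c) (αV (c.1 + 1, c.2)) n p with hRdef
  have hRu : ∀ y ∈ cellO h1 h2 c,
      (u - meshApprox κ h1 h2 cells Ne (N + 1) a αH αV) y = R (localPt h1 h2 c y) := by
    intro y hy
    rw [Pi.sub_apply, meshApprox_eq hκ hh1 hh2 hc hy, hRdef, ← sub_sub]
    simp [hD, shiftJet, nodePt, pdM, localPt]
  have hx1 : x.1 - c.1 * h1 ∈ Ioo 0 h1 := ⟨by linarith [hx.1.1], by linarith [hx.1.2]⟩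
  have hx2 : x.2 - c.2 * h2 ∈ Ioo 0 h2 := ⟨by linarith [hx.2.1], by linarith [hx.2.2]⟩
  have key := hDJ.cell_bound hκ hh2 h21 hA hA2 hτ hν hQ1 hQ
    (fun i j hij p hp => hM c hc i j hij _ (add_mem_cellC hp)) f00 f10 f01 f11
    (n0 := Ne + 1) (by omega) hn hS (R := R) (fun p => by rw [eB, eT, eL, eR]) hx1 hx2
  rw [hRu x hx, pd1_congr_of_isOpen (isOpen_cellO h1 h2 c) hRu x hx,
    pd2_congr_of_isOpen (isOpen_cellO h1 h2 c) hRu x hx]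
  simp only [pd1, pd2, localPt]
  rw [deriv_comp_sub_const (f := fun s => R (s, x.2 - c.2 * h2)),
    deriv_comp_sub_const (f := fun s => R (x.1 - c.1 * h1, s))]
  exact key

end MeshApprox

section SobolevBound

variable {κ h1 h2 : ℝ} {cells : Finset (ℤ × ℤ)} {Ω : Set (ℝ × ℝ)}

lemma cellO_ae_eq_cellC (h1 h2 : ℝ) (c : ℤ × ℤ) : cellO h1 h2 c =ᵐ[volume] cellC h1 h2 c := by
  rw [Measure.volume_eq_prod]
  exact Measure.set_prod_ae_eq Ioo_ae_eq_Icc Ioo_ae_eq_Icc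

lemma volume_cellC (hh1 : 0 < h1) (c : ℤ × ℤ) :
    volume (cellC h1 h2 c) = ENNReal.ofReal (h1 * h2) := by
  rw [cellC, Measure.volume_eq_prod, Measure.prod_prod, Real.volume_Icc, Real.volume_Icc,
    ← ENNReal.ofReal_mul (by linarith)]
  congr 1; ring

lemma IsTessellation.volume_le (hT : IsTessellation h1 h2 cells Ω) (hh1 : 0 < h1) :
    volume Ω ≤ ENNReal.ofReal (cells.card * (h1 * h2)) := by
  calc volume Ω ≤ volume (⋃ c ∈ cells, cellC h1 h2 c) := by
        rw [← hT.2.2]; exact measure_mono subset_closure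
    _ ≤ ∑ c ∈ cells, volume (cellC h1 h2 c) := measure_biUnion_finset_le _ _
    _ = ENNReal.ofReal (cells.card * (h1 * h2)) := by
        simp_rw [volume_cellC hh1, Finset.sum_const, nsmul_eq_mul]
        rw [ENNReal.ofReal_mul (p := (cells.card : ℝ)) (Nat.cast_nonneg _), ENNReal.ofReal_natCast]

lemma IsTessellation.ae_mem_cellO (hT : IsTessellation h1 h2 cells Ω) :
    ∀ᵐ x, x ∈ Ω → ∃ c ∈ cells, x ∈ cellO h1 h2 c := by
  have h : ∀ᵐ x, ∀ c : ℤ × ℤ, x ∈ cellC h1 h2 c → x ∈ cellO h1 h2 c :=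
    ae_all_iff.mpr fun c => (cellO_ae_eq_cellC h1 h2 c).symm.le
  filter_upwards [h] with x hx hxΩ
  have h' := subset_closure hxΩ
  rw [hT.2.2] at h'
  simp only [mem_iUnion, exists_prop] at h'
  obtain ⟨c, hc, hxc⟩ := h'
  exact ⟨c, hc, hx c hxc⟩

lemma IsTessellation.setIntegral_norm_sq_le (hT : IsTessellation h1 h2 cells Ω) (hh1 : 0 < h1)
    (hh2 : 0 < h2) {f : ℝ × ℝ → ℂ} {B : ℝ} (hB : ∀ c ∈ cells, ∀ x ∈ cellO h1 h2 c, ‖f x‖ ≤ B) :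
    ∫ x in Ω, ‖f x‖ ^ 2 ≤ B ^ 2 * (cells.card * (h1 * h2)) := by
  have hv := hT.volume_le hh1
  have hlt : volume Ω < ⊤ := hv.trans_lt ENNReal.ofReal_lt_top
  have h := norm_setIntegral_le_of_norm_le_const_ae' (f := fun x => ‖f x‖ ^ 2) (C := B ^ 2) hlt (by
    filter_upwards [hT.ae_mem_cellO] with x hx hxΩ
    obtain ⟨c, hc, hxc⟩ := hx hxΩ
    rw [Real.norm_eq_abs, abs_of_nonneg (by positivity)]
    exact pow_le_pow_left₀ (norm_nonneg _) (hB c hc x hxc) 2)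
  refine (le_abs_self _).trans (h.trans (mul_le_mul_of_nonneg_left ?_ (sq_nonneg B)))
  exact ENNReal.toReal_le_of_le_ofReal (by positivity) hv

lemma IsTessellation.sobNorm_le (hT : IsTessellation h1 h2 cells Ω) (hκ : 0 < κ) (hh1 : 0 < h1)
    (hh2 : 0 < h2) {r : ℕ} (hr : r ≤ 1) {f : ℝ × ℝ → ℂ} {B : ℝ} (hB0 : 0 ≤ B)
    (hB : ∀ c ∈ cells, ∀ x ∈ cellO h1 h2 c,
      ‖f x‖ ≤ B ∧ ‖pd1 f x‖ ≤ B / h2 ∧ ‖pd2 f x‖ ≤ B / h2) :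
    sobNorm κ r Ω f ≤
      2 * ((meshNodes cells).card * Real.sqrt (h1 * h2) * (B * (1 + 1 / (κ * h2)))) := by
  set L := B * (1 + 1 / (κ * h2)) with hL
  set V := (cells.card : ℝ) * (h1 * h2) with hV
  have hL0 : 0 ≤ L := by positivity
  have hBL : B ≤ L := le_mul_of_one_le_right hB0 (by
    have : 0 ≤ 1 / (κ * h2) := by positivity
    linarith)
  have hBL' : B / h2 ≤ κ * L := by
    rw [hL, show κ * (B * (1 + 1 / (κ * h2))) = κ * B + B / h2 by field_simp]
    have : 0 ≤ κ * B := by positivity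
    linarith
  have hterm : ∀ p ∈ idxLe 1,
      (κ ^ (2 * (p.1 + p.2)))⁻¹ * ∫ x in Ω, ‖pdM p.1 p.2 f x‖ ^ 2 ≤ L ^ 2 * V := by
    intro p hp
    have hb : ∀ c ∈ cells, ∀ x ∈ cellO h1 h2 c, ‖pdM p.1 p.2 f x‖ ≤ κ ^ (p.1 + p.2) * L := by
      intro c hc x hx
      obtain ⟨b0, b1, b2⟩ := hB c hc x hx
      obtain ⟨i, j⟩ := p
      simp only [idxLe, Finset.mem_filter, Finset.mem_product, Finset.mem_range] at hp
      have : (i = 0 ∧ j = 0) ∨ (i = 1 ∧ j = 0) ∨ (i = 0 ∧ j = 1) := by omega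
      rcases this with ⟨rfl, rfl⟩ | ⟨rfl, rfl⟩ | ⟨rfl, rfl⟩
      · simpa [pdM] using b0.trans hBL
      · simpa [pdM] using b1.trans hBL'
      · simpa [pdM] using b2.trans hBL'
    rw [inv_mul_le_iff₀ (by positivity)]
    refine (hT.setIntegral_norm_sq_le hh1 hh2 hb).trans (le_of_eq ?_)
    rw [mul_pow, ← pow_mul]; ring
  have hsub : idxLe r ⊆ idxLe 1 := by
    intro p
    simp only [idxLe, Finset.mem_filter, Finset.mem_product, Finset.mem_range]
    omega
  have hcard : (idxLe 1).card = 3 := by decide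
  have hsq : sobNormSq κ r Ω f ≤ 3 * (L ^ 2 * V) := by
    calc sobNormSq κ r Ω f ≤ sobNormSq κ 1 Ω f :=
          Finset.sum_le_sum_of_subset_of_nonneg hsub fun p _ _ =>
            mul_nonneg (by positivity) (integral_nonneg fun x => by positivity)
      _ ≤ (idxLe 1).card • (L ^ 2 * V) := Finset.sum_le_card_nsmul _ _ _ hterm
      _ = 3 * (L ^ 2 * V) := by rw [hcard]; simp
  have hm : (cells.card : ℝ) ≤ (meshNodes cells).card := by
    exact_mod_cast Finset.card_le_card fun c hc => by simp [meshNodes, hc]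
  have hm1 : (1 : ℝ) ≤ (meshNodes cells).card := by
    refine le_trans ?_ hm
    exact_mod_cast hT.1.card_pos
  rw [sobNorm]
  refine Real.sqrt_le_iff.mpr ⟨by positivity, hsq.trans ?_⟩
  have e : (2 * ((meshNodes cells).card * Real.sqrt (h1 * h2) * L)) ^ 2 =
      4 * ((meshNodes cells).card ^ 2 * (h1 * h2) * L ^ 2) := by
    rw [← Real.sq_sqrt (x := h1 * h2) (by positivity), Real.sqrt_sq (Real.sqrt_nonneg _)]; ring
  rw [e, hV]
  clear_value L
  have hmm : (cells.card : ℝ) ≤ ((meshNodes cells).card : ℝ) ^ 2 := by nlinarith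
  have h12 : 0 ≤ L ^ 2 * (h1 * h2) := by positivity
  nlinarith [mul_le_mul_of_nonneg_right hmm h12,
    mul_nonneg (sq_nonneg ((meshNodes cells).card : ℝ)) h12]

end SobolevBound

lemma exists_hasSum_tail_le {t τ A : ℝ} (ht : 0 < t) (hτ : 1 ≤ τ) (hA : 0 ≤ A) {Ne N : ℕ}
    (hNe1 : 1 ≤ Ne) (hNe : (Ne : ℝ) = τ / π * t) (hN : 1 ≤ N) :
    ∃ S, HasSum (fun k : ℕ => 2 * (t / ((k + (Ne + 1) : ℕ) * π)) ^ (2 * N + 1) * A *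
        (((k + (Ne + 1) : ℕ) : ℝ) * π + 1)) S ∧ S ≤ 4 * A * t * Ne * (τ ^ (2 * N))⁻¹ := by
  have hπ := Real.pi_pos
  have hNe0 : (0 : ℝ) < Ne := by exact_mod_cast hNe1
  have htNe : t = Ne * π / τ := by rw [hNe]; field_simp
  set B := 4 * A * t * (τ ^ (2 * N))⁻¹ with hB
  have hB0 : 0 ≤ B := by positivity
  set g : ℕ → ℝ := fun k => 2 * (t / ((k + (Ne + 1) : ℕ) * π)) ^ (2 * N + 1) * A *
        (((k + (Ne + 1) : ℕ) : ℝ) * π + 1) with hg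
  have hg0 : ∀ k, 0 ≤ g k := fun k => by simp only [hg]; positivity
  have hgle : ∀ k : ℕ, g k ≤ B * (Ne ^ 2 * (1 / ((k : ℝ) + Ne) - 1 / ((k : ℝ) + Ne + 1))) := by
    intro k
    have hcast : ((k + (Ne + 1) : ℕ) : ℝ) = (k : ℝ) + Ne + 1 := by push_cast; ring
    set n : ℝ := (k : ℝ) + Ne + 1 with hn
    have hk0 : (0 : ℝ) ≤ k := Nat.cast_nonneg k
    have hn1 : 1 ≤ n := by linarith
    have hnNe : Ne / n ≤ 1 := by rw [div_le_one (by linarith)]; linarith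
    have hnπ : 1 ≤ n * π := by nlinarith [Real.pi_gt_three]
    have e1 : t / (n * π) = Ne / n / τ := by rw [htNe]; field_simp
    have e2 : (Ne / n) ^ (2 * N) ≤ (Ne / n) ^ 2 :=
      pow_le_pow_of_le_one (by positivity) hnNe (by omega)
    have e3 : (Ne / n) ^ 2 ≤ Ne ^ 2 * (1 / ((k : ℝ) + Ne) - 1 / n) := by
      have hkNe : (k : ℝ) + Ne = n - 1 := by rw [hn]; ring
      have hkpos : 0 < n - 1 := by rw [← hkNe]; linarith
      rw [hkNe, div_pow, div_eq_mul_one_div]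
      gcongr
      rw [div_sub_div _ _ hkpos.ne' (by linarith), div_le_div_iff₀ (by positivity) (by positivity)]
      nlinarith
    simp only [hg, hcast]
    calc 2 * (t / (n * π)) ^ (2 * N + 1) * A * (n * π + 1)
        ≤ 2 * (t / (n * π)) ^ (2 * N + 1) * A * (2 * (n * π)) := by gcongr; linarith
      _ = 4 * A * t * (t / (n * π)) ^ (2 * N) := by rw [pow_succ]; field_simp; ring
      _ = B * (Ne / n) ^ (2 * N) := by rw [e1, div_pow _ τ, hB]; field_simp
      _ ≤ _ := by gcongr; exact e2.trans e3
  have hsum : ∀ K : ℕ, ∑ k ∈ Finset.range K, g k ≤ B * Ne := by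
    intro K
    have h : ∀ K : ℕ, ∑ k ∈ Finset.range K, (1 / ((k : ℝ) + Ne) - 1 / ((k : ℝ) + Ne + 1)) =
        1 / Ne - 1 / ((K : ℝ) + Ne) := by
      intro K
      induction K with
      | zero => simp
      | succ K ih => rw [Finset.sum_range_succ, ih]; push_cast; ring
    calc ∑ k ∈ Finset.range K, g k ≤ ∑ k ∈ Finset.range K, _ :=
          Finset.sum_le_sum fun k _ => hgle k
      _ = B * (Ne ^ 2 * (1 / Ne - 1 / ((K : ℝ) + Ne))) := by
          rw [← Finset.mul_sum, ← Finset.mul_sum, h]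
      _ ≤ B * (Ne ^ 2 * (1 / Ne)) := by
          have : 0 ≤ 1 / ((K : ℝ) + Ne) := by positivity
          gcongr; linarith
      _ = B * Ne := by field_simp
  refine ⟨_, (summable_of_sum_range_le hg0 hsum).hasSum,
    (Real.tsum_le_of_sum_range_le hg0 hsum).trans (le_of_eq ?_)⟩
  rw [hB]; ring

lemma exists_pow_div_pow_le {q a : ℝ} (hq : 1 < q) (ha : 0 < a) :
    ∃ Γ > 0, ∀ t : ℝ, 0 ≤ t → ∀ N : ℕ, (N : ℝ) = a * t → t ^ 5 * (q ^ N)⁻¹ ≤ Γ := by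
  set γ := Real.log q * a with hγ
  have hγ0 : 0 < γ := mul_pos (Real.log_pos hq) ha
  refine ⟨120 / γ ^ 5, by positivity, fun t ht N hN => ?_⟩
  have h := Real.pow_div_factorial_le_exp (γ * t) (by positivity) 5
  have e : Real.exp (γ * t) = q ^ N := by
    rw [hγ, mul_assoc, ← hN, Real.exp_mul, Real.exp_log (by linarith), Real.rpow_natCast]
  rw [e, show ((Nat.factorial 5 : ℕ) : ℝ) = 120 by norm_num [Nat.factorial]] at h
  have hqN : 0 < q ^ N := by positivity
  rw [← div_eq_mul_inv, div_le_div_iff₀ hqN (by positivity)]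
  rw [div_le_iff₀ (by norm_num), mul_pow] at h
  linarith

lemma pow_mul_exp_le_rpow {ρ τe τn t : ℝ} (hρ : 1 ≤ ρ) (hτe : 1 ≤ τe) (hτn : 1 ≤ τn) {N : ℕ}
    (hN : ((N + 1 : ℕ) : ℝ) = τn / π * t) :
    τn ^ (2 * N + 1) * (τe ^ (2 * N))⁻¹ * Real.exp t ≤
      τe ^ 2 * (τe / (ρ * τn) * Real.exp (-(π / (2 * τn)))) ^ (-(2 / π * τn * t)) := by
  have hπ := Real.pi_pos
  have hb : 0 < τe / (ρ * τn) := by positivity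
  have hexp : -(2 / π * τn * t) = -((2 * (N + 1) : ℕ) : ℝ) := by
    push_cast at hN ⊢; rw [hN]; ring
  have e1 : Real.exp (-(π / (2 * τn))) ^ (-(2 / π * τn * t)) = Real.exp t := by
    rw [← Real.exp_mul]; congr 1; field_simp
  rw [Real.mul_rpow hb.le (Real.exp_pos _).le, e1, hexp, Real.rpow_neg hb.le, Real.rpow_natCast,
    ← inv_pow (τe / (ρ * τn)), inv_div, ← mul_assoc]
  refine mul_le_mul_of_nonneg_right ?_ (Real.exp_pos _).le
  calc τn ^ (2 * N + 1) * (τe ^ (2 * N))⁻¹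
      ≤ τn ^ (2 * (N + 1)) * (τe ^ (2 * N))⁻¹ := by
        gcongr ?_ * _; exact pow_le_pow_right₀ hτn (by omega)
    _ = τe ^ 2 * (τn / τe) ^ (2 * (N + 1)) := by
        rw [div_pow, show 2 * (N + 1) = 2 * N + 2 by ring, pow_add τe]; field_simp
    _ ≤ τe ^ 2 * (ρ * τn / τe) ^ (2 * (N + 1)) := by
        gcongr; exact le_mul_of_one_le_left (by linarith) hρ

lemma edgeAmp_le {N : ℕ} {τ M0 P Q : ℝ} (hτ : 1 ≤ τ) (hM0 : 0 ≤ M0) (hP : 1 ≤ P) (hQ : 1 ≤ Q) :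
    edgeAmp N τ M0 (((N + 1 : ℕ) : ℝ) * P * M0) Q ≤
      3 * ((N + 1 : ℕ) : ℝ) ^ 2 * P * M0 * τ ^ (2 * N + 1) * Q := by
  have hn : (1 : ℝ) ≤ ((N + 1 : ℕ) : ℝ) := by exact_mod_cast Nat.succ_pos N
  have hτ' : 1 ≤ τ ^ (2 * N + 1) := one_le_pow₀ hτ
  have h : 1 ≤ ((N + 1 : ℕ) : ℝ) ^ 2 * P * τ ^ (2 * N + 1) * Q :=
    one_le_mul_of_one_le_of_one_le (one_le_mul_of_one_le_of_one_le
      (one_le_mul_of_one_le_of_one_le (one_le_pow₀ hn) hP) hτ') hQ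
  have h' := le_mul_of_one_le_left hM0 h
  have e : edgeAmp N τ M0 (((N + 1 : ℕ) : ℝ) * P * M0) Q =
      M0 + 2 * (((N + 1 : ℕ) : ℝ) ^ 2 * P * τ ^ (2 * N + 1) * Q * M0) := by
    unfold edgeAmp; push_cast; ring
  rw [e]
  linarith

lemma sqrt_mul_sqrt_cell_le {κ h1 h2 H : ℝ} (hκ : 0 < κ) (hh2 : 0 < h2) (h21 : h2 ≤ h1)
    (hH : 0 ≤ H) (ht : 1 ≤ κ * h1) :
    Real.sqrt (h1 * h2) * (Real.sqrt ((1 / h1 + κ) * (1 / h2 + κ)) * H) ≤ 2 * (κ * h1) * H := by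
  have hh1 := hh2.trans_le h21
  rw [← mul_assoc, ← Real.sqrt_mul (by positivity)]
  refine mul_le_mul_of_nonneg_right (Real.sqrt_le_iff.mpr ⟨by positivity, ?_⟩) hH
  have e : h1 * h2 * ((1 / h1 + κ) * (1 / h2 + κ)) = (1 + κ * h1) * (1 + κ * h2) := by field_simp
  have h : κ * h2 ≤ κ * h1 := by gcongr
  have h0 : 0 < κ * h2 := by positivity
  rw [e]
  nlinarith

/-- Collecting the factors of the best approximation error. -/
lemma error_factors_le {ρ τe τn t Q0 Γ s M0 H Y P Q S A ne q d mn : ℝ} {N : ℕ} (hρ : 1 ≤ ρ)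
    (hτe : 1 ≤ τe) (hτn : 1 ≤ τn) (ht : 1 ≤ t) (hQ0 : 0 ≤ Q0) (hs : 0 ≤ s) (hM0 : 0 ≤ M0)
    (hH : 0 ≤ H) (hmn : 0 ≤ mn) (hP1 : 1 ≤ P) (hQ1 : 1 ≤ Q) (hne : 0 ≤ ne) (hq : 0 < q)
    (hsM : s * M0 ≤ 2 * t * H) (hS : S ≤ 4 * A * t * ne * (τe ^ (2 * N))⁻¹)
    (hA : A ≤ 3 * ((N + 1 : ℕ) : ℝ) ^ 2 * P * M0 * τn ^ (2 * N + 1) * Q)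
    (hP : P ≤ 5 * t ^ 2 * Real.exp t * (q ^ (N + 1))⁻¹) (hQ : Q ≤ Q0 * t ^ 3)
    (hnet : ne ≤ τe * t) (hnt : ((N + 1 : ℕ) : ℝ) ≤ τn * t) (hd0 : 0 ≤ d) (hd : d ≤ 1 + ρ)
    (hY : τn ^ (2 * N + 1) * (τe ^ (2 * N))⁻¹ * Real.exp t ≤ τe ^ 2 * Y)
    (hΓ : t ^ 5 * (q ^ (N + 1))⁻¹ ≤ Γ) :
    2 * (mn * s * (4 * S * d)) ≤
      960 * (1 + ρ) * τe ^ 3 * τn ^ 2 * Q0 * Γ * mn * t ^ 5 * Y * H := by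
  set n : ℝ := ((N + 1 : ℕ) : ℝ) with hn
  have hn0 : 0 ≤ n := Nat.cast_nonneg _
  calc 2 * (mn * s * (4 * S * d))
      ≤ 2 * (mn * s * (4 * (4 * (3 * n ^ 2 * P * M0 * τn ^ (2 * N + 1) * Q) * t * ne *
          (τe ^ (2 * N))⁻¹) * d)) := by
        gcongr
        refine hS.trans ?_
        gcongr
    _ = 96 * mn * t * d * (s * M0) * ne * n ^ 2 * P * Q *
          (τn ^ (2 * N + 1) * (τe ^ (2 * N))⁻¹) := by ring
    _ ≤ 96 * mn * t * (1 + ρ) * (2 * t * H) * (τe * t) * (τn * t) ^ 2 *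
          (5 * t ^ 2 * Real.exp t * (q ^ (N + 1))⁻¹) * (Q0 * t ^ 3) *
          (τn ^ (2 * N + 1) * (τe ^ (2 * N))⁻¹) := by gcongr
    _ = 960 * (1 + ρ) * τe * τn ^ 2 * Q0 * (t ^ 5 * (q ^ (N + 1))⁻¹) * mn * t ^ 5 *
          (τn ^ (2 * N + 1) * (τe ^ (2 * N))⁻¹ * Real.exp t) * H := by ring
    _ ≤ 960 * (1 + ρ) * τe * τn ^ 2 * Q0 * Γ * mn * t ^ 5 * (τe ^ 2 * Y) * H := by
        have : 0 ≤ Γ := le_trans (by positivity) hΓ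
        gcongr
    _ = _ := by ring

/-- Corollary 5.4, high-frequency regime for analytic solutions:
if `ρ² ∈ ℚ`, `K` is unbounded with `D̃(ρ,t) ≲ t²` on `K`, `τ_e, τ_n ≥ 1` with
`η = (τ_e/(ρτ_n))e^{−π/(2τ_n)} > 1`, then with `N_e = (τ_e/π)κh`, `N_n = (τ_n/π)κh`,
for every analytic Helmholtz solution `u` and all sufficiently large `κh ∈ K`, the
best-approximation error decays geometrically in `κh`. -/
theorem high_frequency_analytic_convergence (ρ : ℝ) (hρ : 1 ≤ ρ)
    (hq : ∃ q : ℚ, ρ ^ 2 = (q : ℝ)) (r : ℕ) (hr : r ≤ 1)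
    (K : Set ℝ) (hK0 : K ⊆ Ioi (0 : ℝ)) (hKunb : ∀ b : ℝ, ∃ t ∈ K, b < t)
    (hKsup : ∃ C' : ℝ≥0∞, C' ≠ ⊤ ∧ ∀ t ∈ K, DT ρ t ≤ C' * ENNReal.ofReal (t ^ 2))
    (τe τn : ℝ) (hτe : 1 ≤ τe) (hτn : 1 ≤ τn)
    (hη : 1 < τe / (ρ * τn) * Real.exp (-(π / (2 * τn)))) :
    ∃ C > (0 : ℝ), ∃ T : ℝ, ∀ κ h1 h2 : ℝ, 0 < κ → 0 < h2 → h2 ≤ h1 →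
      h1 / h2 = ρ →
      ∀ (cells : Finset (ℤ × ℤ)) (Ω : Set (ℝ × ℝ)), IsTessellation h1 h2 cells Ω →
      A0cond κ h1 h2 → A2cond κ h1 h2 →
      κ * h1 ∈ K → T ≤ κ * h1 →
      ∀ Ne Nn : ℕ, 1 ≤ Ne → 1 ≤ Nn →
        (Ne : ℝ) = τe / π * (κ * h1) → (Nn : ℝ) = τn / π * (κ * h1) →
      ∀ u : ℝ × ℝ → ℂ, AnalyticHelmholtz κ Ω u →
        sInf {E : ℝ | ∃ v ∈ combinedSpace κ h1 h2 cells Ne Nn, E = sobNorm κ r Ω (u - v)} ≤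
          C * ((meshNodes cells).card : ℝ) * (κ * h1) ^ (5 : ℕ) *
            (τe / (ρ * τn) * Real.exp (-(π / (2 * τn)))) ^ (-(2 / π * τn * (κ * h1))) *
            sobNorm κ (2 * Nn + 1) Ω u := by
  obtain ⟨C', hC', hDTK⟩ := hKsup
  have hπ := Real.pi_pos
  set c' := C'.toReal with hc'
  have hc0 : 0 ≤ c' := ENNReal.toReal_nonneg
  have hq1 : 1 < 1 + 1 / (4 * τn ^ 2) := by
    have : 0 < 1 / (4 * τn ^ 2) := by positivity
    linarith
  obtain ⟨Γ, hΓ0, hΓ⟩ := exists_pow_div_pow_le hq1 (show 0 < τn / π by positivity)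
  set q := 1 + 1 / (4 * τn ^ 2) with hqdef
  set Q0 := 1 + 2 * ρ * c' + ρ * c' ^ 2 with hQ0
  have hQ0pos : 0 < Q0 := by positivity
  refine ⟨960 * (1 + ρ) * τe ^ 3 * τn ^ 2 * Q0 * Γ, by positivity, 7, ?_⟩
  intro κ h1 h2 hκ hh2 h21 hρ' cells Ω hT hA hA2 htK hT7 Ne Nn hNe1 hNn1 hNe hNn u hu
  have hh1 := hh2.trans_le h21
  have ht1 : 1 ≤ κ * h1 := by linarith
  have ht0 : 0 < κ * h1 := by linarith
  have hNn2 : (2 : ℝ) ≤ Nn := by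
    rw [hNn, div_mul_eq_mul_div, le_div_iff₀ hπ]
    nlinarith [Real.pi_lt_d2]
  obtain ⟨N, rfl⟩ : ∃ N, Nn = N + 1 := ⟨Nn - 1, by omega⟩
  have hN1 : 1 ≤ N := by
    have : 2 ≤ N + 1 := by exact_mod_cast hNn2
    omega
  set H := sobNorm κ (2 * (N + 1) + 1) Ω u with hH
  have hH0 : 0 ≤ H := Real.sqrt_nonneg _
  set M0 := Real.sqrt ((1 / h1 + κ) * (1 / h2 + κ)) * H with hM0
  have hM00 : 0 ≤ M0 := by positivity
  have hM : ∀ c ∈ cells, ∀ i j, i + j ≤ 2 * N + 1 → ∀ p ∈ cellC h1 h2 c,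
      ‖pdM i j u p‖ ≤ κ ^ (i + j) * M0 := by
    intro c hc i j hij p hp
    have h := norm_pdM_le_sobNorm (M := 2 * (N + 1) + 1) (i := i) (j := j) hκ
      (show (c.1 : ℝ) * h1 < ((c.1 : ℝ) + 1) * h1 by linarith)
      (show (c.2 : ℝ) * h2 < ((c.2 : ℝ) + 1) * h2 by linarith)
      (hu.jet hT.isOpen) hT.isCompact_closure (hT.cellC_subset hc) (hT.cellO_subset hc)
      (by omega) hp
    rwa [show ((c.1 : ℝ) + 1) * h1 - c.1 * h1 = h1 by ring,
      show ((c.2 : ℝ) + 1) * h2 - c.2 * h2 = h2 by ring] at h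
  set P := ∏ k ∈ Finset.range (N + 1), (1 + 1 / nodeNu (κ * h1) k ^ 2) with hP
  have hP1 : 1 ≤ P := Finset.one_le_prod fun k _ => by
    have : 0 ≤ 1 / nodeNu (κ * h1) k ^ 2 := by positivity
    linarith
  have hPle : P ≤ 5 * (κ * h1) ^ 2 * Real.exp (κ * h1) * (q ^ (N + 1))⁻¹ := by
    refine (prod_nodeNu_le ht1 hτn hNn hNn1).trans ?_
    gcongr
    nlinarith
  have hDT : DT (h1 / h2) (κ * h1) ≤ C' * ENNReal.ofReal ((κ * h1) ^ 2) := hρ' ▸ hDTK _ htK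
  set Q := 1 + 2 * ρ * c' * (κ * h1) + ρ * c' ^ 2 * (κ * h1) ^ 3 with hQdef
  have hQ1 : 1 ≤ Q := by
    have : 0 ≤ 2 * ρ * c' * (κ * h1) + ρ * c' ^ 2 * (κ * h1) ^ 3 := by positivity
    linarith
  have hQ : ∀ m, ∀ x ∈ Icc 0 h2,
      ‖Complex.cos (freqV κ h1 m * x) / Complex.sin (freqV κ h1 m * h2)‖ ≤ Q := fun m x hx => by
    have h := norm_cos_div_sin_node_vert_le hκ hh1 hh2 hC' hDT hA2 m hx
    rwa [hρ'] at h
  have hQle : Q ≤ Q0 * (κ * h1) ^ 3 := by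
    have h13 : 1 ≤ (κ * h1) ^ 3 := one_le_pow₀ ht1
    have h33 : κ * h1 ≤ (κ * h1) ^ 3 := le_self_pow₀ ht1 (by norm_num)
    have := mul_le_mul_of_nonneg_left h33 (show 0 ≤ 2 * ρ * c' by positivity)
    linarith
  have hAmp0 : 0 ≤ edgeAmp N τn M0 (((N + 1 : ℕ) : ℝ) * P * M0) Q := by
    unfold edgeAmp; positivity
  obtain ⟨S, hS, hSle⟩ := exists_hasSum_tail_le ht0 hτe hAmp0 hNe1 hNe hN1
  have hn : κ * h1 ≤ (Ne + 1 : ℕ) * π := by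
    have e : (Ne : ℝ) * π = τe * (κ * h1) := by rw [hNe]; field_simp
    push_cast
    nlinarith
  obtain ⟨v, hv, hvB⟩ := exists_combinedSpace_bound hκ hh2 h21 hT hA hA2 hτn
    (fun m hm => nodeNu_le ht0 hNn hm) hQ1 hQ hu hM00 hM hn hS
  have hS0 : 0 ≤ S := hS.nonneg fun k => by positivity
  have hd : 1 / (κ * h2) ≤ ρ := by
    rw [div_le_iff₀ (by positivity), ← hρ', show h1 / h2 * (κ * h2) = κ * h1 by field_simp]
    exact ht1
  have hle : ∀ τ : ℝ, 1 ≤ τ → τ / π * (κ * h1) ≤ τ * (κ * h1) := fun τ hτ => by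
    gcongr
    exact div_le_self (by linarith) (by linarith [Real.pi_gt_three])
  refine le_trans (csInf_le ⟨0, ?_⟩ ⟨v, hv, rfl⟩)
    ((hT.sobNorm_le hκ hh1 hh2 hr (by positivity) hvB).trans ?_)
  · rintro _ ⟨w, -, rfl⟩
    exact Real.sqrt_nonneg _
  · exact error_factors_le hρ hτe hτn ht1 hQ0pos.le (Real.sqrt_nonneg _) hM00 hH0
      (Nat.cast_nonneg _) hP1 hQ1 (Nat.cast_nonneg _) (by linarith)
      (sqrt_mul_sqrt_cell_le hκ hh2 h21 hH0 ht1) hSle (edgeAmp_le hτn hM00 hP1 hQ1) hPle hQle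
      (hNe.le.trans (hle τe hτe)) (hNn.le.trans (hle τn hτn)) (by positivity) (by linarith)
      (pow_mul_exp_le_rpow hρ hτe hτn hNn) (hΓ _ ht0.le _ hNn)

end
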